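/- (Rigidity of spacetimes in the disk.) Let T > 0, let D ⊆ ℂ be the open unit disk, and let (𝓜, u) be a conformal Ricci flow spacetime in the ambient space D × (0,T) which is complete, expanding, continuous and initially determined, and whose slices exhaust the disk: ⋃_{t ∈ (0,T)} 𝓜_t = D. Then 𝓜 = D × (0,T). -/

import Mathlib

open Set MeasureTheory Filter Metric

/-- The Euclidean Laplacian of `f : ℂ → ℝ` at `z`, i.e. `∂²f/∂x² + ∂²f/∂y²`. -/
noncomputable def lap (f : ℂ → ℝ) (z : ℂ) : ℝ :=
  iteratedFDeriv ℝ 2 f z ![1, 1] + iteratedFDeriv ℝ 2 f z ![Complex.I, Complex.I]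

/-- The time-timeSlice of a spacetime `M ⊆ ℂ × ℝ` at time `t`. -/
def timeSlice (M : Set (ℂ × ℝ)) (t : ℝ) : Set ℂ := {z | (z, t) ∈ M}

/-- The conformal distance on `Ω` induced by a conformal factor `v`: the infimum of
`v`-lengths of `C¹` paths in `Ω` joining `x` to `y`. -/
noncomputable def confDist (v : ℂ → ℝ) (Ω : Set ℂ) (x y : ℂ) : ℝ :=
  sInf {L : ℝ | ∃ γ : ℝ → ℂ, ContDiffOn ℝ 1 γ (Icc 0 1) ∧
    (∀ s ∈ Icc (0:ℝ) 1, γ s ∈ Ω) ∧ γ 0 = x ∧ γ 1 = y ∧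
    L = ∫ s in (0:ℝ)..1, Real.sqrt (v (γ s)) * ‖derivWithin γ (Icc 0 1) s‖}

/-- The conformal ball of centre `p` and radius `ρ` in `Ω` for the metric `v|dz|²`. -/
def confBall (v : ℂ → ℝ) (Ω : Set ℂ) (p : ℂ) (ρ : ℝ) : Set ℂ :=
  {z ∈ connectedComponentIn Ω p | confDist v Ω p z < ρ}

/-- The conformal metric `v|dz|²` is complete on `Ω`: every connected component of `Ω` is a
complete metric space with respect to the induced distance `confDist v Ω`. -/
def ConfComplete (v : ℂ → ℝ) (Ω : Set ℂ) : Prop :=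
  ∀ x₀ ∈ Ω, ∀ x : ℕ → ℂ, (∀ n, x n ∈ connectedComponentIn Ω x₀) →
    (∀ ε : ℝ, 0 < ε → ∃ N : ℕ, ∀ m ≥ N, ∀ n ≥ N, confDist v Ω (x m) (x n) < ε) →
    ∃ l ∈ connectedComponentIn Ω x₀,
      Tendsto (fun n => confDist v Ω (x n) l) atTop (nhds 0)

/-- A conformal Ricci flow spacetime in the ambient space `ℂ × (0,T)`:
`M` is a connected open subset of `ℂ × (0,T)` with non-empty time-slices, and `u` is a smooth
positive conformal factor on `M` solving the logarithmic fast diffusion equation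
`∂u/∂t = Δ log u`. -/
structure ConfRFS (T : ℝ) (M : Set (ℂ × ℝ)) (u : ℂ → ℝ → ℝ) : Prop where
  sub : M ⊆ {p : ℂ × ℝ | p.2 ∈ Ioo 0 T}
  opn : IsOpen M
  conn : IsConnected M
  nonempty : ∀ t ∈ Ioo (0:ℝ) T, (timeSlice M t).Nonempty
  pos : ∀ p ∈ M, 0 < u p.1 p.2
  smooth : ContDiffOn ℝ (⊤ : ℕ∞) (fun p : ℂ × ℝ => u p.1 p.2) M
  lfde : ∀ p ∈ M, deriv (u p.1) p.2 = lap (fun z => Real.log (u z p.2)) p.1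

/-- A conformal Ricci flow spacetime is complete if the metric `u(·,t)|dz|²` is complete on the
timeSlice `M_t` for every `t ∈ (0,T)`. -/
def ConfRFSComplete (T : ℝ) (M : Set (ℂ × ℝ)) (u : ℂ → ℝ → ℝ) : Prop :=
  ∀ t ∈ Ioo (0:ℝ) T, ConfComplete (fun z => u z t) (timeSlice M t)

/-- There is a time-preserving path in `M` from time `s` to the point `(z,t)`. -/
def TimePreservingFrom (M : Set (ℂ × ℝ)) (s : ℝ) (z : ℂ) (t : ℝ) : Prop :=
  ∃ γ : ℝ → ℂ, ContinuousOn γ (Icc s t) ∧ (∀ r ∈ Icc s t, (γ r, r) ∈ M) ∧ γ t = z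

/-- The hindsight function of a spacetime `M`. -/
noncomputable def hindsight (M : Set (ℂ × ℝ)) (z : ℂ) (t : ℝ) : ℝ :=
  sInf {s : ℝ | 0 < s ∧ s ≤ t ∧ TimePreservingFrom M s z t}

/-- A spacetime is initially determined if its hindsight function vanishes identically. -/
def InitiallyDetermined (M : Set (ℂ × ℝ)) : Prop :=
  ∀ p ∈ M, hindsight M p.1 p.2 = 0

/-- A spacetime in `ℂ × (0,T)` is expanding if worldlines persist until the final time. -/
def Expanding (T : ℝ) (M : Set (ℂ × ℝ)) : Prop :=
  ∀ (z : ℂ) (t t' : ℝ), (z, t) ∈ M → t ≤ t' → t' < T → (z, t') ∈ M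

/-- An expanding spacetime is continuous if each timeSlice is the interior of the intersection of
all later slices. -/
def ContinuousSpacetime (T : ℝ) (M : Set (ℂ × ℝ)) : Prop :=
  ∀ s ∈ Ioo (0:ℝ) T, timeSlice M s = interior (⋂ t ∈ Ioo s T, timeSlice M t)

/-- The vanishing time of the point `(z,t)`: the supremum of the connected component containing
`t` of the set of times at which `z` belongs to the spacetime. -/
noncomputable def vanishTime (M : Set (ℂ × ℝ)) (z : ℂ) (t : ℝ) : ℝ :=
  sSup (connectedComponentIn {r : ℝ | (z, r) ∈ M} t)

/-- `Reach v Ω x y L`: there is a globally differentiable path with continuous velocity running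
inside `Ω` from `x` to `y` during `[0, 1]`, whose `v`-length is `L`. -/
def Reach (v : ℂ → ℝ) (Ω : Set ℂ) (x y : ℂ) (L : ℝ) : Prop :=
  ∃ γ η : ℝ → ℂ, Continuous η ∧ (∀ r, HasDerivAt γ (η r) r) ∧ (∀ r ∈ Icc (0:ℝ) 1, γ r ∈ Ω) ∧
    γ 0 = x ∧ γ 1 = y ∧ (∫ r in (0:ℝ)..1, Real.sqrt (v (γ r)) * ‖η r‖) = L

theorem confDist_eq_sInf_reach (v : ℂ → ℝ) (Ω : Set ℂ) (x y : ℂ) :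
    confDist v Ω x y = sInf {L : ℝ | Reach v Ω x y L} := by
  unfold confDist
  congr 1
  ext L
  constructor
  · rintro ⟨γ, hγ, hΩ, h0, h1, hL⟩
    have hc : ContinuousOn (derivWithin γ (Icc 0 1)) (Icc 0 1) :=
      hγ.continuousOn_derivWithin (uniqueDiffOn_Icc zero_lt_one) le_rfl
    set η : ℝ → ℂ := fun r => derivWithin γ (Icc 0 1) (projIcc (0:ℝ) 1 zero_le_one r) with hη
    have hηc : Continuous η :=
      hc.domRestrict.comp (continuous_projIcc (h := zero_le_one))
    have hηeq : ∀ r ∈ Icc (0:ℝ) 1, η r = derivWithin γ (Icc 0 1) r := by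
      intro r hr
      simp only [hη, projIcc_of_mem zero_le_one hr]
    set γ' : ℝ → ℂ := fun r => γ 0 + ∫ s in (0:ℝ)..r, η s with hγ'
    have hd : ∀ r, HasDerivAt γ' (η r) r := fun r =>
      (intervalIntegral.integral_hasDerivAt_right (hηc.intervalIntegrable _ _)
        (hηc.stronglyMeasurableAtFilter _ _) hηc.continuousAt).const_add _
    have heq : ∀ r ∈ Icc (0:ℝ) 1, γ' r = γ r := by
      intro r hr
      have : ∫ s in (0:ℝ)..r, η s = γ r - γ 0 := by
        apply intervalIntegral.integral_eq_sub_of_hasDerivAt_of_le hr.1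
        · exact hγ.continuousOn.mono (Icc_subset_Icc_right hr.2)
        · intro s hs
          have hs' : s ∈ Icc (0:ℝ) 1 := ⟨hs.1.le, hs.2.le.trans hr.2⟩
          rw [hηeq s hs']
          exact ((hγ.differentiableOn one_ne_zero s hs').hasDerivWithinAt).hasDerivAt
            (Icc_mem_nhds hs.1 (hs.2.trans_le hr.2))
        · exact hηc.intervalIntegrable _ _
      simp [hγ', this]
    refine ⟨γ', η, hηc, hd, fun r hr => heq r hr ▸ hΩ r hr, ?_, ?_, ?_⟩
    · rw [heq 0 (by simp), h0]
    · rw [heq 1 (by simp), h1]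
    · rw [hL]
      apply intervalIntegral.integral_congr
      intro r hr
      rw [uIcc_of_le zero_le_one] at hr
      simp only [heq r hr, hηeq r hr]
  · rintro ⟨γ, η, hη, hd, hΩ, h0, h1, hL⟩
    refine ⟨γ, ?_, hΩ, h0, h1, ?_⟩
    · have : ContDiff ℝ 1 γ := by
        rw [contDiff_one_iff_deriv]
        refine ⟨fun r => (hd r).differentiableAt, ?_⟩
        have : deriv γ = η := funext fun r => (hd r).deriv
        rwa [this]
      exact this.contDiffOn
    · rw [← hL]
      apply intervalIntegral.integral_congr
      intro r hr
      rw [uIcc_of_le zero_le_one] at hr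
      simp only
      rw [((hd r).hasDerivWithinAt).derivWithin (uniqueDiffOn_Icc zero_lt_one r hr)]

theorem Reach.nonneg {v : ℂ → ℝ} {Ω : Set ℂ} {x y : ℂ} {L : ℝ} (h : Reach v Ω x y L) : 0 ≤ L := by
  obtain ⟨γ, η, -, -, -, -, -, rfl⟩ := h
  exact intervalIntegral.integral_nonneg zero_le_one fun r _ => by positivity

theorem Reach.right_mem {v : ℂ → ℝ} {Ω : Set ℂ} {x y : ℂ} {L : ℝ} (h : Reach v Ω x y L) :
    y ∈ Ω := by
  obtain ⟨γ, η, -, -, h, -, rfl, -⟩ := h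
  exact h 1 (by simp)

theorem Reach.refl (v : ℂ → ℝ) {Ω : Set ℂ} {x : ℂ} (hx : x ∈ Ω) : Reach v Ω x x 0 :=
  ⟨fun _ => x, fun _ => 0, continuous_const, fun r => hasDerivAt_const r x, fun _ _ => hx, rfl, rfl,
    by simp⟩

theorem Reach.symm {v : ℂ → ℝ} {Ω : Set ℂ} {x y : ℂ} {L : ℝ} (h : Reach v Ω x y L) :
    Reach v Ω y x L := by
  obtain ⟨γ, η, hη, hd, hΩ, h0, h1, hL⟩ := h
  refine ⟨fun r => γ (1 - r), fun r => - η (1 - r), by fun_prop, fun r => ?_, fun r hr => ?_,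
    by simpa using h1, by simpa using h0, ?_⟩
  · have := HasDerivAt.scomp r (hd (1 - r)) ((hasDerivAt_id r).const_sub 1)
    simpa [Function.comp_def] using this
  · exact hΩ _ ⟨by linarith [hr.2], by linarith [hr.1]⟩
  · simp only [norm_neg]
    rw [intervalIntegral.integral_comp_sub_left (fun r => Real.sqrt (v (γ r)) * ‖η r‖)]
    simpa using hL

theorem continuousOn_speed {v : ℂ → ℝ} {Ω : Set ℂ} (hv : ContinuousOn v Ω) {γ η : ℝ → ℂ}
    (hη : Continuous η) (hd : ∀ r, HasDerivAt γ (η r) r) {s : Set ℝ} (hΩ : ∀ r ∈ s, γ r ∈ Ω) :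
    ContinuousOn (fun r => Real.sqrt (v (γ r)) * ‖η r‖) s := by
  have hγ : Continuous γ := continuous_iff_continuousAt.2 fun r => (hd r).continuousAt
  exact ((hv.comp hγ.continuousOn hΩ).sqrt).mul hη.norm.continuousOn

theorem integral_speed_comp {v : ℂ → ℝ} {Ω : Set ℂ} (hv : ContinuousOn v Ω) {γ η : ℝ → ℂ}
    (hη : Continuous η) (hd : ∀ r, HasDerivAt γ (η r) r) (hΩ : ∀ r ∈ Icc (0:ℝ) 1, γ r ∈ Ω)
    {f f' : ℝ → ℝ} (hf : ∀ r, HasDerivAt f (f' r) r) (hf' : Continuous f') (hpos : ∀ r, 0 ≤ f' r)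
    {a b : ℝ} (hab : ∀ r ∈ uIcc a b, f r ∈ Icc (0:ℝ) 1) :
    (∫ r in a..b, Real.sqrt (v (γ (f r))) * ‖(f' r : ℂ) * η (f r)‖) =
      ∫ r in f a..f b, Real.sqrt (v (γ r)) * ‖η r‖ := by
  rw [← intervalIntegral.integral_comp_mul_deriv' (f := f) (f' := f')
    (g := fun r => Real.sqrt (v (γ r)) * ‖η r‖) (fun r _ => hf r) hf'.continuousOn]
  · apply intervalIntegral.integral_congr
    intro r _
    simp only [norm_mul, Complex.norm_real, Real.norm_of_nonneg (hpos r), Function.comp]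
    ring
  · apply continuousOn_speed hv hη hd
    rintro _ ⟨r, hr, rfl⟩
    exact hΩ _ (hab r hr)

theorem Reach.sub_path {v : ℂ → ℝ} {Ω : Set ℂ} (hv : ContinuousOn v Ω) {γ η : ℝ → ℂ}
    (hη : Continuous η) (hd : ∀ r, HasDerivAt γ (η r) r) (hΩ : ∀ r ∈ Icc (0:ℝ) 1, γ r ∈ Ω)
    {a b : ℝ} (ha : 0 ≤ a) (hab : a ≤ b) (hb : b ≤ 1) :
    Reach v Ω (γ a) (γ b) (∫ r in a..b, Real.sqrt (v (γ r)) * ‖η r‖) := by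
  have hf : ∀ r, HasDerivAt (fun r : ℝ => a + (b - a) * r) (b - a) r := fun r => by
    simpa using ((hasDerivAt_id r).const_mul (b - a)).const_add a
  have hm : ∀ r ∈ Icc (0:ℝ) 1, a + (b - a) * r ∈ Icc (0:ℝ) 1 := fun r hr =>
    ⟨by nlinarith [hr.1], by nlinarith [hr.1, hr.2]⟩
  refine ⟨fun r => γ (a + (b - a) * r), fun r => ((b - a : ℝ) : ℂ) * η (a + (b - a) * r),
    by fun_prop, fun r => ?_, fun r hr => hΩ _ (hm r hr), by simp, by simp, ?_⟩
  · simpa [Function.comp_def] using HasDerivAt.scomp r (hd (a + (b - a) * r)) (hf r)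
  · rw [integral_speed_comp hv hη hd hΩ hf continuous_const (fun _ => sub_nonneg.2 hab)]
    · simp
    · intro r hr
      rw [uIcc_of_le zero_le_one] at hr
      exact hm r hr

theorem Reach.trans {v : ℂ → ℝ} {Ω : Set ℂ} (hv : ContinuousOn v Ω) {x y z : ℂ} {L L' : ℝ}
    (h : Reach v Ω x y L) (h' : Reach v Ω y z L') : Reach v Ω x z (L + L') := by
  obtain ⟨γ, η, hη, hd, hΩ, h0, h1, hL⟩ := h
  obtain ⟨γ', η', hη', hd', hΩ', h0', h1', hL'⟩ := h'
  set σ := Real.smoothTransition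
  have hσ : ∀ r, HasDerivAt σ (deriv σ r) r := fun r =>
    ((Real.smoothTransition.contDiff (n := 1)).differentiable one_ne_zero r).hasDerivAt
  have hσc : Continuous (deriv σ) :=
    (Real.smoothTransition.contDiff (n := 1)).continuous_deriv (by simp)
  have hσcc : Continuous σ := Real.smoothTransition.continuous
  have hσpos : ∀ r, 0 ≤ deriv σ r := fun r => Real.smoothTransition.monotone.deriv_nonneg
  have hσm : ∀ r, σ r ∈ Icc (0:ℝ) 1 := fun r =>
    ⟨Real.smoothTransition.nonneg r, Real.smoothTransition.le_one r⟩
  have hσ1 : ∀ r, 1 ≤ r → σ r = 1 := fun r hr => Real.smoothTransition.one_of_one_le hr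
  have hσ0 : ∀ r, r ≤ 0 → σ r = 0 := fun r hr => Real.smoothTransition.zero_of_nonpos hr
  have hdσ0 : ∀ r, r ≤ 0 → deriv σ r = 0 := by
    intro r hr
    have h1 : HasDerivWithinAt σ (deriv σ r) (Iic r) r := (hσ r).hasDerivWithinAt
    have h2 : HasDerivWithinAt σ 0 (Iic r) r :=
      (hasDerivWithinAt_const r (Iic r) (0:ℝ)).congr (fun s hs => hσ0 s (le_trans hs hr)) (hσ0 r hr)
    exact (uniqueDiffOn_Iic r r self_mem_Iic).eq_deriv _ h1 h2
  have hdσ1 : ∀ r, 1 ≤ r → deriv σ r = 0 := by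
    intro r hr
    have h1 : HasDerivWithinAt σ (deriv σ r) (Ici r) r := (hσ r).hasDerivWithinAt
    have h2 : HasDerivWithinAt σ 0 (Ici r) r :=
      (hasDerivWithinAt_const r (Ici r) (1:ℝ)).congr (fun s hs => hσ1 s (le_trans hr hs)) (hσ1 r hr)
    exact (uniqueDiffOn_Ici r r self_mem_Ici).eq_deriv _ h1 h2
  set f : ℝ → ℝ := fun r => σ (2 * r)
  set f' : ℝ → ℝ := fun r => 2 * deriv σ (2 * r)
  set g : ℝ → ℝ := fun r => σ (2 * r - 1)
  set g' : ℝ → ℝ := fun r => 2 * deriv σ (2 * r - 1)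
  have hf : ∀ r, HasDerivAt f (f' r) r := fun r => by
    have := HasDerivAt.scomp r (hσ (2 * r)) ((hasDerivAt_id r).const_mul 2)
    simpa [Function.comp_def] using this
  have hg : ∀ r, HasDerivAt g (g' r) r := fun r => by
    have := HasDerivAt.scomp r (hσ (2 * r - 1)) (((hasDerivAt_id r).const_mul 2).sub_const 1)
    simpa [Function.comp_def] using this
  have hf'c : Continuous f' := by fun_prop
  have hg'c : Continuous g' := by fun_prop
  have hfc : Continuous f := by fun_prop
  have hgc : Continuous g := by fun_prop
  have e1 : ∀ r, r ≤ 1 / 2 → g r = 0 ∧ g' r = 0 := fun r hr =>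
    ⟨hσ0 _ (by linarith), by simp [g', hdσ0 (2 * r - 1) (by linarith)]⟩
  have e2 : ∀ r, 1 / 2 ≤ r → f r = 1 ∧ f' r = 0 := fun r hr =>
    ⟨hσ1 _ (by linarith), by simp [f', hdσ1 (2 * r) (by linarith)]⟩
  set Γ : ℝ → ℂ := fun r => γ (f r) + γ' (g r) - y with hΓ
  set H : ℝ → ℂ := fun r => (f' r : ℂ) * η (f r) + (g' r : ℂ) * η' (g r) with hH
  have hΓ1 : ∀ r, r ≤ 1 / 2 → Γ r = γ (f r) ∧ H r = (f' r : ℂ) * η (f r) := fun r hr => by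
    simp [hΓ, hH, (e1 r hr).1, (e1 r hr).2, h0']
  have hΓ2 : ∀ r, 1 / 2 ≤ r → Γ r = γ' (g r) ∧ H r = (g' r : ℂ) * η' (g r) := fun r hr => by
    simp [hΓ, hH, (e2 r hr).1, (e2 r hr).2, h1]
  have hHc : Continuous H := by fun_prop
  have hΓd : ∀ r, HasDerivAt Γ (H r) r := fun r => by
    have h1 := HasDerivAt.scomp r (hd (f r)) (hf r)
    have h2 := HasDerivAt.scomp r (hd' (g r)) (hg r)
    simp only [Function.comp_def, Complex.real_smul] at h1 h2
    exact (h1.add h2).sub_const y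
  have hΓΩ : ∀ r ∈ Icc (0:ℝ) 1, Γ r ∈ Ω := by
    intro r _
    rcases le_total r (1 / 2) with h | h
    · rw [(hΓ1 r h).1]; exact hΩ _ (hσm _)
    · rw [(hΓ2 r h).1]; exact hΩ' _ (hσm _)
  refine ⟨Γ, H, hHc, hΓd, hΓΩ, ?_, ?_, ?_⟩
  · rw [(hΓ1 0 (by norm_num)).1, show f 0 = 0 from hσ0 _ (by norm_num), h0]
  · rw [(hΓ2 1 (by norm_num)).1, show g 1 = 1 from hσ1 _ (by norm_num), h1']
  · have h_int : ∀ a b : ℝ, 0 ≤ a → a ≤ b → b ≤ 1 →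
        IntervalIntegrable (fun r => Real.sqrt (v (Γ r)) * ‖H r‖) volume a b := by
      intro a b ha hab hb
      apply ContinuousOn.intervalIntegrable
      apply continuousOn_speed hv hHc hΓd
      intro r hr
      rw [uIcc_of_le hab] at hr
      exact hΓΩ r ⟨ha.trans hr.1, hr.2.trans hb⟩
    rw [← intervalIntegral.integral_add_adjacent_intervals (h_int 0 (1/2) le_rfl (by norm_num)
      (by norm_num)) (h_int (1/2) 1 (by norm_num) (by norm_num) le_rfl)]
    congr 1
    · rw [← hL]
      have := integral_speed_comp hv hη hd hΩ hf hf'c (fun r => mul_nonneg zero_le_two (hσpos _))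
        (a := 0) (b := 1 / 2) (fun r _ => hσm _)
      rw [show f 0 = 0 from hσ0 _ (by norm_num), show f (1/2) = 1 from hσ1 _ (by norm_num)] at this
      rw [← this]
      apply intervalIntegral.integral_congr
      intro r hr
      rw [uIcc_of_le (by norm_num)] at hr
      simp only [(hΓ1 r hr.2).1, (hΓ1 r hr.2).2]
    · rw [← hL']
      have := integral_speed_comp hv hη' hd' hΩ' hg hg'c (fun r => mul_nonneg zero_le_two (hσpos _))
        (a := 1 / 2) (b := 1) (fun r _ => hσm _)
      rw [show g (1/2) = 0 from hσ0 _ (by norm_num), show g 1 = 1 from hσ1 _ (by norm_num)] at this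
      rw [← this]
      apply intervalIntegral.integral_congr
      intro r hr
      rw [uIcc_of_le (by norm_num)] at hr
      simp only [(hΓ2 r hr.1).1, (hΓ2 r hr.1).2]

theorem Reach.split {v : ℂ → ℝ} {Ω : Set ℂ} (hv : ContinuousOn v Ω) {γ η : ℝ → ℂ}
    (hη : Continuous η) (hd : ∀ r, HasDerivAt γ (η r) r) (hΩ : ∀ r ∈ Icc (0:ℝ) 1, γ r ∈ Ω)
    {r : ℝ} (hr : r ∈ Icc (0:ℝ) 1) :
    ∃ L₁ L₂, Reach v Ω (γ 0) (γ r) L₁ ∧ Reach v Ω (γ r) (γ 1) L₂ ∧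
      L₁ = (∫ s in (0:ℝ)..r, Real.sqrt (v (γ s)) * ‖η s‖) ∧
      L₁ + L₂ = ∫ s in (0:ℝ)..1, Real.sqrt (v (γ s)) * ‖η s‖ := by
  refine ⟨_, _, Reach.sub_path hv hη hd hΩ le_rfl hr.1 hr.2,
    Reach.sub_path hv hη hd hΩ hr.1 hr.2 le_rfl, rfl, ?_⟩
  have hc := continuousOn_speed hv hη hd hΩ
  apply intervalIntegral.integral_add_adjacent_intervals
  · apply ContinuousOn.intervalIntegrable
    rw [uIcc_of_le hr.1]; exact hc.mono (Icc_subset_Icc_right hr.2)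
  · apply ContinuousOn.intervalIntegrable
    rw [uIcc_of_le hr.2]; exact hc.mono (Icc_subset_Icc_left hr.1)

theorem Reach.of_segment {v : ℂ → ℝ} {Ω : Set ℂ} (hv : ContinuousOn v Ω) {x y : ℂ} {Λ : ℝ}
    (hs : segment ℝ x y ⊆ Ω) (hΛ : ∀ z ∈ segment ℝ x y, Real.sqrt (v z) ≤ Λ) :
    ∃ L ≤ Λ * ‖y - x‖, Reach v Ω x y L := by
  have hm : ∀ r ∈ Icc (0:ℝ) 1, x + r * (y - x) ∈ segment ℝ x y := by
    intro r hr
    rw [segment_eq_image']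
    exact ⟨r, hr, by simp⟩
  have hd : ∀ r : ℝ, HasDerivAt (fun r : ℝ => x + r * (y - x)) (y - x) r := fun r => by
    have := (((hasDerivAt_id (r:ℂ)).comp_ofReal).mul_const (y - x)).const_add x
    simpa using this
  have hΩ : ∀ r ∈ Icc (0:ℝ) 1, x + r * (y - x) ∈ Ω := fun r hr => hs (hm r hr)
  refine ⟨_, ?_, _, _, continuous_const, hd, hΩ, by simp, by simp, rfl⟩
  calc (∫ r in (0:ℝ)..1, Real.sqrt (v (x + r * (y - x))) * ‖y - x‖)
      ≤ ∫ r in (0:ℝ)..1, Λ * ‖y - x‖ := by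
        apply intervalIntegral.integral_mono_on zero_le_one _ (by simp)
        · intro r hr
          exact mul_le_mul_of_nonneg_right (hΛ _ (hm r hr)) (norm_nonneg _)
        · apply ContinuousOn.intervalIntegrable
          rw [uIcc_of_le zero_le_one]
          exact continuousOn_speed hv continuous_const hd hΩ
    _ = Λ * ‖y - x‖ := by simp

theorem exists_first_exit {γ : ℝ → ℂ} (hγ : Continuous γ) {U : Set ℂ} (hU : IsOpen U)
    (h0 : γ 0 ∈ U) {r : ℝ} (hr : r ∈ Icc (0:ℝ) 1) (hrU : γ r ∉ U) :
    ∃ r₀ ∈ Icc (0:ℝ) 1, γ r₀ ∉ U ∧ (∀ s ∈ Ico (0:ℝ) r₀, γ s ∈ U) ∧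
      ∀ s ∈ Icc (0:ℝ) r₀, γ s ∈ closure U := by
  set S := Icc (0:ℝ) 1 ∩ γ ⁻¹' Uᶜ
  have hS : IsCompact S := isCompact_Icc.inter_right (hU.isClosed_compl.preimage hγ)
  obtain ⟨r₀, hr₀, hmin⟩ := hS.exists_isMinOn ⟨r, hr, hrU⟩ continuousOn_id
  have hlt : ∀ s ∈ Ico (0:ℝ) r₀, γ s ∈ U := by
    intro s hs
    by_contra hsU
    exact absurd (hmin (a := s) ⟨⟨hs.1, hs.2.le.trans hr₀.1.2⟩, hsU⟩) (not_le.2 hs.2)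
  have hr₀pos : 0 < r₀ := lt_of_le_of_ne hr₀.1.1 (by rintro rfl; exact hr₀.2 h0)
  refine ⟨r₀, hr₀.1, hr₀.2, hlt, fun s hs => ?_⟩
  have h1 : s ∈ closure (Ico (0:ℝ) r₀) := by rwa [closure_Ico hr₀pos.ne]
  exact closure_mono (image_subset_iff.2 hlt) (image_closure_subset_closure_image hγ ⟨s, h1, rfl⟩)

theorem mul_norm_le_integral_speed {v : ℂ → ℝ} {Ω : Set ℂ} (hv : ContinuousOn v Ω) {γ η : ℝ → ℂ}
    (hη : Continuous η) (hd : ∀ r, HasDerivAt γ (η r) r) {c r₀ : ℝ} (hr₀ : 0 ≤ r₀)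
    (hΩ : ∀ r ∈ Icc (0:ℝ) r₀, γ r ∈ Ω)
    (hc : ∀ r ∈ Icc (0:ℝ) r₀, c ≤ Real.sqrt (v (γ r))) (hc0 : 0 ≤ c) :
    c * ‖γ r₀ - γ 0‖ ≤ ∫ r in (0:ℝ)..r₀, Real.sqrt (v (γ r)) * ‖η r‖ := by
  have h1 : γ r₀ - γ 0 = ∫ r in (0:ℝ)..r₀, η r :=
    (intervalIntegral.integral_eq_sub_of_hasDerivAt (fun r _ => hd r)
      (hη.intervalIntegrable _ _)).symm
  calc c * ‖γ r₀ - γ 0‖ ≤ c * ∫ r in (0:ℝ)..r₀, ‖η r‖ := by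
        rw [h1]
        exact mul_le_mul_of_nonneg_left (intervalIntegral.norm_integral_le_integral_norm hr₀) hc0
    _ = ∫ r in (0:ℝ)..r₀, c * ‖η r‖ := by simp
    _ ≤ _ := by
        apply intervalIntegral.integral_mono_on hr₀ ((by fun_prop : Continuous _).intervalIntegrable _ _)
        · apply ContinuousOn.intervalIntegrable
          rw [uIcc_of_le hr₀]
          exact continuousOn_speed hv hη hd hΩ
        · intro r hr
          exact mul_le_mul_of_nonneg_right (hc r hr) (norm_nonneg _)

theorem integral_speed_mono {v : ℂ → ℝ} {Ω : Set ℂ} (hv : ContinuousOn v Ω) {γ η : ℝ → ℂ}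
    (hη : Continuous η) (hd : ∀ r, HasDerivAt γ (η r) r) {r₀ : ℝ} (hr₀ : r₀ ∈ Icc (0:ℝ) 1)
    (hΩ : ∀ r ∈ Icc (0:ℝ) 1, γ r ∈ Ω) :
    (∫ r in (0:ℝ)..r₀, Real.sqrt (v (γ r)) * ‖η r‖) ≤
      ∫ r in (0:ℝ)..1, Real.sqrt (v (γ r)) * ‖η r‖ := by
  obtain ⟨L₁, L₂, -, h2, h3, h4⟩ := Reach.split hv hη hd hΩ hr₀
  rw [← h4, ← h3]
  linarith [h2.nonneg]

theorem Reach.mul_min_le {v : ℂ → ℝ} {Ω : Set ℂ} (hv : ContinuousOn v Ω) {x y : ℂ} {L δ c : ℝ}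
    (h : Reach v Ω x y L) (hδ : 0 < δ) (hc0 : 0 ≤ c)
    (hc : ∀ z ∈ closedBall x δ, c ≤ Real.sqrt (v z)) : c * min δ ‖y - x‖ ≤ L := by
  obtain ⟨γ, η, hη, hd, hΩ, rfl, rfl, rfl⟩ := h
  have hγ : Continuous γ := continuous_iff_continuousAt.2 fun r => (hd r).continuousAt
  by_cases hex : ∃ r ∈ Icc (0:ℝ) 1, γ r ∉ ball (γ 0) δ
  · obtain ⟨r, hr, hrU⟩ := hex
    obtain ⟨r₀, hr₀, hU, -, hcl⟩ := exists_first_exit hγ isOpen_ball (mem_ball_self hδ) hr hrU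
    have h1 : δ ≤ ‖γ r₀ - γ 0‖ := by simpa [dist_eq_norm] using hU
    calc c * min δ ‖γ 1 - γ 0‖ ≤ c * ‖γ r₀ - γ 0‖ :=
          mul_le_mul_of_nonneg_left ((min_le_left _ _).trans h1) hc0
      _ ≤ _ := mul_norm_le_integral_speed hv hη hd hr₀.1
          (fun s hs => hΩ s ⟨hs.1, hs.2.trans hr₀.2⟩)
          (fun s hs => hc _ (closure_ball_subset_closedBall (hcl s hs))) hc0
      _ ≤ _ := integral_speed_mono hv hη hd hr₀ hΩ
  · push Not at hex
    calc c * min δ ‖γ 1 - γ 0‖ ≤ c * ‖γ 1 - γ 0‖ :=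
          mul_le_mul_of_nonneg_left (min_le_right _ _) hc0
      _ ≤ _ := mul_norm_le_integral_speed hv hη hd zero_le_one hΩ
          (fun s hs => hc _ (ball_subset_closedBall (hex s hs))) hc0

theorem Reach.exists_split {v : ℂ → ℝ} {Ω : Set ℂ} (hv : ContinuousOn v Ω) {x y : ℂ} {L a : ℝ}
    (h : Reach v Ω x y L) (ha : a ∈ Icc 0 L) :
    ∃ w, Reach v Ω x w a ∧ Reach v Ω w y (L - a) := by
  obtain ⟨γ, η, hη, hd, hΩ, rfl, rfl, rfl⟩ := h
  have hc : ContinuousOn (fun r => ∫ s in (0:ℝ)..r, Real.sqrt (v (γ s)) * ‖η s‖) (Icc 0 1) := by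
    rw [← uIcc_of_le (zero_le_one (α := ℝ))]
    apply intervalIntegral.continuousOn_primitive_interval
    rw [uIcc_of_le zero_le_one]
    exact (continuousOn_speed hv hη hd hΩ).integrableOn_Icc
  obtain ⟨r, hr, hra⟩ := intermediate_value_Icc zero_le_one hc (by simpa using ha)
  simp only at hra
  obtain ⟨L₁, L₂, h1, h2, h3, h4⟩ := Reach.split hv hη hd hΩ hr
  refine ⟨γ r, ?_, ?_⟩
  · rwa [← hra, ← h3]
  · rwa [← h4, ← hra, ← h3, add_sub_cancel_left]

theorem Reach.mem_connectedComponentIn {v : ℂ → ℝ} {Ω : Set ℂ} {x y : ℂ} {L : ℝ}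
    (h : Reach v Ω x y L) : y ∈ connectedComponentIn Ω x := by
  obtain ⟨γ, η, hη, hd, hΩ, rfl, rfl, rfl⟩ := h
  have hγ : Continuous γ := continuous_iff_continuousAt.2 fun r => (hd r).continuousAt
  exact (isPreconnected_Icc.image γ hγ.continuousOn).subset_connectedComponentIn
    ⟨0, by simp, rfl⟩ (image_subset_iff.2 hΩ) ⟨1, by simp, rfl⟩

theorem eventually_reach {v : ℂ → ℝ} {Ω : Set ℂ} (hΩ : IsOpen Ω) (hv : ContinuousOn v Ω) {x : ℂ}
    (hx : x ∈ Ω) {ε : ℝ} (hε : 0 < ε) : ∀ᶠ y in nhds x, ∃ L < ε, Reach v Ω x y L := by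
  have hca : ContinuousAt (fun z => Real.sqrt (v z)) x := (hv.continuousAt (hΩ.mem_nhds hx)).sqrt
  have h1 : ∀ᶠ z in nhds x, Real.sqrt (v z) < Real.sqrt (v x) + 1 :=
    hca.eventually_lt continuousAt_const (by linarith)
  obtain ⟨δ, hδ, hball⟩ := Metric.eventually_nhds_iff_ball.1 (h1.and (hΩ.mem_nhds hx))
  have hpos : 0 < Real.sqrt (v x) + 1 := by positivity
  filter_upwards [ball_mem_nhds x (lt_min hδ (div_pos hε hpos))] with y hy
  have hyx : ‖y - x‖ < min δ (ε / (Real.sqrt (v x) + 1)) := by simpa [dist_eq_norm] using hy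
  have hseg : segment ℝ x y ⊆ ball x δ := (convex_ball x δ).segment_subset (mem_ball_self hδ)
    (by rw [mem_ball, dist_eq_norm]; exact hyx.trans_le (min_le_left _ _))
  obtain ⟨L, hL, hR⟩ := Reach.of_segment hv (fun z hz => (hball z (hseg hz)).2)
    (fun z hz => (hball z (hseg hz)).1.le)
  refine ⟨L, hL.trans_lt ?_, hR⟩
  have := (lt_div_iff₀ hpos).1 (hyx.trans_le (min_le_right _ _))
  linarith

theorem exists_reach_of_mem_connectedComponentIn {v : ℂ → ℝ} {Ω : Set ℂ} (hΩ : IsOpen Ω)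
    (hv : ContinuousOn v Ω) {c x y : ℂ} (hx : x ∈ connectedComponentIn Ω c)
    (hy : y ∈ connectedComponentIn Ω c) : ∃ L, Reach v Ω x y L := by
  refine isPreconnected_connectedComponentIn.induction₂ (fun x y => ∃ L, Reach v Ω x y L) ?_ ?_ ?_
    hx hy
  · intro x hx
    refine nhdsWithin_le_nhds ?_
    filter_upwards [eventually_reach hΩ hv (connectedComponentIn_subset _ _ hx) zero_lt_one] with y hy
    obtain ⟨L, -, h⟩ := hy
    exact ⟨L, h⟩
  · rintro x y z _ _ _ ⟨L, h⟩ ⟨L', h'⟩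
    exact ⟨_, h.trans hv h'⟩
  · rintro x y _ _ ⟨L, h⟩
    exact ⟨L, h.symm⟩

theorem confDist_nonneg (v : ℂ → ℝ) (Ω : Set ℂ) (x y : ℂ) : 0 ≤ confDist v Ω x y := by
  rw [confDist_eq_sInf_reach]
  exact Real.sInf_nonneg fun L h => Reach.nonneg h

theorem confDist_le_of_reach {v : ℂ → ℝ} {Ω : Set ℂ} {x y : ℂ} {L : ℝ} (h : Reach v Ω x y L) :
    confDist v Ω x y ≤ L := by
  rw [confDist_eq_sInf_reach]
  exact csInf_le ⟨0, fun L h => Reach.nonneg h⟩ h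

theorem exists_reach_of_confDist_lt {v : ℂ → ℝ} {Ω : Set ℂ} (hΩ : IsOpen Ω)
    (hv : ContinuousOn v Ω) {c x y : ℂ} (hx : x ∈ connectedComponentIn Ω c)
    (hy : y ∈ connectedComponentIn Ω c) {r : ℝ} (h : confDist v Ω x y < r) :
    ∃ L < r, Reach v Ω x y L := by
  rw [confDist_eq_sInf_reach] at h
  obtain ⟨L, hL, hlt⟩ := exists_lt_of_csInf_lt (s := {L | Reach v Ω x y L})
    (exists_reach_of_mem_connectedComponentIn hΩ hv hx hy) h
  exact ⟨L, hlt, hL⟩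

theorem confDist_comm (v : ℂ → ℝ) (Ω : Set ℂ) (x y : ℂ) :
    confDist v Ω x y = confDist v Ω y x := by
  simp only [confDist_eq_sInf_reach]
  congr 1
  ext L
  exact ⟨Reach.symm, Reach.symm⟩

theorem confDist_triangle {v : ℂ → ℝ} {Ω : Set ℂ} (hΩ : IsOpen Ω)
    (hv : ContinuousOn v Ω) {c x y z : ℂ} (hx : x ∈ connectedComponentIn Ω c)
    (hy : y ∈ connectedComponentIn Ω c) (hz : z ∈ connectedComponentIn Ω c) :
    confDist v Ω x z ≤ confDist v Ω x y + confDist v Ω y z := by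
  refine le_of_forall_pos_le_add fun ε hε => ?_
  obtain ⟨L, hL, h⟩ := exists_reach_of_confDist_lt hΩ hv hx hy
    (lt_add_of_pos_right (confDist v Ω x y) (half_pos hε))
  obtain ⟨L', hL', hL₂⟩ := exists_reach_of_confDist_lt hΩ hv hy hz
    (lt_add_of_pos_right (confDist v Ω y z) (half_pos hε))
  linarith [confDist_le_of_reach (h.trans hv hL₂)]

/-- A component of `Ω` as a type, to be metrized by `confDist`. -/
def ConfComponent (Ω : Set ℂ) (c : ℂ) : Type := {x : ℂ // x ∈ connectedComponentIn Ω c}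

/-- The pseudometric structure given by `confDist` on a component. -/
noncomputable abbrev confPseudoMetric {v : ℂ → ℝ} {Ω : Set ℂ} (hΩ : IsOpen Ω)
    (hv : ContinuousOn v Ω) (c : ℂ) : PseudoMetricSpace (ConfComponent Ω c) where
  dist x y := confDist v Ω x.1 y.1
  dist_self x := le_antisymm (confDist_le_of_reach (Reach.refl v (connectedComponentIn_subset _ _ x.2)))
    (confDist_nonneg _ _ _ _)
  dist_comm x y := confDist_comm _ _ _ _
  dist_triangle x y z := confDist_triangle hΩ hv x.2 y.2 z.2

/-- The set of points that can be reached from `x` by paths of `v`-length less than `r`. -/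
def reachBall (v : ℂ → ℝ) (Ω : Set ℂ) (x : ℂ) (r : ℝ) : Set ℂ := {y | ∃ L < r, Reach v Ω x y L}

theorem isOpen_reachBall {v : ℂ → ℝ} {Ω : Set ℂ} (hΩ : IsOpen Ω) (hv : ContinuousOn v Ω) (x : ℂ)
    (r : ℝ) : IsOpen (reachBall v Ω x r) := by
  rw [isOpen_iff_mem_nhds]
  rintro y ⟨L, hL, h⟩
  filter_upwards [eventually_reach hΩ hv h.right_mem (sub_pos.2 hL)] with z hz
  obtain ⟨L', hL', h'⟩ := hz
  exact ⟨L + L', by linarith, h.trans hv h'⟩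

theorem exists_pos_le_sqrt {v : ℂ → ℝ} {K : Set ℂ} (hK : IsCompact K) (hv : ContinuousOn v K)
    (hpos : ∀ z ∈ K, 0 < v z) : ∃ c > 0, ∀ z ∈ K, c ≤ Real.sqrt (v z) := by
  rcases K.eq_empty_or_nonempty with rfl | hne
  · exact ⟨1, one_pos, by simp⟩
  obtain ⟨z, hz, hmin⟩ := hK.exists_isMinOn hne hv.sqrt
  exact ⟨_, Real.sqrt_pos.2 (hpos z hz), fun w hw => hmin hw⟩

theorem exists_reachBall_thicken {v : ℂ → ℝ} {Ω : Set ℂ} (hΩ : IsOpen Ω) (hv : ContinuousOn v Ω)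
    (hpos : ∀ z ∈ Ω, 0 < v z) {x : ℂ} (hx : x ∈ Ω) {r : ℝ} {K : Set ℂ} (hK : IsCompact K)
    (hKΩ : K ⊆ Ω) (hB : reachBall v Ω x r ⊆ K) :
    ∃ ε > 0, ∃ K', IsCompact K' ∧ K' ⊆ Ω ∧ reachBall v Ω x (r + ε) ⊆ K' := by
  have hK1 : IsCompact (insert x K) := hK.insert x
  obtain ⟨δ, hδ, hcpt⟩ := hK1.exists_isCompact_cthickening
  obtain ⟨δ', hδ', hsub⟩ := hK1.exists_cthickening_subset_open hΩ (insert_subset hx hKΩ)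
  set d := min δ δ' with hd
  have hdpos : 0 < d := lt_min hδ hδ'
  have hKc : IsCompact (cthickening d (insert x K)) :=
    hcpt.of_isClosed_subset isClosed_cthickening (cthickening_mono (min_le_left _ _) _)
  have hKs : cthickening d (insert x K) ⊆ Ω := (cthickening_mono (min_le_right _ _) _).trans hsub
  obtain ⟨c, hc, hcv⟩ := exists_pos_le_sqrt hKc (hv.mono hKs) fun z hz => hpos z (hKs hz)
  refine ⟨c * d / 2, by positivity, _, hKc, hKs, ?_⟩
  rintro y ⟨L, hL, h⟩
  have key : ∀ w ∈ insert x K, ∀ L', L' ≤ c * d / 2 → Reach v Ω w y L' →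
      y ∈ cthickening d (insert x K) := by
    intro w hw L' hL' h'
    have hb : closedBall w d ⊆ cthickening d (insert x K) := closedBall_subset_cthickening hw d
    apply hb
    have h1 := h'.mul_min_le hv hdpos hc.le fun z hz => hcv z (hb hz)
    rw [mem_closedBall, dist_eq_norm]
    by_contra hlt
    rw [min_eq_left (not_le.1 hlt).le] at h1
    nlinarith
  rcases le_total L (c * d / 2) with hl | hl
  · exact key x (mem_insert _ _) L hl h
  · obtain ⟨w, h1, h2⟩ := h.exists_split hv (a := L - c * d / 2) ⟨by linarith, by linarith [mul_pos hc hdpos]⟩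
    exact key w (mem_insert_of_mem _ (hB ⟨_, by linarith, h1⟩)) _ (by linarith) h2

theorem exists_compact_of_reachBall_lt {v : ℂ → ℝ} {Ω : Set ℂ} (hΩ : IsOpen Ω)
    (hv : ContinuousOn v Ω) (hpos : ∀ z ∈ Ω, 0 < v z) (hcomp : ConfComplete v Ω) {x : ℂ}
    (hx : x ∈ Ω) {σ : ℝ}
    (h : ∀ r < σ, ∃ K, IsCompact K ∧ K ⊆ Ω ∧ reachBall v Ω x r ⊆ K) :
    ∃ K, IsCompact K ∧ K ⊆ Ω ∧ reachBall v Ω x σ ⊆ K := by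
  let _ : PseudoMetricSpace (ConfComponent Ω x) := confPseudoMetric hΩ hv x
  have hsub := connectedComponentIn_subset Ω x
  have hdist : ∀ a b : ConfComponent Ω x, dist a b = confDist v Ω a.1 b.1 := fun _ _ => rfl
  have : CompleteSpace (ConfComponent Ω x) := by
    apply Metric.complete_of_cauchySeq_tendsto
    intro s hs
    obtain ⟨l, hl, hlim⟩ := hcomp x hx (fun n => (s n).1) (fun n => (s n).2) fun ε hε => by
      obtain ⟨N, hN⟩ := Metric.cauchySeq_iff.1 hs ε hε
      exact ⟨N, fun m hm n hn => hN m hm n hn⟩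
    exact ⟨⟨l, hl⟩, tendsto_iff_dist_tendsto_zero.2 hlim⟩
  let ι : connectedComponentIn Ω x → ConfComponent Ω x := id
  have hι : Continuous ι := by
    rw [continuous_iff_continuousAt]
    intro a
    rw [ContinuousAt, Metric.tendsto_nhds]
    intro ε hε
    have := continuous_subtype_val.continuousAt.eventually
      (eventually_reach hΩ hv (hsub a.2) hε : ∀ᶠ y in nhds a.1, _)
    filter_upwards [this] with b hb
    obtain ⟨L, hL, h⟩ := hb
    rw [dist_comm, hdist]
    exact (confDist_le_of_reach h).trans_lt hL
  have hval : Continuous (fun a : ConfComponent Ω x => a.1) := by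
    rw [continuous_iff_continuousAt]
    intro a
    rw [ContinuousAt, Metric.tendsto_nhds]
    intro ε hε
    obtain ⟨δ, hδ, hδΩ⟩ := Metric.nhds_basis_closedBall.mem_iff.1 (hΩ.mem_nhds (hsub a.2))
    obtain ⟨c, hc, hcv⟩ := exists_pos_le_sqrt (isCompact_closedBall a.1 δ) (hv.mono hδΩ)
      fun z hz => hpos z (hδΩ hz)
    filter_upwards [ball_mem_nhds a (by positivity : 0 < c * min δ ε)] with b hb
    rw [mem_ball, dist_comm, hdist] at hb
    obtain ⟨L, hL, h⟩ := exists_reach_of_confDist_lt hΩ hv a.2 b.2 hb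
    have h1 := lt_of_mul_lt_mul_left ((h.mul_min_le hv hδ hc.le hcv).trans_lt hL) hc.le
    rw [dist_eq_norm]
    rcases min_lt_iff.1 h1 with h2 | h2
    · exact absurd h2 (not_lt.2 (min_le_left _ _))
    · exact h2.trans_le (min_le_right _ _)
  let B : Set (ConfComponent Ω x) := {y | ∃ L < σ, Reach v Ω x y.1 L}
  have htb : TotallyBounded B := by
    rw [Metric.totallyBounded_iff]
    intro ε hε
    obtain ⟨K, hK, hKΩ, hBK⟩ := h (σ - ε / 2) (by linarith)
    have hKx : IsCompact (insert x K) := hK.insert x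
    have hKxΩ : insert x K ⊆ Ω := insert_subset hx hKΩ
    have hKc : IsCompact {a : connectedComponentIn Ω x | a.1 ∈ insert x K} := by
      rw [Topology.IsInducing.subtypeVal.isCompact_iff]
      have h1 : Subtype.val '' {a : connectedComponentIn Ω x | a.1 ∈ insert x K} =
          insert x K \ (⋃ z ∈ Ω \ connectedComponentIn Ω x, connectedComponentIn Ω z) := by
        ext z
        simp only [mem_image, mem_ofPred_eq, Subtype.exists, exists_and_left, exists_prop,
          exists_eq_right_right, Set.mem_sdiff, mem_iUnion, not_exists]
        constructor
        · rintro ⟨h1, h2⟩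
          refine ⟨h1, fun w ⟨hw, hz⟩ => hw.2 ?_⟩
          rw [connectedComponentIn_eq h2, ← connectedComponentIn_eq hz]
          exact mem_connectedComponentIn hw.1
        · rintro ⟨h1, h2⟩
          refine ⟨h1, ?_⟩
          by_contra hz
          exact h2 z ⟨⟨hKxΩ h1, hz⟩, mem_connectedComponentIn (hKxΩ h1)⟩
      rw [h1]
      exact hKx.diff (isOpen_biUnion fun z _ => hΩ.connectedComponentIn)
    have hKtb := (hKc.image hι).totallyBounded
    obtain ⟨t, ht, hcov⟩ := Metric.totallyBounded_iff.1 hKtb (ε / 2) (half_pos hε)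
    refine ⟨t, ht, ?_⟩
    rintro y ⟨L, hL, hy⟩
    have key : ∀ w ∈ insert x K, w ∈ connectedComponentIn Ω x → ∀ L' < ε / 2 + (σ - L) / 2,
        L' ≤ ε / 2 → Reach v Ω w y.1 L' → y ∈ ⋃ y ∈ t, ball y ε := by
      intro w hw hwc L' hL' hL'2 h'
      have := hcov ⟨⟨w, hwc⟩, hw, rfl⟩
      simp only [mem_iUnion, mem_ball, exists_prop] at this ⊢
      obtain ⟨b, hb, hbd⟩ := this
      refine ⟨b, hb, ?_⟩
      have h1 : dist y (ι ⟨w, hwc⟩) ≤ ε / 2 := by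
        rw [dist_comm, hdist]
        exact (confDist_le_of_reach h').trans hL'2
      linarith [dist_triangle y (ι ⟨w, hwc⟩) b]
    rcases le_total L (ε / 2) with hl | hl
    · exact key x (mem_insert _ _) (mem_connectedComponentIn hx) L (by linarith) hl hy
    · obtain ⟨w, h1, h2⟩ := hy.exists_split hv (a := L - ε / 2) ⟨by linarith, by linarith⟩
      exact key w (mem_insert_of_mem _ (hBK ⟨_, by linarith, h1⟩)) h1.mem_connectedComponentIn _
        (by linarith) (by linarith) h2
  have hcl : IsCompact (closure B) := htb.closure.isCompact_of_isComplete isClosed_closure.isComplete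
  refine ⟨(fun a : ConfComponent Ω x => a.1) '' closure B, hcl.image hval, ?_, ?_⟩
  · rintro _ ⟨a, -, rfl⟩
    exact hsub a.2
  · rintro y ⟨L, hL, hy⟩
    exact ⟨⟨y, hy.mem_connectedComponentIn⟩, subset_closure ⟨L, hL, hy⟩, rfl⟩

theorem ConfComplete.exists_compact_reachBall {v : ℂ → ℝ} {Ω : Set ℂ} (hΩ : IsOpen Ω)
    (hv : ContinuousOn v Ω) (hpos : ∀ z ∈ Ω, 0 < v z) (hcomp : ConfComplete v Ω) {x : ℂ}
    (hx : x ∈ Ω) (R : ℝ) : ∃ K, IsCompact K ∧ K ⊆ Ω ∧ reachBall v Ω x R ⊆ K := by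
  by_contra hR
  set S := {r : ℝ | ∃ K, IsCompact K ∧ K ⊆ Ω ∧ reachBall v Ω x r ⊆ K}
  have hdown : ∀ r ∈ S, ∀ r' ≤ r, r' ∈ S := by
    rintro r ⟨K, h1, h2, h3⟩ r' hr'
    exact ⟨K, h1, h2, fun y ⟨L, hL, hy⟩ => h3 ⟨L, hL.trans_le hr', hy⟩⟩
  have hbdd : BddAbove S := ⟨R, fun r hr => by
    by_contra h
    exact hR (hdown r hr R (not_le.1 h).le)⟩
  have hne : S.Nonempty := ⟨0, ∅, isCompact_empty, empty_subset _, fun y ⟨L, hL, hy⟩ =>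
    absurd hy.nonneg (not_le.2 hL)⟩
  obtain ⟨K, h1, h2, h3⟩ := exists_compact_of_reachBall_lt hΩ hv hpos hcomp hx (σ := sSup S)
    fun r hr => by
      obtain ⟨r', hr', hlt⟩ := exists_lt_of_lt_csSup hne hr
      exact hdown r' hr' r hlt.le
  obtain ⟨ε, hε, K', h4, h5, h6⟩ := exists_reachBall_thicken hΩ hv hpos hx h1 h2 h3
  linarith [le_csSup hbdd (show sSup S + ε ∈ S from ⟨K', h4, h5, h6⟩)]

theorem isOpen_timeSlice {M : Set (ℂ × ℝ)} (hM : IsOpen M) (t : ℝ) : IsOpen (timeSlice M t) :=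
  hM.preimage (by fun_prop : Continuous fun z : ℂ => (z, t))

theorem continuousOn_timeSlice {M : Set (ℂ × ℝ)} {u : ℂ → ℝ → ℝ}
    (hu : ContinuousOn (fun p : ℂ × ℝ => u p.1 p.2) M) (t : ℝ) :
    ContinuousOn (fun z => u z t) (timeSlice M t) :=
  hu.comp (f := fun z : ℂ => (z, t)) (by fun_prop) fun _ hz => hz

theorem exists_compact_reachBall_nhds {M : Set (ℂ × ℝ)} (hM : IsOpen M) {u : ℂ → ℝ → ℝ}
    (hu : ContinuousOn (fun p : ℂ × ℝ => u p.1 p.2) M) (hpos : ∀ p ∈ M, 0 < u p.1 p.2) {x : ℂ}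
    {s : ℝ} (hx : (x, s) ∈ M) (hcomp : ConfComplete (fun z => u z s) (timeSlice M s)) {R : ℝ}
    (hR : 0 ≤ R) : ∃ K : Set ℂ, IsCompact K ∧ ∀ᶠ t in nhds s, (∀ z ∈ K, (z, t) ∈ M) ∧
      reachBall (fun z => u z t) (timeSlice M t) x R ⊆ K := by
  have hΩ := isOpen_timeSlice hM s
  have hv := continuousOn_timeSlice hu s
  obtain ⟨K, hK, hKΩ, hBK⟩ := hcomp.exists_compact_reachBall hΩ hv (fun z hz => hpos (z, s) hz) hx
    (2 * R + 1)
  refine ⟨K, hK, ?_⟩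
  have hev : ∀ᶠ t in nhds s, ∀ z ∈ K, (z, t) ∈ M ∧ Real.sqrt (u z s) ≤ 2 * Real.sqrt (u z t) := by
    apply hK.eventually_forall_of_forall_eventually
    intro z hz
    have hzM : (z, s) ∈ M := hKΩ hz
    have c1 : ContinuousAt (fun q : ℝ × ℂ => u q.2 q.1) (s, z) :=
      ContinuousAt.comp' (f := fun q : ℝ × ℂ => (q.2, q.1)) (g := fun p : ℂ × ℝ => u p.1 p.2)
        (hu.continuousAt (hM.mem_nhds hzM)) (by fun_prop)
    have c2 : ContinuousAt (fun q : ℝ × ℂ => u q.2 s) (s, z) :=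
      ContinuousAt.comp' (f := fun q : ℝ × ℂ => (q.2, s)) (g := fun p : ℂ × ℝ => u p.1 p.2)
        (hu.continuousAt (hM.mem_nhds hzM)) (by fun_prop)
    have e1 : ∀ᶠ q : ℝ × ℂ in nhds (s, z), (q.2, q.1) ∈ M :=
      (hM.preimage (by fun_prop : Continuous fun q : ℝ × ℂ => (q.2, q.1))).mem_nhds hzM
    have hp := Real.sqrt_pos.2 (hpos _ hzM)
    have e2 := c2.sqrt.eventually_lt (c1.sqrt.const_mul 2) (by simp only at hp ⊢; linarith)
    filter_upwards [e1, e2] with q h1 h2 using ⟨h1, h2.le⟩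
  filter_upwards [hev] with t ht
  refine ⟨fun z hz => (ht z hz).1, ?_⟩
  rintro z ⟨L, hL, γ, η, hη, hd, hγΩ, h0, h1, hLeq⟩
  have hγ : Continuous γ := continuous_iff_continuousAt.2 fun r => (hd r).continuousAt
  set U := reachBall (fun z => u z s) (timeSlice M s) x (2 * R + 1)
  have hU : IsOpen U := isOpen_reachBall hΩ hv _ _
  have h0U : γ 0 ∈ U := by
    rw [h0]
    exact ⟨0, by linarith, Reach.refl _ hx⟩
  by_cases hex : ∃ r ∈ Icc (0:ℝ) 1, γ r ∉ U
  · exfalso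
    obtain ⟨r, hr, hrU⟩ := hex
    obtain ⟨r₀, hr₀, hU0, -, hcl⟩ := exists_first_exit hγ hU h0U hr hrU
    have hclK : ∀ q ∈ Icc (0:ℝ) r₀, γ q ∈ K := fun q hq => closure_minimal hBK hK.isClosed (hcl q hq)
    apply hU0
    refine ⟨∫ r in (0:ℝ)..r₀, Real.sqrt (u (γ r) s) * ‖η r‖, ?_, ?_⟩
    · have hint1 : IntervalIntegrable (fun r => Real.sqrt (u (γ r) s) * ‖η r‖) volume 0 r₀ := by
        apply ContinuousOn.intervalIntegrable
        rw [uIcc_of_le hr₀.1]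
        exact continuousOn_speed hv hη hd fun q hq => hKΩ (hclK q hq)
      have hint2 : IntervalIntegrable (fun r => 2 * (Real.sqrt (u (γ r) t) * ‖η r‖)) volume 0 r₀ := by
        apply ContinuousOn.intervalIntegrable
        rw [uIcc_of_le hr₀.1]
        exact (continuousOn_speed (continuousOn_timeSlice hu t) hη hd
          fun q hq => hγΩ q ⟨hq.1, hq.2.trans hr₀.2⟩).const_mul 2
      have h2 := intervalIntegral.integral_mono_on hr₀.1 hint1 hint2 fun q hq => by
        have := mul_le_mul_of_nonneg_right (ht _ (hclK q hq)).2 (norm_nonneg (η q))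
        linarith
      have h3 := integral_speed_mono (continuousOn_timeSlice hu t) hη hd hr₀ hγΩ
      rw [intervalIntegral.integral_const_mul] at h2
      linarith
    · have hscale : ∀ q ∈ Icc (0:ℝ) 1, r₀ * q ∈ Icc (0:ℝ) r₀ := fun q hq =>
        ⟨mul_nonneg hr₀.1 hq.1, by nlinarith [hq.2, hr₀.1]⟩
      refine ⟨fun q => γ (r₀ * q), fun q => (r₀ : ℂ) * η (r₀ * q), by fun_prop, fun q => ?_,
        fun q hq => hKΩ (hclK _ (hscale q hq)), by simpa using h0, by simp, ?_⟩
      · have hf : HasDerivAt (fun q : ℝ => r₀ * q) r₀ q := by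
          simpa using (hasDerivAt_id q).const_mul r₀
        simpa [Function.comp_def] using HasDerivAt.scomp q (hd (r₀ * q)) hf
      · have := intervalIntegral.mul_integral_comp_mul_left (a := 0) (b := 1) 
          (f := fun r => Real.sqrt (u (γ r) s) * ‖η r‖) r₀
        simp only [mul_zero, mul_one] at this
        rw [← this, ← intervalIntegral.integral_const_mul]
        congr 1
        ext q
        simp only [norm_mul, Complex.norm_real, Real.norm_of_nonneg hr₀.1]
        ring
  · push Not at hex
    exact hBK (h1 ▸ hex 1 (by simp))

theorem exists_compact_reachBall_Icc {T : ℝ} {M : Set (ℂ × ℝ)} {u : ℂ → ℝ → ℝ}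
    (hRF : ConfRFS T M u) (hcomp : ConfRFSComplete T M u) {x : ℂ} {a b : ℝ}
    (hx : ∀ t ∈ Icc a b, (x, t) ∈ M) {R : ℝ} (hR : 0 ≤ R) :
    ∃ K : Set (ℂ × ℝ), IsCompact K ∧ K ⊆ M ∧ ∀ t ∈ Icc a b,
      ∀ z ∈ reachBall (fun z => u z t) (timeSlice M t) x R, (z, t) ∈ K := by
  have hu : ContinuousOn (fun p : ℂ × ℝ => u p.1 p.2) M := hRF.smooth.continuousOn
  refine isCompact_Icc.induction_on (p := fun S => ∃ K : Set (ℂ × ℝ), IsCompact K ∧ K ⊆ M ∧ ∀ t ∈ S,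
      ∀ z ∈ reachBall (fun z => u z t) (timeSlice M t) x R, (z, t) ∈ K) ?_ ?_ ?_ ?_
  · exact ⟨∅, isCompact_empty, empty_subset _, by simp⟩
  · rintro S S' hS ⟨K, h1, h2, h3⟩
    exact ⟨K, h1, h2, fun t ht => h3 t (hS ht)⟩
  · rintro S S' ⟨K, h1, h2, h3⟩ ⟨K', h1', h2', h3'⟩
    refine ⟨K ∪ K', h1.union h1', union_subset h2 h2', ?_⟩
    rintro t (ht | ht) z hz
    · exact Or.inl (h3 t ht z hz)
    · exact Or.inr (h3' t ht z hz)
  · intro s hs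
    obtain ⟨K, hK, hev⟩ := exists_compact_reachBall_nhds hRF.opn hu hRF.pos (hx s hs)
      (hcomp s (hRF.sub (hx s hs))) hR
    obtain ⟨δ, hδ, hball⟩ := Metric.nhds_basis_closedBall.mem_iff.1 hev
    refine ⟨closedBall s δ, nhdsWithin_le_nhds (closedBall_mem_nhds s hδ), K ×ˢ closedBall s δ,
      hK.prod (isCompact_closedBall s δ), ?_, ?_⟩
    · rintro ⟨z, t⟩ ⟨hz, ht⟩
      exact (hball ht).1 z hz
    · intro t ht z hz
      exact ⟨(hball ht).2 hz, ht⟩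

/-- The first and second derivatives at `0` of a real function that is differentiable near `0`. -/
def Jet2 (f : ℝ → ℝ) (d e : ℝ) : Prop :=
  ∃ f₁ : ℝ → ℝ, (∀ᶠ x in nhds 0, HasDerivAt f (f₁ x) x) ∧ f₁ 0 = d ∧ HasDerivAt f₁ e 0

theorem Jet2.hasDerivAt {f : ℝ → ℝ} {d e : ℝ} (h : Jet2 f d e) : HasDerivAt f d 0 := by
  obtain ⟨f₁, h1, h2, -⟩ := h
  exact h2 ▸ h1.self_of_nhds

theorem Jet2.add {f g : ℝ → ℝ} {d e d' e' : ℝ} (hf : Jet2 f d e) (hg : Jet2 g d' e') :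
    Jet2 (fun x => f x + g x) (d + d') (e + e') := by
  obtain ⟨f₁, h1, h2, h3⟩ := hf
  obtain ⟨g₁, k1, k2, k3⟩ := hg
  refine ⟨fun x => f₁ x + g₁ x, ?_, by simp [h2, k2], h3.add k3⟩
  filter_upwards [h1, k1] with x a b using a.add b

theorem Jet2.const_mul {f : ℝ → ℝ} {d e : ℝ} (hf : Jet2 f d e) (c : ℝ) :
    Jet2 (fun x => c * f x) (c * d) (c * e) := by
  obtain ⟨f₁, h1, h2, h3⟩ := hf
  refine ⟨fun x => c * f₁ x, ?_, by simp [h2], h3.const_mul c⟩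
  filter_upwards [h1] with x a using a.const_mul c

theorem Jet2.sub {f g : ℝ → ℝ} {d e d' e' : ℝ} (hf : Jet2 f d e) (hg : Jet2 g d' e') :
    Jet2 (fun x => f x - g x) (d - d') (e - e') := by
  simpa [sub_eq_add_neg] using hf.add (hg.const_mul (-1))

theorem Jet2.const (c : ℝ) : Jet2 (fun _ => c) 0 0 :=
  ⟨fun _ => 0, Eventually.of_forall fun x => hasDerivAt_const x c, rfl, hasDerivAt_const 0 0⟩

theorem Jet2.congr {f g : ℝ → ℝ} {d e : ℝ} (hf : Jet2 f d e) (h : ∀ᶠ x in nhds 0, g x = f x) :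
    Jet2 g d e := by
  obtain ⟨f₁, h1, h2, h3⟩ := hf
  refine ⟨f₁, ?_, h2, h3⟩
  filter_upwards [h1, h.eventually_nhds] with x a b using a.congr_of_eventuallyEq b

theorem Jet2.log {f : ℝ → ℝ} {d e : ℝ} (hf : Jet2 f d e) (h0 : 0 < f 0) :
    Jet2 (fun x => Real.log (f x)) (d / f 0) (e / f 0 - (d / f 0) ^ 2) := by
  have hd := hf.hasDerivAt
  obtain ⟨f₁, h1, h2, h3⟩ := hf
  refine ⟨fun x => f₁ x / f x, ?_, by simp [h2], ?_⟩
  · filter_upwards [h1, hd.continuousAt.eventually_ne h0.ne'] with x a b using a.log b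
  · refine (h3.div hd h0.ne').congr_deriv ?_
    rw [h2]
    field_simp

theorem Jet2.exp {f : ℝ → ℝ} {d e : ℝ} (hf : Jet2 f d e) :
    Jet2 (fun x => Real.exp (f x)) (Real.exp (f 0) * d) (Real.exp (f 0) * (e + d ^ 2)) := by
  have hd := hf.hasDerivAt
  obtain ⟨f₁, h1, h2, h3⟩ := hf
  refine ⟨fun x => Real.exp (f x) * f₁ x, ?_, by simp [h2], ?_⟩
  · filter_upwards [h1] with x a using a.exp
  · refine (hd.exp.mul h3).congr_deriv ?_
    rw [h2]
    ring

theorem Jet2.quadratic (a b c : ℝ) : Jet2 (fun x => a + b * x + c * x ^ 2) b (2 * c) := by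
  refine ⟨fun x => b + 2 * c * x, Eventually.of_forall fun x => ?_, by simp, ?_⟩
  · have := (((hasDerivAt_id x).const_mul b).const_add a).add (((hasDerivAt_id x).pow 2).const_mul c)
    refine (this.congr_deriv (g' := b + 2 * c * x) ?_).congr_of_eventuallyEq ?_
    · simp
      ring
    · exact Eventually.of_forall fun y => by simp
  · simpa using ((hasDerivAt_id (0:ℝ)).const_mul (2 * c)).const_add b

theorem Jet2.nonpos_of_isLocalMax {f : ℝ → ℝ} {d e : ℝ} (hf : Jet2 f d e) (hm : IsLocalMax f 0) :
    e ≤ 0 := by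
  have hd := hf.hasDerivAt
  obtain ⟨f₁, h1, h2, h3⟩ := hf
  by_contra he
  have hd0 : d = 0 := hm.hasDerivAt_eq_zero hd
  have hderiv : deriv f =ᶠ[nhds 0] f₁ := by
    filter_upwards [h1] with x a using a.deriv
  -- the derivative is positive just to the right of `0`, so `f` increases strictly there
  have hpos : ∀ᶠ x in nhdsWithin 0 (Ioi (0:ℝ)), 0 < f₁ x := by
    have hs := hasDerivAt_iff_tendsto_slope.1 h3
    have : ∀ᶠ x in nhdsWithin 0 {(0:ℝ)}ᶜ, 0 < slope f₁ 0 x :=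
      hs.eventually (lt_mem_nhds (not_le.1 he))
    have h4 := nhdsWithin_mono (0:ℝ) (fun x (hx : x ∈ Ioi (0:ℝ)) => (ne_of_gt hx : x ≠ 0)) this
    filter_upwards [h4, self_mem_nhdsWithin] with x hx hx0
    simp only [slope_def_field, h2, hd0, sub_zero] at hx
    exact (div_pos_iff_of_pos_right hx0).1 hx
  obtain ⟨δ, hδ, hδs⟩ := Metric.eventually_nhds_iff_ball.1 (h1.and hm)
  obtain ⟨δ', hδ', hs'⟩ := mem_nhdsGT_iff_exists_Ioo_subset.1 hpos
  set y := min (δ / 2) (δ' / 2) with hy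
  have hδ'0 : 0 < δ' := hδ'
  have hy0 : 0 < y := lt_min (by linarith) (by linarith)
  have hyδ : y < δ := (min_le_left _ _).trans_lt (by linarith)
  have hyδ' : y < δ' := (min_le_right _ _).trans_lt (by linarith)
  have hmem : ∀ x ∈ Icc 0 y, x ∈ ball (0:ℝ) δ := fun x hx => by
    rw [mem_ball, Real.dist_eq, sub_zero, abs_of_nonneg hx.1]
    exact hx.2.trans_lt hyδ
  obtain ⟨c, hc, hce⟩ := exists_hasDerivAt_eq_slope f f₁ hy0
    (fun x hx => (hδs x (hmem x hx)).1.continuousAt.continuousWithinAt)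
    (fun x hx => (hδs x (hmem x (Ioo_subset_Icc_self hx))).1)
  have h5 : 0 < f₁ c := hs' ⟨hc.1, hc.2.trans hyδ'⟩
  rw [hce, sub_zero] at h5
  have h6 := (div_pos_iff_of_pos_right hy0).1 h5
  have h7 := (hδs y (hmem y ⟨hy0.le, le_rfl⟩)).2
  linarith

/-- Smoothness data and the evolution equation for the logarithm `V` of a conformal factor. -/
structure LogFlow (M : Set (ℂ × ℝ)) (V : ℂ × ℝ → ℝ) (A : ℂ × ℝ → (ℂ × ℝ →L[ℝ] ℝ))
    (H : ℂ × ℝ → (ℂ × ℝ →L[ℝ] ℂ × ℝ →L[ℝ] ℝ)) : Prop where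
  opn : IsOpen M
  fst : ∀ p ∈ M, HasFDerivAt V (A p) p
  snd : ∀ p ∈ M, HasFDerivAt A (H p) p
  cont : ContinuousOn H M
  evol : ∀ p ∈ M, Real.exp (V p) * A p (0, 1) = H p (1, 0) (1, 0) + H p (Complex.I, 0) (Complex.I, 0)

theorem ConfRFS.exists_logFlow {T : ℝ} {M : Set (ℂ × ℝ)} {u : ℂ → ℝ → ℝ} (h : ConfRFS T M u) :
    ∃ A H, LogFlow M (fun p => Real.log (u p.1 p.2)) A H := by
  set V : ℂ × ℝ → ℝ := fun p => Real.log (u p.1 p.2) with hV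
  have hVs : ∀ p ∈ M, ContDiffAt ℝ (⊤ : ℕ∞) V p := fun p hp =>
    (h.smooth.contDiffAt (h.opn.mem_nhds hp)).log (h.pos p hp).ne'
  have hA : ∀ p ∈ M, ContDiffAt ℝ (⊤ : ℕ∞) (fderiv ℝ V) p := fun p hp =>
    (hVs p hp).fderiv_right (by simp)
  have hH : ∀ p ∈ M, ContDiffAt ℝ (⊤ : ℕ∞) (fderiv ℝ (fderiv ℝ V)) p := fun p hp =>
    (hA p hp).fderiv_right (by simp)
  have f1 : ∀ p ∈ M, HasFDerivAt V (fderiv ℝ V p) p := fun p hp =>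
    ((hVs p hp).differentiableAt (by simp)).hasFDerivAt
  have f2 : ∀ p ∈ M, HasFDerivAt (fderiv ℝ V) (fderiv ℝ (fderiv ℝ V) p) p := fun p hp =>
    ((hA p hp).differentiableAt (by simp)).hasFDerivAt
  refine ⟨fderiv ℝ V, fderiv ℝ (fderiv ℝ V), h.opn, f1, f2,
    fun p hp => (hH p hp).continuousAt.continuousWithinAt, ?_⟩
  rintro ⟨z, t⟩ hp
  have hlf := h.lfde (z, t) hp
  simp only at hlf ⊢
  have e1 : deriv (u z) t = Real.exp (V (z, t)) * fderiv ℝ V (z, t) (0, 1) := by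
    have hcurve : HasDerivAt (fun s : ℝ => (z, s)) ((0:ℂ), (1:ℝ)) t :=
      (hasDerivAt_const t z).prodMk (hasDerivAt_id t)
    have h1 : HasDerivAt (fun s => V (z, s)) (fderiv ℝ V (z, t) (0, 1)) t :=
      (f1 (z, t) hp).comp_hasDerivAt t hcurve
    refine (h1.exp.congr_of_eventuallyEq ?_).deriv
    have : ∀ᶠ s in nhds t, (z, s) ∈ M := hcurve.continuousAt.eventually (h.opn.mem_nhds hp)
    filter_upwards [this] with s hs
    exact (Real.exp_log (h.pos _ hs)).symm
  have e2 : ∀ a b : ℂ, iteratedFDeriv ℝ 2 (fun z => Real.log (u z t)) z ![a, b] =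
      fderiv ℝ (fderiv ℝ V) (z, t) (a, 0) (b, 0) := by
    intro a b
    have hin : ∀ w : ℂ, HasFDerivAt (fun w : ℂ => (w, t)) (ContinuousLinearMap.inl ℝ ℂ ℝ) w :=
      fun w => hasFDerivAt_prodMk_left w t
    have hnear : ∀ᶠ w in nhds z, (w, t) ∈ M :=
      (hin z).continuousAt.eventually (h.opn.mem_nhds hp)
    have hd : fderiv ℝ (fun z => Real.log (u z t)) =ᶠ[nhds z]
        fun w => (fderiv ℝ V (w, t)).comp (ContinuousLinearMap.inl ℝ ℂ ℝ) := by
      filter_upwards [hnear] with w hw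
      exact ((f1 (w, t) hw).comp w (hin w)).fderiv
    rw [iteratedFDeriv_two_apply, hd.fderiv_eq]
    have h2 := ((ContinuousLinearMap.compL ℝ ℂ (ℂ × ℝ) ℝ).flip
      (ContinuousLinearMap.inl ℝ ℂ ℝ)).hasFDerivAt.comp z ((f2 (z, t) hp).comp z (hin z))
    simp only [Function.comp_def, ContinuousLinearMap.flip_apply, ContinuousLinearMap.compL_apply] at h2
    rw [h2.fderiv]
    simp
  rw [← e1, hlf, lap, e2, e2]

theorem hasDerivAt_integral_unitInterval {S : Set ℝ} (hS : IsOpen S) {f f' : ℝ → ℝ → ℝ}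
    (hd : ∀ x ∈ S, ∀ r ∈ Icc (0:ℝ) 1, HasDerivAt (fun x => f x r) (f' x r) x)
    (hf : ContinuousOn (fun p : ℝ × ℝ => f p.1 p.2) (S ×ˢ Icc (0:ℝ) 1))
    (hf' : ContinuousOn (fun p : ℝ × ℝ => f' p.1 p.2) (S ×ˢ Icc (0:ℝ) 1)) {x : ℝ} (hx : x ∈ S) :
    HasDerivAt (fun x => ∫ r in (0:ℝ)..1, f x r) (∫ r in (0:ℝ)..1, f' x r) x := by
  obtain ⟨δ, hδ, hball⟩ := Metric.nhds_basis_closedBall.mem_iff.1 (hS.mem_nhds hx)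
  obtain ⟨C, hC⟩ := ((isCompact_closedBall x δ).prod isCompact_Icc).exists_bound_of_continuousOn
    (hf'.mono (prod_mono hball Subset.rfl))
  have hIoc : uIoc (0:ℝ) 1 ⊆ Icc 0 1 := by
    rw [uIoc_of_le zero_le_one]; exact Ioc_subset_Icc_self
  have hslice : ∀ {g : ℝ → ℝ → ℝ}, ContinuousOn (fun p : ℝ × ℝ => g p.1 p.2) (S ×ˢ Icc (0:ℝ) 1) →
      ∀ y ∈ S, ContinuousOn (g y) (Icc 0 1) := fun hg y hy =>
    hg.comp (f := fun r => (y, r)) (by fun_prop) fun r hr => ⟨hy, hr⟩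
  refine (intervalIntegral.hasDerivAt_integral_of_dominated_loc_of_deriv_le
    (F := f) (F' := f') (bound := fun _ => C) (s := closedBall x δ) (closedBall_mem_nhds x hδ)
    ?_ ?_ ?_ ?_ ?_ ?_).2
  · filter_upwards [hS.mem_nhds hx] with y hy
    exact ((hslice hf y hy).mono hIoc).aestronglyMeasurable measurableSet_uIoc
  · apply ContinuousOn.intervalIntegrable
    rw [uIcc_of_le zero_le_one]
    exact hslice hf x hx
  · exact ((hslice hf' x hx).mono hIoc).aestronglyMeasurable measurableSet_uIoc
  · exact Eventually.of_forall fun r hr y hy => hC (y, r) ⟨hy, hIoc hr⟩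
  · simp
  · exact Eventually.of_forall fun r hr y hy => hd y (hball hy) r (hIoc hr)

namespace LogFlow

variable {M : Set (ℂ × ℝ)} {V : ℂ × ℝ → ℝ} {A : ℂ × ℝ → (ℂ × ℝ →L[ℝ] ℝ)}
  {H : ℂ × ℝ → (ℂ × ℝ →L[ℝ] ℂ × ℝ →L[ℝ] ℝ)}

theorem continuousOn_fst (h : LogFlow M V A H) : ContinuousOn V M :=
  fun p hp => (h.fst p hp).continuousAt.continuousWithinAt

theorem continuousOn_snd (h : LogFlow M V A H) : ContinuousOn A M :=
  fun p hp => (h.snd p hp).continuousAt.continuousWithinAt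

theorem hasDerivAt_line (h : LogFlow M V A H) {q w : ℂ} {t x : ℝ} (hx : (q + x * w, t) ∈ M) :
    HasDerivAt (fun x : ℝ => V (q + x * w, t)) (A (q + x * w, t) (w, 0)) x := by
  have hc : HasDerivAt (fun x : ℝ => (q + x * w, t)) (w, (0:ℝ)) x := by
    refine HasDerivAt.prodMk ?_ (hasDerivAt_const x t)
    simpa using (((hasDerivAt_id (x:ℂ)).comp_ofReal).mul_const w).const_add q
  exact (h.fst _ hx).comp_hasDerivAt x hc

theorem hasDerivAt_line_snd (h : LogFlow M V A H) {q w : ℂ} {t x : ℝ} (hx : (q + x * w, t) ∈ M)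
    (e : ℂ × ℝ) :
    HasDerivAt (fun x : ℝ => A (q + x * w, t) e) (H (q + x * w, t) (w, 0) e) x := by
  have hc : HasDerivAt (fun x : ℝ => (q + x * w, t)) (w, (0:ℝ)) x := by
    refine HasDerivAt.prodMk ?_ (hasDerivAt_const x t)
    simpa using (((hasDerivAt_id (x:ℂ)).comp_ofReal).mul_const w).const_add q
  have h1 := (h.snd _ hx).comp_hasDerivAt x hc
  simpa using h1.clm_apply (hasDerivAt_const x e)

theorem hasDerivAt_time (h : LogFlow M V A H) {q : ℂ} {t : ℝ} (hx : (q, t) ∈ M) :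
    HasDerivAt (fun s : ℝ => V (q, s)) (A (q, t) (0, 1)) t :=
  (h.fst _ hx).comp_hasDerivAt t ((hasDerivAt_const t q).prodMk (hasDerivAt_id t))

theorem jet2_line (h : LogFlow M V A H) {q w : ℂ} {t : ℝ} (hq : (q, t) ∈ M) :
    Jet2 (fun x : ℝ => V (q + x * w, t)) (A (q, t) (w, 0)) (H (q, t) (w, 0) (w, 0)) := by
  have hev : ∀ᶠ x : ℝ in nhds 0, (q + x * w, t) ∈ M := by
    have hc : Continuous (fun x : ℝ => (q + x * w, t)) := by fun_prop
    exact hc.continuousAt.eventually (h.opn.mem_nhds (by simpa using hq))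
  refine ⟨fun x => A (q + x * w, t) (w, 0), ?_, by simp, ?_⟩
  · filter_upwards [hev] with x hx using h.hasDerivAt_line hx
  · simpa using h.hasDerivAt_line_snd (x := 0) (w := w) (by simpa using hq) (w, 0)

end LogFlow

/-- The logarithm of the factor by which the conformal speed changes when a point `z` of a path is
shifted to `z + ζ * Y` and the velocity is multiplied by `1 + ζ * b`. -/
noncomputable def varLog (V : ℂ × ℝ → ℝ) (z Y b ζ : ℂ) (t : ℝ) : ℝ :=
  V (z + ζ * Y, t) / 2 + (Complex.log (1 + ζ * b)).re

/-- The derivative of `varLog` in the direction `e`. -/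
noncomputable def varLogFst (A : ℂ × ℝ → (ℂ × ℝ →L[ℝ] ℝ)) (e z Y b ζ : ℂ) (t : ℝ) : ℝ :=
  A (z + ζ * Y, t) (e * Y, 0) / 2 + (e * b / (1 + ζ * b)).re

/-- The second derivative of `varLog` in the direction `e`. -/
noncomputable def varLogSnd (H : ℂ × ℝ → (ℂ × ℝ →L[ℝ] ℂ × ℝ →L[ℝ] ℝ)) (e z Y b ζ : ℂ) (t : ℝ) : ℝ :=
  H (z + ζ * Y, t) (e * Y, 0) (e * Y, 0) / 2 - ((e * b / (1 + ζ * b)) ^ 2).re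

theorem one_add_mem_slitPlane {w : ℂ} (hw : ‖w‖ < 1 / 2) : 1 + w ∈ Complex.slitPlane := by
  left
  have := (Complex.abs_re_le_norm w)
  have := neg_abs_le w.re
  simp
  linarith

theorem exp_varLog {V : ℂ × ℝ → ℝ} {z Y b ζ : ℂ} {t : ℝ} (hb : ‖ζ * b‖ < 1 / 2) :
    Real.exp (varLog V z Y b ζ t) = Real.sqrt (Real.exp (V (z + ζ * Y, t))) * ‖1 + ζ * b‖ := by
  have h0 : 1 + ζ * b ≠ 0 := Complex.slitPlane_ne_zero (one_add_mem_slitPlane hb)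
  rw [varLog, Real.exp_add, Complex.log_re, Real.exp_log (norm_pos_iff.2 h0), Real.exp_half]

section

variable {M : Set (ℂ × ℝ)} {V : ℂ × ℝ → ℝ} {A : ℂ × ℝ → (ℂ × ℝ →L[ℝ] ℝ)}
  {H : ℂ × ℝ → (ℂ × ℝ →L[ℝ] ℂ × ℝ →L[ℝ] ℝ)}

theorem LogFlow.hasDerivAt_varLog (h : LogFlow M V A H) {e z Y b ζ : ℂ} {t x : ℝ}
    (hM : (z + (ζ + x * e) * Y, t) ∈ M) (hb : ‖(ζ + x * e) * b‖ < 1 / 2) :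
    HasDerivAt (fun x : ℝ => varLog V z Y b (ζ + x * e) t) (varLogFst A e z Y b (ζ + x * e) t) x := by
  have e1 : ∀ x : ℝ, z + (ζ + x * e) * Y = z + ζ * Y + x * (e * Y) := fun x => by ring
  have e2 : ∀ x : ℝ, 1 + (ζ + x * e) * b = 1 + ζ * b + x * (e * b) := fun x => by ring
  have hc : HasDerivAt (fun x : ℝ => 1 + (ζ + x * e) * b) (e * b) x := by
    simp only [e2]
    simpa using (((hasDerivAt_id (x:ℂ)).comp_ofReal).mul_const (e * b)).const_add (1 + ζ * b)
  have h1 := hc.clog_real (one_add_mem_slitPlane hb)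
  have h2 := Complex.reCLM.hasFDerivAt.comp_hasDerivAt x h1
  have h3 : HasDerivAt (fun x : ℝ => V (z + (ζ + x * e) * Y, t))
      (A (z + (ζ + x * e) * Y, t) (e * Y, 0)) x := by
    simp only [e1] at hM ⊢
    exact h.hasDerivAt_line hM
  exact (h3.div_const 2).add h2

theorem LogFlow.hasDerivAt_varLogFst (h : LogFlow M V A H) {e z Y b ζ : ℂ} {t x : ℝ}
    (hM : (z + (ζ + x * e) * Y, t) ∈ M) (hb : ‖(ζ + x * e) * b‖ < 1 / 2) :
    HasDerivAt (fun x : ℝ => varLogFst A e z Y b (ζ + x * e) t)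
      (varLogSnd H e z Y b (ζ + x * e) t) x := by
  have e1 : ∀ x : ℝ, z + (ζ + x * e) * Y = z + ζ * Y + x * (e * Y) := fun x => by ring
  have e2 : ∀ x : ℝ, 1 + (ζ + x * e) * b = 1 + ζ * b + x * (e * b) := fun x => by ring
  have hc : HasDerivAt (fun x : ℝ => 1 + (ζ + x * e) * b) (e * b) x := by
    simp only [e2]
    simpa using (((hasDerivAt_id (x:ℂ)).comp_ofReal).mul_const (e * b)).const_add (1 + ζ * b)
  have hne := Complex.slitPlane_ne_zero (one_add_mem_slitPlane hb)
  have h1 := (hasDerivAt_const x (e * b)).div hc hne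
  have h2 := Complex.reCLM.hasFDerivAt.comp_hasDerivAt x h1
  have h3 : HasDerivAt (fun x : ℝ => A (z + (ζ + x * e) * Y, t) (e * Y, 0))
      (H (z + (ζ + x * e) * Y, t) (e * Y, 0) (e * Y, 0)) x := by
    simp only [e1] at hM ⊢
    exact h.hasDerivAt_line_snd hM _
  refine ((h3.div_const 2).add h2).congr_deriv ?_
  have e3 : (0 * (1 + (ζ + x * e) * b) - e * b * (e * b)) / (1 + (ζ + x * e) * b) ^ 2 =
      -(e * b / (1 + (ζ + x * e) * b)) ^ 2 := by
    rw [div_pow]; ring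
  rw [varLogSnd, e3, map_neg, Complex.reCLM_apply, sub_eq_add_neg]

theorem LogFlow.hasDerivAt_varLog_time (h : LogFlow M V A H) {z Y b ζ : ℂ} {t : ℝ}
    (hM : (z + ζ * Y, t) ∈ M) :
    HasDerivAt (fun s : ℝ => varLog V z Y b ζ s) (A (z + ζ * Y, t) (0, 1) / 2) t :=
  ((h.hasDerivAt_time hM).div_const 2).add_const _

theorem LogFlow.varLogSnd_add (z Y b ζ : ℂ) (t : ℝ) :
    varLogSnd H 1 z Y b ζ t + varLogSnd H Complex.I z Y b ζ t =
      ‖Y‖ ^ 2 * (H (z + ζ * Y, t) (1, 0) (1, 0) +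
        H (z + ζ * Y, t) (Complex.I, 0) (Complex.I, 0)) / 2 := by
  have hsq : ((1 * b / (1 + ζ * b)) ^ 2).re + ((Complex.I * b / (1 + ζ * b)) ^ 2).re = 0 := by
    rw [← Complex.add_re]
    have : (1 * b / (1 + ζ * b)) ^ 2 + (Complex.I * b / (1 + ζ * b)) ^ 2 = 0 := by
      rw [mul_div_assoc, mul_div_assoc, mul_pow, mul_pow, Complex.I_sq]; ring
    rw [this, Complex.zero_re]
  have h1 : ((1 * Y, 0) : ℂ × ℝ) = Y.re • ((1:ℂ), (0:ℝ)) + Y.im • (Complex.I, (0:ℝ)) := by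
    ext <;> simp
  have h2 : ((Complex.I * Y, 0) : ℂ × ℝ) =
      (-Y.im) • ((1:ℂ), (0:ℝ)) + Y.re • (Complex.I, (0:ℝ)) := by
    refine Prod.ext (Complex.ext ?_ ?_) ?_ <;> simp
  have h3 : ‖Y‖ ^ 2 = Y.re ^ 2 + Y.im ^ 2 := by
    rw [Complex.sq_norm, Complex.normSq_apply]; ring
  have key : varLogSnd H 1 z Y b ζ t + varLogSnd H Complex.I z Y b ζ t =
      (H (z + ζ * Y, t) (1 * Y, 0) (1 * Y, 0) +
        H (z + ζ * Y, t) (Complex.I * Y, 0) (Complex.I * Y, 0)) / 2 := by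
    unfold varLogSnd
    linarith
  rw [key, h1, h2, h3]
  simp only [map_add, map_smul, add_apply, smul_apply,
    smul_eq_mul]
  ring

end

/-- The length at time `t` of the path obtained from `γ` (with velocity `η`) by shifting along
`ζ * Y`, where the velocity gets multiplied by `1 + ζ * b`. -/
noncomputable def varLen (V : ℂ × ℝ → ℝ) (γ η Y b : ℝ → ℂ) (ζ : ℂ) (t : ℝ) : ℝ :=
  ∫ r in (0:ℝ)..1, Real.exp (varLog V (γ r) (Y r) (b r) ζ t) * ‖η r‖

section

variable {M : Set (ℂ × ℝ)} {V : ℂ × ℝ → ℝ} {A : ℂ × ℝ → (ℂ × ℝ →L[ℝ] ℝ)}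
  {H : ℂ × ℝ → (ℂ × ℝ →L[ℝ] ℂ × ℝ →L[ℝ] ℝ)} {γ η Y b : ℝ → ℂ} {S : Set (ℂ × ℝ)}

/-- Every shift of the path by a parameter in `S` stays in the spacetime and is small. -/
structure ShiftAdmissible (M : Set (ℂ × ℝ)) (γ η Y b : ℝ → ℂ) (S : Set (ℂ × ℝ)) : Prop where
  opn : IsOpen S
  path : ContinuousOn γ (Icc 0 1)
  vel : ContinuousOn η (Icc 0 1)
  shift : ContinuousOn Y (Icc 0 1)
  factor : ContinuousOn b (Icc 0 1)
  mem : ∀ q ∈ S, ∀ r ∈ Icc (0:ℝ) 1, (γ r + q.1 * Y r, q.2) ∈ M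
  small : ∀ q ∈ S, ∀ r ∈ Icc (0:ℝ) 1, ‖q.1 * b r‖ < 1 / 2

namespace ShiftAdmissible

theorem continuousOn_point (h : ShiftAdmissible M γ η Y b S) :
    ContinuousOn (fun p : (ℂ × ℝ) × ℝ => (γ p.2 + p.1.1 * Y p.2, p.1.2)) (S ×ˢ Icc (0:ℝ) 1) := by
  have h1 : ContinuousOn (fun p : (ℂ × ℝ) × ℝ => γ p.2) (S ×ˢ Icc (0:ℝ) 1) :=
    h.path.comp continuousOn_snd fun p hp => hp.2
  have h2 : ContinuousOn (fun p : (ℂ × ℝ) × ℝ => Y p.2) (S ×ˢ Icc (0:ℝ) 1) :=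
    h.shift.comp continuousOn_snd fun p hp => hp.2
  have h3 : Continuous fun p : (ℂ × ℝ) × ℝ => p.1.1 := by fun_prop
  have h4 : Continuous fun p : (ℂ × ℝ) × ℝ => p.1.2 := by fun_prop
  exact (h1.add (h3.continuousOn.mul h2)).prodMk h4.continuousOn

theorem continuousOn_comp {X : Type*} [TopologicalSpace X] (h : ShiftAdmissible M γ η Y b S)
    {f : ℂ × ℝ → X} (hf : ContinuousOn f M) :
    ContinuousOn (fun p : (ℂ × ℝ) × ℝ => f (γ p.2 + p.1.1 * Y p.2, p.1.2))
      (S ×ˢ Icc (0:ℝ) 1) :=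
  hf.comp h.continuousOn_point fun p hp => h.mem p.1 hp.1 p.2 hp.2

theorem continuousOn_factor (h : ShiftAdmissible M γ η Y b S) :
    ContinuousOn (fun p : (ℂ × ℝ) × ℝ => 1 + p.1.1 * b p.2) (S ×ˢ Icc (0:ℝ) 1) := by
  have h2 : ContinuousOn (fun p : (ℂ × ℝ) × ℝ => b p.2) (S ×ˢ Icc (0:ℝ) 1) :=
    h.factor.comp continuousOn_snd fun p hp => hp.2
  have h3 : Continuous fun p : (ℂ × ℝ) × ℝ => p.1.1 := by fun_prop
  exact continuousOn_const.add (h3.continuousOn.mul h2)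

theorem factor_mem (h : ShiftAdmissible M γ η Y b S) {p : (ℂ × ℝ) × ℝ} (hp : p ∈ S ×ˢ Icc (0:ℝ) 1) :
    1 + p.1.1 * b p.2 ∈ Complex.slitPlane :=
  one_add_mem_slitPlane (h.small p.1 hp.1 p.2 hp.2)

theorem continuousOn_varLog (hA : LogFlow M V A H) (h : ShiftAdmissible M γ η Y b S) :
    ContinuousOn (fun p : (ℂ × ℝ) × ℝ => varLog V (γ p.2) (Y p.2) (b p.2) p.1.1 p.1.2)
      (S ×ˢ Icc (0:ℝ) 1) := by
  have h1 := h.continuousOn_comp hA.continuousOn_fst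
  have h2 := h.continuousOn_factor.clog fun p hp => h.factor_mem hp
  exact (h1.div_const 2).add (Complex.continuous_re.comp_continuousOn h2)

theorem continuousOn_dir (h : ShiftAdmissible M γ η Y b S) (e : ℂ) :
    ContinuousOn (fun p : (ℂ × ℝ) × ℝ => ((e * Y p.2, 0) : ℂ × ℝ)) (S ×ˢ Icc (0:ℝ) 1) := by
  have h2 : ContinuousOn (fun p : (ℂ × ℝ) × ℝ => Y p.2) (S ×ˢ Icc (0:ℝ) 1) :=
    h.shift.comp continuousOn_snd fun p hp => hp.2
  exact (continuousOn_const.mul h2).prodMk continuousOn_const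

theorem continuousOn_quot (h : ShiftAdmissible M γ η Y b S) (e : ℂ) :
    ContinuousOn (fun p : (ℂ × ℝ) × ℝ => e * b p.2 / (1 + p.1.1 * b p.2)) (S ×ˢ Icc (0:ℝ) 1) := by
  have h2 : ContinuousOn (fun p : (ℂ × ℝ) × ℝ => b p.2) (S ×ˢ Icc (0:ℝ) 1) :=
    h.factor.comp continuousOn_snd fun p hp => hp.2
  exact (continuousOn_const.mul h2).div h.continuousOn_factor
    fun p hp => Complex.slitPlane_ne_zero (h.factor_mem hp)

theorem continuousOn_varLogFst (hA : LogFlow M V A H) (h : ShiftAdmissible M γ η Y b S) (e : ℂ) :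
    ContinuousOn (fun p : (ℂ × ℝ) × ℝ => varLogFst A e (γ p.2) (Y p.2) (b p.2) p.1.1 p.1.2)
      (S ×ˢ Icc (0:ℝ) 1) := by
  have h1 := (h.continuousOn_comp hA.continuousOn_snd).clm_apply (h.continuousOn_dir e)
  exact (h1.div_const 2).add (Complex.continuous_re.comp_continuousOn (h.continuousOn_quot e))

theorem continuousOn_varLogSnd (hA : LogFlow M V A H) (h : ShiftAdmissible M γ η Y b S) (e : ℂ) :
    ContinuousOn (fun p : (ℂ × ℝ) × ℝ => varLogSnd H e (γ p.2) (Y p.2) (b p.2) p.1.1 p.1.2)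
      (S ×ˢ Icc (0:ℝ) 1) := by
  have h1 := ((h.continuousOn_comp hA.cont).clm_apply (h.continuousOn_dir e)).clm_apply
    (h.continuousOn_dir e)
  exact (h1.div_const 2).sub
    (Complex.continuous_re.comp_continuousOn ((h.continuousOn_quot e).pow 2))

theorem continuousOn_time (hA : LogFlow M V A H) (h : ShiftAdmissible M γ η Y b S) :
    ContinuousOn (fun p : (ℂ × ℝ) × ℝ => A (γ p.2 + p.1.1 * Y p.2, p.1.2) (0, 1))
      (S ×ˢ Icc (0:ℝ) 1) :=
  (h.continuousOn_comp hA.continuousOn_snd).clm_apply continuousOn_const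

theorem continuousOn_speed (h : ShiftAdmissible M γ η Y b S) :
    ContinuousOn (fun p : (ℂ × ℝ) × ℝ => ‖η p.2‖) (S ×ˢ Icc (0:ℝ) 1) :=
  (h.vel.comp continuousOn_snd fun p hp => hp.2).norm

theorem slice {X : Type*} [TopologicalSpace X] {f : (ℂ × ℝ) × ℝ → X}
    (hf : ContinuousOn f (S ×ˢ Icc (0:ℝ) 1)) {q : ℂ × ℝ} (hq : q ∈ S) :
    ContinuousOn (fun r => f (q, r)) (Icc 0 1) :=
  hf.comp (f := fun r => (q, r)) (by fun_prop) fun _ hr => ⟨hq, hr⟩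

theorem line {X : Type*} [TopologicalSpace X] {f : (ℂ × ℝ) × ℝ → X}
    (hf : ContinuousOn f (S ×ˢ Icc (0:ℝ) 1)) (ζ e : ℂ) (t : ℝ) :
    ContinuousOn (fun p : ℝ × ℝ => f ((ζ + p.1 * e, t), p.2))
      ({x : ℝ | (ζ + x * e, t) ∈ S} ×ˢ Icc (0:ℝ) 1) :=
  hf.comp (f := fun p : ℝ × ℝ => ((ζ + p.1 * e, t), p.2)) (by fun_prop) fun _ hr => ⟨hr.1, hr.2⟩

theorem jet2_varLen (hA : LogFlow M V A H) (h : ShiftAdmissible M γ η Y b S) {ζ : ℂ} {t : ℝ}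
    (hq : (ζ, t) ∈ S) (e : ℂ) :
    Jet2 (fun x : ℝ => varLen V γ η Y b (ζ + x * e) t)
      (∫ r in (0:ℝ)..1, Real.exp (varLog V (γ r) (Y r) (b r) ζ t) *
        varLogFst A e (γ r) (Y r) (b r) ζ t * ‖η r‖)
      (∫ r in (0:ℝ)..1, Real.exp (varLog V (γ r) (Y r) (b r) ζ t) *
        (varLogSnd H e (γ r) (Y r) (b r) ζ t + varLogFst A e (γ r) (Y r) (b r) ζ t ^ 2) * ‖η r‖) := by
  set U := {x : ℝ | (ζ + x * e, t) ∈ S} with hUdef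
  have hU : IsOpen U := h.opn.preimage (by fun_prop : Continuous fun x : ℝ => (ζ + x * e, t))
  have h0 : (0:ℝ) ∈ U := by simpa [U] using hq
  have c0 := line (h.continuousOn_varLog hA) ζ e t
  have c1 := line (h.continuousOn_varLogFst hA e) ζ e t
  have c2 := line (h.continuousOn_varLogSnd hA e) ζ e t
  have cs := line h.continuousOn_speed ζ e t
  have d0 : ∀ x ∈ U, ∀ r ∈ Icc (0:ℝ) 1, HasDerivAt
      (fun x : ℝ => varLog V (γ r) (Y r) (b r) (ζ + x * e) t)
      (varLogFst A e (γ r) (Y r) (b r) (ζ + x * e) t) x := fun x hx r hr =>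
    hA.hasDerivAt_varLog (h.mem _ hx r hr) (h.small _ hx r hr)
  have d1 : ∀ x ∈ U, ∀ r ∈ Icc (0:ℝ) 1, HasDerivAt
      (fun x : ℝ => varLogFst A e (γ r) (Y r) (b r) (ζ + x * e) t)
      (varLogSnd H e (γ r) (Y r) (b r) (ζ + x * e) t) x := fun x hx r hr =>
    hA.hasDerivAt_varLogFst (h.mem _ hx r hr) (h.small _ hx r hr)
  refine ⟨fun x => ∫ r in (0:ℝ)..1, Real.exp (varLog V (γ r) (Y r) (b r) (ζ + x * e) t) *
        varLogFst A e (γ r) (Y r) (b r) (ζ + x * e) t * ‖η r‖, ?_, by simp, ?_⟩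
  · filter_upwards [hU.mem_nhds h0] with x hx
    refine hasDerivAt_integral_unitInterval hU
      (f := fun x r => Real.exp (varLog V (γ r) (Y r) (b r) (ζ + x * e) t) * ‖η r‖)
      (f' := fun x r => Real.exp (varLog V (γ r) (Y r) (b r) (ζ + x * e) t) *
        varLogFst A e (γ r) (Y r) (b r) (ζ + x * e) t * ‖η r‖) ?_ (c0.rexp.mul cs)
        ((c0.rexp.mul c1).mul cs) hx
    intro x hx r hr
    exact (d0 x hx r hr).exp.mul_const _
  · have := hasDerivAt_integral_unitInterval hU
      (f := fun x r => Real.exp (varLog V (γ r) (Y r) (b r) (ζ + x * e) t) *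
        varLogFst A e (γ r) (Y r) (b r) (ζ + x * e) t * ‖η r‖)
      (f' := fun x r => Real.exp (varLog V (γ r) (Y r) (b r) (ζ + x * e) t) *
        (varLogSnd H e (γ r) (Y r) (b r) (ζ + x * e) t +
          varLogFst A e (γ r) (Y r) (b r) (ζ + x * e) t ^ 2) * ‖η r‖) ?_
      ((c0.rexp.mul c1).mul cs) ((c0.rexp.mul (c2.add (c1.pow 2))).mul cs) h0
    · simpa using this
    · intro x hx r hr
      refine (((d0 x hx r hr).exp.mul (d1 x hx r hr)).mul_const _).congr_deriv ?_
      ring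

theorem hasDerivAt_varLen_time (hA : LogFlow M V A H) (h : ShiftAdmissible M γ η Y b S) {ζ : ℂ}
    {t : ℝ} (hq : (ζ, t) ∈ S) :
    HasDerivAt (fun s => varLen V γ η Y b ζ s)
      (∫ r in (0:ℝ)..1, Real.exp (varLog V (γ r) (Y r) (b r) ζ t) *
        (A (γ r + ζ * Y r, t) (0, 1) / 2) * ‖η r‖) t := by
  set U := {s : ℝ | (ζ, s) ∈ S} with hUdef
  have hU : IsOpen U := h.opn.preimage (by fun_prop : Continuous fun x : ℝ => (ζ, x))
  have hl : ∀ {f : (ℂ × ℝ) × ℝ → ℝ}, ContinuousOn f (S ×ˢ Icc (0:ℝ) 1) →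
      ContinuousOn (fun p : ℝ × ℝ => f ((ζ, p.1), p.2)) (U ×ˢ Icc (0:ℝ) 1) := fun hf =>
    hf.comp (f := fun p : ℝ × ℝ => ((ζ, p.1), p.2)) (by fun_prop) fun _ hr => ⟨hr.1, hr.2⟩
  have c0 := hl (h.continuousOn_varLog hA)
  have c1 := hl (h.continuousOn_time hA)
  have cs := hl h.continuousOn_speed
  refine hasDerivAt_integral_unitInterval hU
    (f := fun s r => Real.exp (varLog V (γ r) (Y r) (b r) ζ s) * ‖η r‖)
    (f' := fun s r => Real.exp (varLog V (γ r) (Y r) (b r) ζ s) *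
        (A (γ r + ζ * Y r, s) (0, 1) / 2) * ‖η r‖) ?_ (c0.rexp.mul cs)
        ((c0.rexp.mul (c1.div_const 2)).mul cs) hq
  intro s hs r hr
  exact (hA.hasDerivAt_varLog_time (h.mem _ hs r hr)).exp.mul_const _

theorem continuousOn_varLen (hA : LogFlow M V A H) (h : ShiftAdmissible M γ η Y b S) :
    ContinuousOn (fun q : ℂ × ℝ => varLen V γ η Y b q.1 q.2) S := by
  have hf := (h.continuousOn_varLog hA).rexp.mul h.continuousOn_speed
  have hIoc : uIoc (0:ℝ) 1 ⊆ Icc 0 1 := by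
    rw [uIoc_of_le zero_le_one]; exact Ioc_subset_Icc_self
  intro q hq
  obtain ⟨δ, hδ, hball⟩ := Metric.nhds_basis_closedBall.mem_iff.1 (h.opn.mem_nhds hq)
  obtain ⟨C, hC⟩ := ((isCompact_closedBall q δ).prod isCompact_Icc).exists_bound_of_continuousOn
    (hf.mono (prod_mono hball Subset.rfl))
  refine ContinuousAt.continuousWithinAt ?_
  refine intervalIntegral.continuousAt_of_dominated_interval (bound := fun _ => C) ?_ ?_ ?_ ?_
  · filter_upwards [h.opn.mem_nhds hq] with y hy
    exact ((slice hf hy).mono hIoc).aestronglyMeasurable measurableSet_uIoc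
  · filter_upwards [closedBall_mem_nhds q hδ] with y hy
    exact Eventually.of_forall fun r hr => hC (y, r) ⟨hy, hIoc hr⟩
  · simp
  · refine Eventually.of_forall fun r hr => ?_
    have : ContinuousOn (fun q => Real.exp (varLog V (γ r) (Y r) (b r) q.1 q.2) * ‖η r‖) S :=
      hf.comp (f := fun q => (q, r)) (by fun_prop) fun q hq => ⟨hq, hIoc hr⟩
    exact this.continuousAt (h.opn.mem_nhds hq)

end ShiftAdmissible

end

theorem norm_add_ofReal_mul_sq (q e : ℂ) (x : ℝ) :
    ‖q + x * e‖ ^ 2 = ‖q‖ ^ 2 + 2 * (q.re * e.re + q.im * e.im) * x + ‖e‖ ^ 2 * x ^ 2 := by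
  simp only [Complex.sq_norm, Complex.normSq_apply, Complex.add_re, Complex.add_im, Complex.mul_re,
    Complex.mul_im, Complex.ofReal_re, Complex.ofReal_im]
  ring

theorem jet2_norm_sq (q e : ℂ) :
    Jet2 (fun x : ℝ => ‖q + x * e‖ ^ 2) (2 * (q.re * e.re + q.im * e.im)) (2 * ‖e‖ ^ 2) :=
  (Jet2.quadratic (‖q‖ ^ 2) (2 * (q.re * e.re + q.im * e.im)) (‖e‖ ^ 2)).congr
    (Eventually.of_forall fun x => norm_add_ofReal_mul_sq q e x)

/-- The logarithm of the stationary subsolution `e^(r-3)/r`, where `r` is the distance to `p`. -/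
noncomputable def logBarrier (p z : ℂ) : ℝ := ‖z - p‖ - Real.log ‖z - p‖ - 3

theorem exp_logBarrier {p z : ℂ} (h : z ≠ p) :
    Real.exp (logBarrier p z) = Real.exp (‖z - p‖ - 3) / ‖z - p‖ := by
  have : 0 < ‖z - p‖ := norm_pos_iff.2 (sub_ne_zero.2 h)
  rw [logBarrier, show ‖z - p‖ - Real.log ‖z - p‖ - 3 = (‖z - p‖ - 3) - Real.log ‖z - p‖ by ring,
    Real.exp_sub, Real.exp_log this]

theorem two_mul_exp_logBarrier_le {p z : ℂ} (h : z ≠ p) (h2 : ‖z - p‖ ≤ 2) :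
    2 * Real.exp (logBarrier p z) ≤ 1 / ‖z - p‖ := by
  have h0 : 0 < ‖z - p‖ := norm_pos_iff.2 (sub_ne_zero.2 h)
  rw [exp_logBarrier h, ← mul_div_assoc]
  gcongr
  have h1 : Real.exp (‖z - p‖ - 3) ≤ Real.exp (-1) := Real.exp_le_exp.2 (by linarith)
  have h3 : Real.exp (-1) ≤ 1 / 2 := by
    rw [Real.exp_neg, one_div]
    have := Real.add_one_le_exp (1:ℝ)
    exact inv_anti₀ (by norm_num) (by linarith)
  linarith

theorem continuousOn_logBarrier (p : ℂ) : ContinuousOn (logBarrier p) {p}ᶜ := by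
  have h : ContinuousOn (fun z : ℂ => ‖z - p‖) {p}ᶜ := by fun_prop
  exact (h.sub (h.log fun z hz => (norm_pos_iff.2 (sub_ne_zero.2 hz)).ne')).sub continuousOn_const

theorem jet2_logBarrier {p z e : ℂ} (h : z ≠ p) (he : ‖e‖ = 1) :
    Jet2 (fun x : ℝ => logBarrier p (z + x * e))
      (((z - p).re * e.re + (z - p).im * e.im) / ‖z - p‖ -
        ((z - p).re * e.re + (z - p).im * e.im) / ‖z - p‖ ^ 2)
      (1 / ‖z - p‖ - ((z - p).re * e.re + (z - p).im * e.im) ^ 2 / ‖z - p‖ ^ 3 -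
        (1 / ‖z - p‖ ^ 2 - 2 * ((z - p).re * e.re + (z - p).im * e.im) ^ 2 / ‖z - p‖ ^ 4)) := by
  have h0 : 0 < ‖z - p‖ := norm_pos_iff.2 (sub_ne_zero.2 h)
  set q := z - p with hq
  set d := q.re * e.re + q.im * e.im with hd
  have h1 := ((jet2_norm_sq q e).log (by simpa using pow_pos h0 2)).const_mul (1 / 2)
  have h2 := h1.exp
  have h3 := (h2.sub h1).sub (Jet2.const 3)
  have e0 : Real.exp (1 / 2 * Real.log (‖q‖ ^ 2)) = ‖q‖ := by
    rw [Real.log_pow, Nat.cast_ofNat, ← mul_assoc]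
    norm_num
    rw [Real.exp_log h0]
  simp only [Complex.ofReal_zero, zero_mul, add_zero, he, e0, ← hd] at h3
  have h4 := h3.congr (g := fun x : ℝ => logBarrier p (z + x * e)) ?_
  · convert h4 using 1 <;> field_simp <;> ring
  · have hne : ∀ᶠ x : ℝ in nhds 0, q + x * e ≠ 0 := by
      have hc : Continuous fun x : ℝ => q + x * e := by fun_prop
      exact hc.continuousAt.eventually_ne (by simpa using norm_pos_iff.1 h0)
    filter_upwards [hne] with x hx
    have hxpos := norm_pos_iff.2 hx
    have e1 : z + x * e - p = q + x * e := by rw [hq]; ring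
    rw [logBarrier, e1, Real.log_pow, Nat.cast_ofNat, ← mul_assoc]
    norm_num
    rw [Real.exp_log hxpos]

/-- The barrier has Laplacian of its logarithm equal to `1/r`. -/
theorem exists_jet2_logBarrier {p z : ℂ} (h : z ≠ p) :
    ∃ d₁ e₁ d₂ e₂, Jet2 (fun x : ℝ => logBarrier p (z + x * 1)) d₁ e₁ ∧
      Jet2 (fun x : ℝ => logBarrier p (z + x * Complex.I)) d₂ e₂ ∧ e₁ + e₂ = 1 / ‖z - p‖ := by
  refine ⟨_, _, _, _, jet2_logBarrier h norm_one, jet2_logBarrier h Complex.norm_I, ?_⟩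
  have h0 : 0 < ‖z - p‖ := norm_pos_iff.2 (sub_ne_zero.2 h)
  have h3 : ‖z - p‖ ^ 2 = (z - p).re ^ 2 + (z - p).im ^ 2 := by
    rw [Complex.sq_norm, Complex.normSq_apply]; ring
  simp only [Complex.one_re, Complex.one_im, Complex.I_re, Complex.I_im, mul_one, mul_zero,
    add_zero, zero_add]
  set r := ‖z - p‖
  have h4 : (z - p).im ^ 2 = r ^ 2 - (z - p).re ^ 2 := by linarith
  rw [h4]
  field_simp
  ring

/-- First and second order conditions at a space-time maximum of
`w + 2 log (R - ρ) - c |ζ|² + c' t`. -/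
theorem conditions_of_max {w ρ : ℂ → ℝ → ℝ} {R c c' : ℝ} {ζ : ℂ} {t w₁ w₂ wt ρt a₁ a₂ b₁ b₂ d₁ d₂ : ℝ}
    (jw₁ : Jet2 (fun x : ℝ => w (ζ + x * 1) t) d₁ w₁)
    (jw₂ : Jet2 (fun x : ℝ => w (ζ + x * Complex.I) t) d₂ w₂)
    (jr₁ : Jet2 (fun x : ℝ => ρ (ζ + x * 1) t) a₁ b₁)
    (jr₂ : Jet2 (fun x : ℝ => ρ (ζ + x * Complex.I) t) a₂ b₂)
    (hw : HasDerivAt (fun s => w ζ s) wt t) (hρ : HasDerivAt (fun s => ρ ζ s) ρt t)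
    (hR : ρ ζ t < R)
    (hspace : ∀ᶠ ξ in nhds ζ, w ξ t + 2 * Real.log (R - ρ ξ t) - c * ‖ξ‖ ^ 2 ≤
      w ζ t + 2 * Real.log (R - ρ ζ t) - c * ‖ζ‖ ^ 2)
    (htime : ∀ᶠ s in nhdsWithin t (Iio t), w ζ s + 2 * Real.log (R - ρ ζ s) + c' * s ≤
      w ζ t + 2 * Real.log (R - ρ ζ t) + c' * t) :
    0 ≤ wt + c' - 2 * ρt / (R - ρ ζ t) ∧
    w₁ + w₂ - 2 * (b₁ + b₂) / (R - ρ ζ t) - 2 * (a₁ ^ 2 + a₂ ^ 2) / (R - ρ ζ t) ^ 2 - 4 * c ≤ 0 := by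
  have hpos : 0 < R - ρ ζ t := by linarith
  constructor
  · have hd : HasDerivAt (fun s => w ζ s + 2 * Real.log (R - ρ ζ s) + c' * s)
        (wt + c' - 2 * ρt / (R - ρ ζ t)) t := by
      refine ((hw.add (((hρ.const_sub R).log hpos.ne').const_mul 2)).add
        ((hasDerivAt_id t).const_mul c')).congr_deriv ?_
      ring
    have hs := (hasDerivWithinAt_iff_tendsto_slope' (by simp)).1
      (hd.hasDerivWithinAt (s := Iio t))
    refine ge_of_tendsto hs ?_
    filter_upwards [htime, self_mem_nhdsWithin] with s h1 h2
    rw [slope_def_field]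
    exact div_nonneg_of_nonpos (by linarith) (by have := mem_Iio.1 h2; linarith)
  · have key : ∀ e : ℂ, ‖e‖ = 1 → ∀ d w' a b, Jet2 (fun x : ℝ => w (ζ + x * e) t) d w' →
        Jet2 (fun x : ℝ => ρ (ζ + x * e) t) a b →
        w' - 2 * b / (R - ρ ζ t) - 2 * a ^ 2 / (R - ρ ζ t) ^ 2 - 2 * c ≤ 0 := by
      intro e he d w' a b jw jr
      have j1 := ((Jet2.const R).sub jr).log (by simpa using hpos)
      have j2 := (jw.add (j1.const_mul 2)).sub ((jet2_norm_sq ζ e).const_mul c)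
      have j3 := j2.nonpos_of_isLocalMax ?_
      · simp only [Complex.ofReal_zero, zero_mul, add_zero, he] at j3
        have : w' - 2 * b / (R - ρ ζ t) - 2 * a ^ 2 / (R - ρ ζ t) ^ 2 - 2 * c =
          w' + 2 * ((0 - b) / (R - ρ ζ t) - ((0 - a) / (R - ρ ζ t)) ^ 2) - c * (2 * 1 ^ 2) := by
          field_simp
          ring
        rw [this]; exact j3
      · have hc : Continuous fun x : ℝ => ζ + x * e := by fun_prop
        have := (hc.tendsto' 0 ζ (by simp)).eventually hspace
        filter_upwards [this] with x hx
        simpa using hx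
    have k1 := key 1 norm_one _ _ _ _ jw₁ jr₁
    have k2 := key Complex.I Complex.norm_I _ _ _ _ jw₂ jr₂
    have : w₁ + w₂ - 2 * (b₁ + b₂) / (R - ρ ζ t) - 2 * (a₁ ^ 2 + a₂ ^ 2) / (R - ρ ζ t) ^ 2 - 4 * c =
      (w₁ - 2 * b₁ / (R - ρ ζ t) - 2 * a₁ ^ 2 / (R - ρ ζ t) ^ 2 - 2 * c) +
      (w₂ - 2 * b₂ / (R - ρ ζ t) - 2 * a₂ ^ 2 / (R - ρ ζ t) ^ 2 - 2 * c) := by ring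
    linarith

/-- The complex derivative `½ (∂ₓ - i ∂ᵧ)` associated with a real-linear form. -/
noncomputable def wirtinger (B : ℂ × ℝ →L[ℝ] ℝ) : ℂ :=
  ((B (1, 0) : ℂ) - Complex.I * (B (Complex.I, 0) : ℂ)) / 2

theorem apply_eq_two_mul_re_wirtinger (B : ℂ × ℝ →L[ℝ] ℝ) (w : ℂ) :
    B (w, 0) = 2 * (wirtinger B * w).re := by
  have h1 : ((w, 0) : ℂ × ℝ) = w.re • ((1:ℂ), (0:ℝ)) + w.im • (Complex.I, (0:ℝ)) := by
    refine Prod.ext (Complex.ext ?_ ?_) ?_ <;> simp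
  rw [h1, map_add, map_smul, map_smul]
  simp [wirtinger]
  ring

theorem continuous_wirtinger : Continuous wirtinger := by
  unfold wirtinger
  fun_prop

section

variable {M : Set (ℂ × ℝ)} {V : ℂ × ℝ → ℝ} {A : ℂ × ℝ → (ℂ × ℝ →L[ℝ] ℝ)}
  {H : ℂ × ℝ → (ℂ × ℝ →L[ℝ] ℂ × ℝ →L[ℝ] ℝ)} {γ η : ℝ → ℂ}

/-- Parallel transport of the vector `1` backwards along a path. -/
theorem LogFlow.exists_transport (h : LogFlow M V A H) {t : ℝ} (hη : Continuous η)
    (hγ : ∀ r, HasDerivAt γ (η r) r) (hM : ∀ r ∈ Icc (0:ℝ) 1, (γ r, t) ∈ M) :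
    ∃ Y Y' b : ℝ → ℂ, Continuous Y' ∧ (∀ r, HasDerivAt Y (Y' r) r) ∧ Y 1 = 1 ∧
      ContinuousOn b (Icc 0 1) ∧ (∀ r ∈ Icc (0:ℝ) 1, Y' r = η r * b r) ∧
      (∀ r ∈ Icc (0:ℝ) 1, b r = -wirtinger (A (γ r, t)) * Y r) ∧
      ∀ r ∈ Icc (0:ℝ) 1, ‖Y r‖ ^ 2 * Real.exp (V (γ r, t)) = Real.exp (V (γ 1, t)) := by
  have hγc : Continuous γ := continuous_iff_continuousAt.2 fun r => (hγ r).continuousAt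
  have hc : ContinuousOn (fun r => wirtinger (A (γ r, t))) (Icc 0 1) :=
    continuous_wirtinger.comp_continuousOn
      (h.continuousOn_snd.comp (f := fun r => (γ r, t)) (by fun_prop) hM)
  set f : ℝ → ℂ := fun r => IccExtend zero_le_one
    ((Icc (0:ℝ) 1).domRestrict fun r => wirtinger (A (γ r, t))) r * η r with hf
  have hfc : Continuous f := (hc.domRestrict.Icc_extend' (h := zero_le_one)).mul hη
  have hfI : ∀ r ∈ Icc (0:ℝ) 1, f r = wirtinger (A (γ r, t)) * η r := fun r hr => by
    simp only [hf, IccExtend_of_mem zero_le_one _ hr]; rfl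
  set Φ : ℝ → ℂ := fun r => ∫ x in (1:ℝ)..r, f x with hΦ
  have hΦd : ∀ r, HasDerivAt Φ (f r) r := fun r =>
    hfc.integral_hasStrictDerivAt 1 r |>.hasDerivAt
  have hYd : ∀ r, HasDerivAt (fun r => Complex.exp (-Φ r)) (Complex.exp (-Φ r) * -f r) r :=
    fun r => (hΦd r).neg.cexp
  have hΦc : Continuous Φ := continuous_iff_continuousAt.2 fun r => (hΦd r).continuousAt
  refine ⟨fun r => Complex.exp (-Φ r), fun r => Complex.exp (-Φ r) * -f r,
    fun r => -wirtinger (A (γ r, t)) * Complex.exp (-Φ r), by fun_prop, hYd, by simp [hΦ], ?_, ?_,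
    fun r hr => rfl, ?_⟩
  · exact hc.neg.mul (by fun_prop)
  · intro r hr
    simp only [hfI r hr]
    ring
  · set g : ℝ → ℝ := fun r => V (γ r, t) - 2 * (Φ r).re with hg
    have hgd : ∀ r ∈ Icc (0:ℝ) 1, HasDerivAt g 0 r := by
      intro r hr
      have h1 : HasDerivAt (fun r => V (γ r, t)) (A (γ r, t) (η r, 0)) r :=
        (h.fst _ (hM r hr)).comp_hasDerivAt r ((hγ r).prodMk (hasDerivAt_const r t))
      have h2 := (Complex.reCLM.hasFDerivAt.comp_hasDerivAt r (hΦd r)).const_mul 2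
      refine (h1.sub h2).congr_deriv ?_
      rw [apply_eq_two_mul_re_wirtinger, hfI r hr]
      simp
    have hgc : ∀ r ∈ Icc (0:ℝ) 1, g r = g 0 := constant_of_has_deriv_right_zero
      (fun r hr => (hgd r hr).continuousAt.continuousWithinAt)
      fun r hr => (hgd r (Ico_subset_Icc_self hr)).hasDerivWithinAt
    intro r hr
    have h1 := (hgc r hr).trans (hgc 1 (right_mem_Icc.2 zero_le_one)).symm
    have h2 : Φ 1 = 0 := by simp [hΦ]
    simp only [hg, h2, Complex.zero_re, mul_zero, sub_zero] at h1
    rw [Complex.norm_exp, ← Real.exp_nat_mul, ← Real.exp_add, ← h1]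
    congr 1
    simp
    ring

theorem reach_shift {u : ℂ → ℝ → ℝ} (hpos : ∀ p ∈ M, 0 < u p.1 p.2) {Y Y' b : ℝ → ℂ}
    (hη : Continuous η) (hγ : ∀ r, HasDerivAt γ (η r) r) (hY' : Continuous Y')
    (hY : ∀ r, HasDerivAt Y (Y' r) r) (hb : ∀ r ∈ Icc (0:ℝ) 1, Y' r = η r * b r) {ζ : ℂ} {s : ℝ}
    (hM : ∀ r ∈ Icc (0:ℝ) 1, (γ r + ζ * Y r, s) ∈ M)
    (hsm : ∀ r ∈ Icc (0:ℝ) 1, ‖ζ * b r‖ < 1 / 2) :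
    Reach (fun z => u z s) (timeSlice M s) (γ 0 + ζ * Y 0) (γ 1 + ζ * Y 1)
      (varLen (fun p => Real.log (u p.1 p.2)) γ η Y b ζ s) := by
  refine ⟨fun r => γ r + ζ * Y r, fun r => η r + ζ * Y' r, by fun_prop,
    fun r => (hγ r).add ((hY r).const_mul ζ), hM, rfl, rfl, ?_⟩
  refine intervalIntegral.integral_congr fun r hr => ?_
  rw [uIcc_of_le zero_le_one] at hr
  have e1 : η r + ζ * Y' r = (1 + ζ * b r) * η r := by rw [hb r hr]; ring
  simp only [e1, norm_mul]
  rw [exp_varLog (hsm r hr), Real.exp_log (hpos _ (hM r hr)), mul_assoc]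

end

section

variable {M : Set (ℂ × ℝ)} {V : ℂ × ℝ → ℝ} {A : ℂ × ℝ → (ℂ × ℝ →L[ℝ] ℝ)}
  {H : ℂ × ℝ → (ℂ × ℝ →L[ℝ] ℂ × ℝ →L[ℝ] ℝ)}

theorem continuousAt_varLogFst {X : Type*} [TopologicalSpace X] {x : X} {e : ℂ}
    {z Y b ζ : X → ℂ} {t : X → ℝ} (hA : ContinuousAt (fun x => A (z x + ζ x * Y x, t x)) x)
    (hY : ContinuousAt Y x) (hb : ContinuousAt b x) (hζ : ContinuousAt ζ x)
    (hne : 1 + ζ x * b x ≠ 0) :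
    ContinuousAt (fun x => varLogFst A e (z x) (Y x) (b x) (ζ x) (t x)) x := by
  unfold varLogFst
  have h1 := hA.clm_apply ((continuousAt_const (y := e)).mul hY |>.prodMk
    (continuousAt_const (y := (0:ℝ))))
  exact (h1.div_const 2).add (Complex.continuous_re.continuousAt.comp
    ((continuousAt_const.mul hb).div (continuousAt_const.add (hζ.mul hb)) hne))

theorem LogFlow.exists_uniform_shift (h : LogFlow M V A H) {K : Set (ℂ × ℝ)} (hK : IsCompact K)
    (hKM : K ⊆ M) {ε : ℝ} (hε : 0 < ε) :
    ∃ δ > 0, ∀ (z y Y b : ℂ) (t : ℝ), (z, t) ∈ K → (y, t) ∈ K →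
      ‖Y‖ ^ 2 * Real.exp (V (z, t)) = Real.exp (V (y, t)) → b = -wirtinger (A (z, t)) * Y →
      ∀ (ζ : ℂ) (s : ℝ), ‖ζ‖ < δ → |s - t| < δ →
        (z + ζ * Y, s) ∈ M ∧ (y + ζ, s) ∈ M ∧ ‖ζ * b‖ < 1 / 2 ∧ ‖ζ * Y‖ < ε ∧
        -ε < A (z + ζ * Y, s) (0, 1) / 2 - Real.exp (-V (y + ζ, s)) *
          (varLogSnd H 1 z Y b ζ s + varLogSnd H Complex.I z Y b ζ s +
            varLogFst A 1 z Y b ζ s ^ 2 + varLogFst A Complex.I z Y b ζ s ^ 2) ∧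
        Real.exp (-V (y + ζ, s)) * varLogFst A 1 z Y b ζ s ^ 2 < ε ^ 2 ∧
        Real.exp (-V (y + ζ, s)) * varLogFst A Complex.I z Y b ζ s ^ 2 < ε ^ 2 ∧
        Real.exp (-V (y + ζ, s)) * ‖Y‖ ^ 2 < 2 * Real.exp (-V (z, t)) ∧
        Real.exp (-V (y + ζ, s)) < Real.exp (-V (y, t)) + 1 := by
  -- the compact set of admissible configurations `((z, y), (Y, t))`
  obtain ⟨C, hC⟩ := (hK.prod hK).exists_bound_of_continuousOn
    (f := fun p : (ℂ × ℝ) × (ℂ × ℝ) => Real.exp (V p.2) / Real.exp (V p.1))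
    (((h.continuousOn_fst.mono hKM).comp _root_.continuousOn_snd fun p hp => hp.2).rexp.div
      ((h.continuousOn_fst.mono hKM).comp _root_.continuousOn_fst fun p hp => hp.1).rexp
      fun p _ => (Real.exp_pos _).ne')
  set K₂ : Set ((ℂ × ℂ) × (ℂ × ℝ)) :=
    ((Prod.fst '' K) ×ˢ (Prod.fst '' K)) ×ˢ (closedBall 0 (C + 1) ×ˢ (Prod.snd '' K)) ∩
      {p | (p.1.1, p.2.2) ∈ K ∧ (p.1.2, p.2.2) ∈ K} with hK₂
  have hK₂c : IsCompact K₂ := by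
    refine IsCompact.inter_right ?_ ?_
    · exact ((hK.image continuous_fst).prod (hK.image continuous_fst)).prod
        ((isCompact_closedBall _ _).prod (hK.image continuous_snd))
    · exact (hK.isClosed.preimage (by fun_prop : Continuous fun p : (ℂ × ℂ) × (ℂ × ℝ) =>
        (p.1.1, p.2.2))).inter (hK.isClosed.preimage
          (by fun_prop : Continuous fun p : (ℂ × ℂ) × (ℂ × ℝ) => (p.1.2, p.2.2)))
  have hF : ContinuousOn (fun p : (ℂ × ℂ) × (ℂ × ℝ) => ‖p.2.1‖ ^ 2 * Real.exp (V (p.1.1, p.2.2)) -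
      Real.exp (V (p.1.2, p.2.2))) K₂ := by
    have h1 : ContinuousOn (fun p : (ℂ × ℂ) × (ℂ × ℝ) => V (p.1.1, p.2.2)) K₂ :=
      (h.continuousOn_fst.mono hKM).comp (by fun_prop) fun p hp => hp.2.1
    have h2 : ContinuousOn (fun p : (ℂ × ℂ) × (ℂ × ℝ) => V (p.1.2, p.2.2)) K₂ :=
      (h.continuousOn_fst.mono hKM).comp (by fun_prop) fun p hp => hp.2.2
    have h3 : Continuous (fun p : (ℂ × ℂ) × (ℂ × ℝ) => ‖p.2.1‖ ^ 2) := by fun_prop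
    exact (h3.continuousOn.mul h1.rexp).sub h2.rexp
  set K₃ := K₂ ∩ (fun p : (ℂ × ℂ) × (ℂ × ℝ) => ‖p.2.1‖ ^ 2 * Real.exp (V (p.1.1, p.2.2)) -
      Real.exp (V (p.1.2, p.2.2))) ⁻¹' {0} with hPe
  have hPc : IsCompact K₃ := hK₂c.of_isClosed_subset
    (hF.preimage_isClosed_of_isClosed hK₂c.isClosed isClosed_singleton) inter_subset_left
  have main := hPc.eventually_forall_of_forall_eventually (x₀ := ((0, 0) : ℂ × ℝ))
    (P := fun q p => (p.1.1 + q.1 * p.2.1, p.2.2 + q.2) ∈ M ∧ (p.1.2 + q.1, p.2.2 + q.2) ∈ M ∧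
        ‖q.1 * (-wirtinger (A (p.1.1, p.2.2)) * p.2.1)‖ < 1 / 2 ∧ ‖q.1 * p.2.1‖ < ε ∧
        -ε < A (p.1.1 + q.1 * p.2.1, p.2.2 + q.2) (0, 1) / 2 -
          Real.exp (-V (p.1.2 + q.1, p.2.2 + q.2)) *
          (‖p.2.1‖ ^ 2 * (H (p.1.1 + q.1 * p.2.1, p.2.2 + q.2) (1, 0) (1, 0) +
            H (p.1.1 + q.1 * p.2.1, p.2.2 + q.2) (Complex.I, 0) (Complex.I, 0)) / 2 +
            varLogFst A 1 p.1.1 p.2.1 (-wirtinger (A (p.1.1, p.2.2)) * p.2.1) q.1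
              (p.2.2 + q.2) ^ 2 +
            varLogFst A Complex.I p.1.1 p.2.1 (-wirtinger (A (p.1.1, p.2.2)) * p.2.1) q.1
              (p.2.2 + q.2) ^ 2) ∧
        Real.exp (-V (p.1.2 + q.1, p.2.2 + q.2)) *
          varLogFst A 1 p.1.1 p.2.1 (-wirtinger (A (p.1.1, p.2.2)) * p.2.1) q.1
            (p.2.2 + q.2) ^ 2 < ε ^ 2 ∧
        Real.exp (-V (p.1.2 + q.1, p.2.2 + q.2)) *
          varLogFst A Complex.I p.1.1 p.2.1 (-wirtinger (A (p.1.1, p.2.2)) * p.2.1) q.1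
            (p.2.2 + q.2) ^ 2 < ε ^ 2 ∧
        Real.exp (-V (p.1.2 + q.1, p.2.2 + q.2)) * ‖p.2.1‖ ^ 2 <
          2 * Real.exp (-V (p.1.1, p.2.2)) ∧
        Real.exp (-V (p.1.2 + q.1, p.2.2 + q.2)) < Real.exp (-V (p.1.2, p.2.2)) + 1) ?_
  · obtain ⟨δ, hδ, hball⟩ := Metric.eventually_nhds_iff.1 main
    refine ⟨δ, hδ, fun z y Y b t hz hy hYe hb ζ s hζ hs => ?_⟩
    have hp : ((z, y), (Y, t)) ∈ K₃ := by
      refine ⟨⟨⟨⟨⟨_, hz, rfl⟩, ⟨_, hy, rfl⟩⟩, ?_, ⟨_, hz, rfl⟩⟩, hz, hy⟩, by simp [hYe]⟩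
      have h1 := hC ((z, t), (y, t)) ⟨hz, hy⟩
      simp only [← hYe, mul_div_assoc, div_self (Real.exp_pos _).ne', mul_one, norm_pow,
        norm_norm] at h1
      simp only [mem_closedBall, dist_zero_right]
      nlinarith [norm_nonneg Y]
    have := hball (y := (ζ, s - t)) (by simp [Prod.dist_eq, hζ, hs]) _ hp
    simp only [add_sub_cancel, ← hb] at this
    simpa only [LogFlow.varLogSnd_add] using this
  · rintro ⟨⟨z, y⟩, Y, t⟩ hp
    obtain ⟨⟨-, hz, hy⟩, hYe⟩ := hp
    simp only [mem_preimage, mem_singleton_iff, sub_eq_zero] at hz hy hYe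
    have hzM := hKM hz
    have hyM := hKM hy
    set x₀ : (ℂ × ℝ) × ((ℂ × ℂ) × (ℂ × ℝ)) := ((0, 0), ((z, y), (Y, t))) with hx₀
    have c1 : ContinuousAt (fun x : (ℂ × ℝ) × ((ℂ × ℂ) × (ℂ × ℝ)) =>
      (x.2.1.1 + x.1.1 * x.2.2.1, x.2.2.2 + x.1.2)) x₀ := by fun_prop
    have c2 : ContinuousAt (fun x : (ℂ × ℝ) × ((ℂ × ℂ) × (ℂ × ℝ)) =>
      (x.2.1.2 + x.1.1, x.2.2.2 + x.1.2)) x₀ := by fun_prop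
    have c3 : ContinuousAt (fun x : (ℂ × ℝ) × ((ℂ × ℂ) × (ℂ × ℝ)) =>
      (x.2.1.1, x.2.2.2)) x₀ := by fun_prop
    have c4 : ContinuousAt (fun x : (ℂ × ℝ) × ((ℂ × ℂ) × (ℂ × ℝ)) =>
      (x.2.1.2, x.2.2.2)) x₀ := by fun_prop
    have cζ : ContinuousAt (fun x : (ℂ × ℝ) × ((ℂ × ℂ) × (ℂ × ℝ)) => x.1.1) x₀ := by fun_prop
    have cY : ContinuousAt (fun x : (ℂ × ℝ) × ((ℂ × ℂ) × (ℂ × ℝ)) => x.2.2.1) x₀ := by fun_prop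
    have v1 : (x₀.2.1.1 + x₀.1.1 * x₀.2.2.1, x₀.2.2.2 + x₀.1.2) = (z, t) := by simp [hx₀]
    have v2 : (x₀.2.1.2 + x₀.1.1, x₀.2.2.2 + x₀.1.2) = (y, t) := by simp [hx₀]
    have cA1 := (h.snd _ hzM).continuousAt.comp_of_eq c1 v1
    have cH1 := (h.cont.continuousAt (h.opn.mem_nhds hzM)).comp_of_eq c1 v1
    have cV2 := (h.fst _ hyM).continuousAt.comp_of_eq c2 v2
    have ca := (cV2.neg).rexp
    have cV4 := (h.fst _ hyM).continuousAt.comp_of_eq c4 rfl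
    have cV3 := (h.fst _ hzM).continuousAt.comp_of_eq c3 rfl
    have cA3 := (h.snd _ hzM).continuousAt.comp_of_eq c3 rfl
    have cb := ((continuous_wirtinger.continuousAt.comp cA3).neg).mul cY
    have cg : ∀ e, _ := fun e : ℂ => continuousAt_varLogFst (e := e) cA1 cY cb cζ (by simp [hx₀])
    have cζb := (cζ.mul cb).norm
    have cζY := (cζ.mul cY).norm
    have cY2 := cY.norm.pow 2
    have cT := (cA1.clm_apply (continuousAt_const (y := ((0:ℂ), (1:ℝ))))).div_const 2
    have cHe : ∀ e, _ := fun e : ℂ × ℝ =>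
      (cH1.clm_apply (continuousAt_const (y := e))).clm_apply (continuousAt_const (y := e))
    have hg : ∀ e : ℂ, varLogFst A e z Y (-(wirtinger (A (z, t)) * Y)) 0 t = 0 := by
      intro e
      rw [varLogFst, zero_mul, add_zero, zero_mul, add_zero, apply_eq_two_mul_re_wirtinger]
      have : e * -(wirtinger (A (z, t)) * Y) / 1 = -(wirtinger (A (z, t)) * (e * Y)) := by
        rw [div_one]; ring
      rw [this, Complex.neg_re]
      ring
    have hεsq : 0 < ε ^ 2 := by positivity
    have r1 : Real.exp (-V (y, t)) * ‖Y‖ ^ 2 = Real.exp (-V (z, t)) := by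
      rw [Real.exp_neg, Real.exp_neg, ← hYe]
      have := Real.exp_pos (V (z, t))
      have h0 : ‖Y‖ ≠ 0 := by
        intro h0
        rw [h0, zero_pow two_ne_zero, zero_mul] at hYe
        exact (Real.exp_pos _).ne hYe
      field_simp
    have r2 : A (z, t) (0, 1) / 2 - Real.exp (-V (y, t)) * (‖Y‖ ^ 2 *
        (H (z, t) (1, 0) (1, 0) + H (z, t) (Complex.I, 0) (Complex.I, 0)) / 2) = 0 := by
      rw [← h.evol _ hzM]
      have : Real.exp (-V (z, t)) * Real.exp (V (z, t)) = 1 := by rw [← Real.exp_add]; simp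
      linear_combination (-(Real.exp (V (z, t)) * A (z, t) (0, 1) / 2)) * r1 -
        A (z, t) (0, 1) / 2 * this
    filter_upwards [c1.eventually (v1 ▸ h.opn.mem_nhds hzM), c2.eventually (v2 ▸ h.opn.mem_nhds hyM),
      cζb.eventually_lt continuousAt_const (show _ < (1 / 2 : ℝ) by simp [hx₀]),
      cζY.eventually_lt continuousAt_const (show _ < ε by simpa [hx₀] using hε),
      (continuousAt_const (y := -ε)).eventually_lt
        (cT.sub (ca.mul ((((cY2.mul ((cHe (1, 0)).add (cHe (Complex.I, 0)))).div_const 2).add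
          ((cg 1).pow 2)).add ((cg Complex.I).pow 2))))
        (by simp [hx₀, hg]; linarith),
      (ca.mul ((cg 1).pow 2)).eventually_lt continuousAt_const
        (show _ < ε ^ 2 by simpa [hx₀, hg] using hεsq),
      (ca.mul ((cg Complex.I).pow 2)).eventually_lt continuousAt_const
        (show _ < ε ^ 2 by simpa [hx₀, hg] using hεsq),
      (ca.mul cY2).eventually_lt (continuousAt_const.mul (cV3.neg).rexp)
        (show _ < (2:ℝ) * _ by simp [hx₀, r1, Real.exp_pos]),
      ca.eventually_lt ((cV4.neg).rexp.add continuousAt_const)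
        (show _ < _ + (1:ℝ) by simp [hx₀])] with x a1 a2 a3 a4 a5 a6 a7 a8 a9
    exact ⟨a1, a2, a3, a4, a5, a6, a7, a8, a9⟩

end

theorem neg_mul_integral_le {E F P Q n : ℝ → ℝ} {a ε : ℝ}
    (i0 : IntervalIntegrable (fun r => E r * n r) volume 0 1)
    (i1 : IntervalIntegrable (fun r => E r * F r * n r) volume 0 1)
    (i2 : IntervalIntegrable (fun r => E r * P r * n r) volume 0 1)
    (i3 : IntervalIntegrable (fun r => E r * Q r * n r) volume 0 1)
    (hE : ∀ r, 0 ≤ E r) (hn : ∀ r, 0 ≤ n r)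
    (hε : ∀ r ∈ Icc (0:ℝ) 1, -ε ≤ F r - a * (P r + Q r)) :
    -ε * (∫ r in (0:ℝ)..1, E r * n r) ≤ (∫ r in (0:ℝ)..1, E r * F r * n r) -
      a * ((∫ r in (0:ℝ)..1, E r * P r * n r) + ∫ r in (0:ℝ)..1, E r * Q r * n r) := by
  rw [← intervalIntegral.integral_const_mul, ← intervalIntegral.integral_add i2 i3,
    ← intervalIntegral.integral_const_mul, ← intervalIntegral.integral_sub i1 ((i2.add i3).const_mul a)]
  refine intervalIntegral.integral_mono_on zero_le_one (i0.const_mul _)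
    (i1.sub ((i2.add i3).const_mul a)) fun r hr => ?_
  have h1 := mul_le_mul_of_nonneg_right (hε r hr) (mul_nonneg (hE r) (hn r))
  linarith

namespace ShiftAdmissible

variable {M : Set (ℂ × ℝ)} {V : ℂ × ℝ → ℝ} {A : ℂ × ℝ → (ℂ × ℝ →L[ℝ] ℝ)}
  {H : ℂ × ℝ → (ℂ × ℝ →L[ℝ] ℂ × ℝ →L[ℝ] ℝ)} {γ η Y b : ℝ → ℂ} {S : Set (ℂ × ℝ)}

theorem intervalIntegrable_slice {f : (ℂ × ℝ) × ℝ → ℝ} (hf : ContinuousOn f (S ×ˢ Icc (0:ℝ) 1))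
    {q : ℂ × ℝ} (hq : q ∈ S) : IntervalIntegrable (fun r => f (q, r)) volume 0 1 := by
  apply ContinuousOn.intervalIntegrable
  rw [uIcc_of_le zero_le_one]
  exact slice hf hq

theorem neg_mul_varLen_le (hA : LogFlow M V A H) (h : ShiftAdmissible M γ η Y b S) {ζ : ℂ} {t : ℝ}
    (hq : (ζ, t) ∈ S) {a ε : ℝ}
    (hε : ∀ r ∈ Icc (0:ℝ) 1, -ε ≤ A (γ r + ζ * Y r, t) (0, 1) / 2 - a *
      (varLogSnd H 1 (γ r) (Y r) (b r) ζ t + varLogSnd H Complex.I (γ r) (Y r) (b r) ζ t +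
        varLogFst A 1 (γ r) (Y r) (b r) ζ t ^ 2 +
        varLogFst A Complex.I (γ r) (Y r) (b r) ζ t ^ 2)) :
    -ε * varLen V γ η Y b ζ t ≤
      (∫ r in (0:ℝ)..1, Real.exp (varLog V (γ r) (Y r) (b r) ζ t) *
        (A (γ r + ζ * Y r, t) (0, 1) / 2) * ‖η r‖) - a *
      ((∫ r in (0:ℝ)..1, Real.exp (varLog V (γ r) (Y r) (b r) ζ t) *
        (varLogSnd H 1 (γ r) (Y r) (b r) ζ t + varLogFst A 1 (γ r) (Y r) (b r) ζ t ^ 2) * ‖η r‖) +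
      ∫ r in (0:ℝ)..1, Real.exp (varLog V (γ r) (Y r) (b r) ζ t) *
        (varLogSnd H Complex.I (γ r) (Y r) (b r) ζ t +
          varLogFst A Complex.I (γ r) (Y r) (b r) ζ t ^ 2) * ‖η r‖) := by
  have c0 : ContinuousOn (fun r => varLog V (γ r) (Y r) (b r) ζ t) (Icc 0 1) :=
    (slice (h.continuousOn_varLog hA) hq :)
  have ct : ContinuousOn (fun r => A (γ r + ζ * Y r, t) (0, 1)) (Icc 0 1) :=
    (slice (h.continuousOn_time hA) hq :)
  have cf : ∀ e, ContinuousOn (fun r => varLogFst A e (γ r) (Y r) (b r) ζ t) (Icc 0 1) :=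
    fun e => (slice (h.continuousOn_varLogFst hA e) hq :)
  have cs : ∀ e, ContinuousOn (fun r => varLogSnd H e (γ r) (Y r) (b r) ζ t) (Icc 0 1) :=
    fun e => (slice (h.continuousOn_varLogSnd hA e) hq :)
  have cv := h.vel.norm
  have key : ∀ f : ℝ → ℝ, ContinuousOn f (Icc 0 1) → IntervalIntegrable f volume 0 1 :=
    fun f hf => ContinuousOn.intervalIntegrable (by rwa [uIcc_of_le zero_le_one])
  have i0 := key _ (c0.rexp.mul cv)
  have i1 := key _ ((c0.rexp.mul (ct.div_const 2)).mul cv)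
  have i2 := key _ ((c0.rexp.mul ((cs 1).add ((cf 1).pow 2))).mul cv)
  have i3 := key _ ((c0.rexp.mul ((cs Complex.I).add ((cf Complex.I).pow 2))).mul cv)
  exact neg_mul_integral_le i0 i1 i2 i3 (fun r => (Real.exp_pos _).le) (fun r => norm_nonneg _)
    fun r hr => (hε r hr).trans (le_of_eq (by ring))

theorem mul_sq_le (hA : LogFlow M V A H) (h : ShiftAdmissible M γ η Y b S) {ζ : ℂ} {t : ℝ}
    (hq : (ζ, t) ∈ S) {a ε : ℝ} {e : ℂ} (ha : 0 ≤ a) (hε0 : 0 ≤ ε)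
    (hε : ∀ r ∈ Icc (0:ℝ) 1, a * varLogFst A e (γ r) (Y r) (b r) ζ t ^ 2 ≤ ε ^ 2) :
    a * (∫ r in (0:ℝ)..1, Real.exp (varLog V (γ r) (Y r) (b r) ζ t) *
        varLogFst A e (γ r) (Y r) (b r) ζ t * ‖η r‖) ^ 2 ≤ (ε * varLen V γ η Y b ζ t) ^ 2 := by
  have c0 := (h.continuousOn_varLog hA).rexp
  have cv := h.continuousOn_speed
  have i0 := intervalIntegrable_slice (c0.mul cv) hq
  set I := ∫ r in (0:ℝ)..1, Real.exp (varLog V (γ r) (Y r) (b r) ζ t) *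
        varLogFst A e (γ r) (Y r) (b r) ζ t * ‖η r‖
  have h1 : |Real.sqrt a * I| ≤ ε * varLen V γ η Y b ζ t := by
    rw [varLen, ← intervalIntegral.integral_const_mul, ← intervalIntegral.integral_const_mul,
      ← Real.norm_eq_abs]
    refine intervalIntegral.norm_integral_le_of_norm_le zero_le_one
      (Eventually.of_forall fun r hr => ?_) (i0.const_mul _)
    have h2 : |Real.sqrt a * varLogFst A e (γ r) (Y r) (b r) ζ t| ≤ ε := by
      refine abs_le_of_sq_le_sq ?_ hε0
      rw [mul_pow, Real.sq_sqrt ha]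
      exact hε r (Ioc_subset_Icc_self hr)
    have h3 := mul_le_mul_of_nonneg_right h2
      (mul_nonneg (Real.exp_pos (varLog V (γ r) (Y r) (b r) ζ t)).le (norm_nonneg (η r)))
    rw [Real.norm_eq_abs]
    refine (le_of_eq ?_).trans h3
    rw [show Real.sqrt a * (Real.exp (varLog V (γ r) (Y r) (b r) ζ t) *
        varLogFst A e (γ r) (Y r) (b r) ζ t * ‖η r‖) =
        (Real.sqrt a * varLogFst A e (γ r) (Y r) (b r) ζ t) *
        (Real.exp (varLog V (γ r) (Y r) (b r) ζ t) * ‖η r‖) by ring, abs_mul,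
      abs_of_nonneg (mul_nonneg (Real.exp_pos _).le (norm_nonneg _))]
  calc a * I ^ 2 = |Real.sqrt a * I| ^ 2 := by rw [sq_abs, mul_pow, Real.sq_sqrt ha]
    _ ≤ _ := pow_le_pow_left₀ (abs_nonneg _) h1 2

theorem varLen_nonneg : ∀ ζ t, 0 ≤ varLen V γ η Y b ζ t := fun _ _ =>
  intervalIntegral.integral_nonneg zero_le_one fun _ _ =>
    mul_nonneg (Real.exp_pos _).le (norm_nonneg _)

end ShiftAdmissible

theorem mul_sq_le_of_conditions {τ a lapL lapV Vt ρt lapR S c c' C₀ ρ R E : ℝ} (hτ : 0 < τ)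
    (ha : 0 ≤ a) (hR : 0 < R) (hρ0 : 0 ≤ ρ) (hρ : ρ < R) (hc : 0 ≤ c) (hc' : 0 ≤ c') (hC₀ : 0 ≤ C₀)
    (hV : Vt = a * lapV) (hE : E ≤ τ * (a * lapL))
    (h1 : 0 ≤ 1 / τ - Vt + c' - 2 * ρt / (R - ρ))
    (h2 : lapL - lapV - 2 * lapR / (R - ρ) - 2 * S / (R - ρ) ^ 2 - 4 * c ≤ 0)
    (h3 : -C₀ ≤ ρt - a * lapR) (h4 : a * S ≤ C₀) :
    E * (1 - ρ / R) ^ 2 ≤ 1 + τ * (c' + 4 * (a * c) + 2 * C₀ / R + 2 * C₀ / R ^ 2) := by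
  have hD : 0 < R - ρ := by linarith
  set D := R - ρ with hDdef
  have hDR : D ≤ R := by linarith
  have e1 : 1 - ρ / R = D / R := by rw [hDdef]; field_simp
  have k1 : a * lapL ≤ 1 / τ + c' + 4 * (a * c) + 2 * C₀ / D + 2 * C₀ / D ^ 2 := by
    have m1 := mul_nonneg ha (neg_nonneg.2 h2)
    have m2 : 2 * (-C₀) / D ≤ 2 * (ρt - a * lapR) / D := by gcongr
    have m3 : 2 * (a * S) / D ^ 2 ≤ 2 * C₀ / D ^ 2 := by gcongr
    have m4 : 2 * (ρt - a * lapR) / D = 2 * ρt / D - a * (2 * lapR / D) := by ring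
    have m5 : 2 * (a * S) / D ^ 2 = a * (2 * S / D ^ 2) := by ring
    have m6 : 2 * (-C₀) / D = -(2 * C₀ / D) := by ring
    nlinarith
  have hDR1 : D / R ≤ 1 := (div_le_one hR).2 hDR
  have hDR0 : 0 ≤ D / R := (div_pos hD hR).le
  have hDR2 : (D / R) ^ 2 ≤ 1 := pow_le_one₀ hDR0 hDR1
  rw [e1]
  calc E * (D / R) ^ 2 ≤ τ * (1 / τ + c' + 4 * (a * c) + 2 * C₀ / D + 2 * C₀ / D ^ 2) *
        (D / R) ^ 2 := by gcongr; exact hE.trans (by gcongr)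
    _ = (D / R) ^ 2 * 1 + τ * ((c' + 4 * (a * c)) * (D / R) ^ 2 + 2 * C₀ / R * (D / R) +
        2 * C₀ / R ^ 2) := by field_simp; ring
    _ ≤ 1 * 1 + τ * ((c' + 4 * (a * c)) * 1 + 2 * C₀ / R * 1 + 2 * C₀ / R ^ 2) := by gcongr
    _ = _ := by ring

section

variable {M : Set (ℂ × ℝ)} {V : ℂ × ℝ → ℝ} {A : ℂ × ℝ → (ℂ × ℝ →L[ℝ] ℝ)}
  {H : ℂ × ℝ → (ℂ × ℝ →L[ℝ] ℂ × ℝ →L[ℝ] ℝ)} {γ η Y b : ℝ → ℂ} {S : Set (ℂ × ℝ)}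

/-- The total cost of a shifted path: its length plus a quadratic penalty on its base point. -/
noncomputable def varCost (V : ℂ × ℝ → ℝ) (γ η Y b : ℝ → ℂ) (B : ℝ) (x₀ ζ : ℂ) (t : ℝ) : ℝ :=
  varLen V γ η Y b ζ t + B * ‖γ 0 + ζ * Y 0 - x₀‖ ^ 2

/-- The logarithm of `2 (t - t₀) e^(logBarrier) / e^V` at the point `z`. -/
noncomputable def logRatio (V : ℂ × ℝ → ℝ) (p : ℂ) (t₀ : ℝ) (z : ℂ) (t : ℝ) : ℝ :=
  Real.log (2 * (t - t₀)) + logBarrier p z - V (z, t)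

theorem exp_logRatio {p z : ℂ} {t₀ t : ℝ} (ht : t₀ < t) :
    Real.exp (logRatio V p t₀ z t) =
      2 * (t - t₀) * Real.exp (logBarrier p z) * Real.exp (-V (z, t)) := by
  rw [logRatio, sub_eq_add_neg, Real.exp_add, Real.exp_add, Real.exp_log (by linarith)]

/-- The constant in the estimate at a maximum point. -/
noncomputable def maxConst (B r₀ lam : ℝ) : ℝ := 4 + 8 * B / lam + 16 * B ^ 2 * r₀ ^ 2 / lam

theorem mul_add_sq_le {a i j k l x y w : ℝ} (ha : 0 ≤ a) (h1 : a * i ^ 2 ≤ x)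
    (h2 : a * j ^ 2 ≤ y) (h3 : k ^ 2 + l ^ 2 = w) :
    a * ((i + k) ^ 2 + (j + l) ^ 2) ≤ 2 * x + 2 * y + 2 * (a * w) := by
  subst h3
  nlinarith [mul_nonneg ha (sq_nonneg (i - k)), mul_nonneg ha (sq_nonneg (j - l))]

theorem bound_at_max (hA : LogFlow M V A H) (h : ShiftAdmissible M γ η Y b S) {ζ z p x₀ : ℂ}
    {s t₀ R B r₀ lam c c' : ℝ} (hq : (ζ, s) ∈ S) (hz : (z + ζ, s) ∈ M) (hzp : z + ζ ≠ p)
    (hz2 : ‖z + ζ - p‖ ≤ 2) (ht : t₀ < s) (hR : 0 < R) (hB : 0 ≤ B) (hlam : 0 < lam)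
    (hc : 0 ≤ c) (hc' : 0 ≤ c') (hy : ‖γ 0 + ζ * Y 0 - x₀‖ ≤ r₀)
    (hY : Real.exp (-V (z + ζ, s)) * ‖Y 0‖ ^ 2 ≤ 2 / lam)
    (hev : ∀ r ∈ Icc (0:ℝ) 1, -(1 / R) ≤ A (γ r + ζ * Y r, s) (0, 1) / 2 -
      Real.exp (-V (z + ζ, s)) *
      (varLogSnd H 1 (γ r) (Y r) (b r) ζ s + varLogSnd H Complex.I (γ r) (Y r) (b r) ζ s +
        varLogFst A 1 (γ r) (Y r) (b r) ζ s ^ 2 +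
        varLogFst A Complex.I (γ r) (Y r) (b r) ζ s ^ 2))
    (hg₁ : ∀ r ∈ Icc (0:ℝ) 1, Real.exp (-V (z + ζ, s)) *
      varLogFst A 1 (γ r) (Y r) (b r) ζ s ^ 2 ≤ (1 / R) ^ 2)
    (hg₂ : ∀ r ∈ Icc (0:ℝ) 1, Real.exp (-V (z + ζ, s)) *
      varLogFst A Complex.I (γ r) (Y r) (b r) ζ s ^ 2 ≤ (1 / R) ^ 2)
    (hρR : varCost V γ η Y b B x₀ ζ s < R)
    (hspace : ∀ᶠ ξ in nhds ζ, logRatio V p t₀ (z + ξ) s +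
        2 * Real.log (R - varCost V γ η Y b B x₀ ξ s) - c * ‖ξ‖ ^ 2 ≤
      logRatio V p t₀ (z + ζ) s + 2 * Real.log (R - varCost V γ η Y b B x₀ ζ s) - c * ‖ζ‖ ^ 2)
    (htime : ∀ᶠ t in nhdsWithin s (Iio s), logRatio V p t₀ (z + ζ) t +
        2 * Real.log (R - varCost V γ η Y b B x₀ ζ t) + c' * t ≤
      logRatio V p t₀ (z + ζ) s + 2 * Real.log (R - varCost V γ η Y b B x₀ ζ s) + c' * s) :
    Real.exp (logRatio V p t₀ (z + ζ) s) * (1 - varCost V γ η Y b B x₀ ζ s / R) ^ 2 ≤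
      1 + (s - t₀) * (c' + 4 * (Real.exp (-V (z + ζ, s)) * c) + 2 * maxConst B r₀ lam / R +
        2 * maxConst B r₀ lam / R ^ 2) := by
  obtain ⟨d₁, l₁, d₂, l₂, jl₁, jl₂, hl⟩ := exists_jet2_logBarrier hzp
  have hV : ∀ e : ℂ, Jet2 (fun x : ℝ => V (z + (ζ + x * e), s)) (A (z + ζ, s) (e, 0))
      (H (z + ζ, s) (e, 0) (e, 0)) := fun e =>
    (hA.jet2_line hz).congr (Eventually.of_forall fun x => by rw [add_assoc])
  have jw : ∀ (e : ℂ) (d l : ℝ), Jet2 (fun x : ℝ => logBarrier p (z + ζ + x * e)) d l →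
      Jet2 (fun x : ℝ => logRatio V p t₀ (z + (ζ + x * e)) s) (0 + d - A (z + ζ, s) (e, 0))
        (0 + l - H (z + ζ, s) (e, 0) (e, 0)) := fun e d l j =>
    ((Jet2.const (Real.log (2 * (s - t₀)))).add (j.congr (g := fun x : ℝ =>
      logBarrier p (z + (ζ + x * e))) (Eventually.of_forall fun x => by rw [add_assoc]))).sub (hV e)
  set q := γ 0 + ζ * Y 0 - x₀ with hqdef
  have jG : ∀ e : ℂ, Jet2 (fun x : ℝ => B * ‖γ 0 + (ζ + x * e) * Y 0 - x₀‖ ^ 2)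
      (B * (2 * (q.re * (e * Y 0).re + q.im * (e * Y 0).im))) (B * (2 * ‖e * Y 0‖ ^ 2)) := fun e =>
    ((jet2_norm_sq q (e * Y 0)).const_mul B).congr (Eventually.of_forall fun x => by
      rw [show γ 0 + (ζ + x * e) * Y 0 - x₀ = q + x * (e * Y 0) by rw [hqdef]; ring])
  have jr := fun e : ℂ => (h.jet2_varLen hA hq e).add (jG e)
  have dV : HasDerivAt (fun t => V (z + ζ, t)) (A (z + ζ, s) (0, 1)) s := hA.hasDerivAt_time hz
  have dw : HasDerivAt (fun t => logRatio V p t₀ (z + ζ) t)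
      (1 / (s - t₀) - A (z + ζ, s) (0, 1)) s := by
    have h1 : HasDerivAt (fun t : ℝ => 2 * (t - t₀)) (2 * 1) s :=
      ((hasDerivAt_id s).sub_const t₀).const_mul 2
    have h2 := ((h1.log (by linarith)).add_const (logBarrier p (z + ζ))).sub dV
    refine h2.congr_deriv ?_
    have : s - t₀ ≠ 0 := by linarith
    field_simp
  have dr := (h.hasDerivAt_varLen_time hA hq).add_const (B * ‖q‖ ^ 2)
  obtain ⟨k1, k2⟩ := conditions_of_max (w := fun ξ t => logRatio V p t₀ (z + ξ) t)
    (ρ := fun ξ t => varCost V γ η Y b B x₀ ξ t) (jw 1 _ _ jl₁) (jw Complex.I _ _ jl₂) (jr 1)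
    (jr Complex.I) dw dr hρR hspace htime
  have hn := h.neg_mul_varLen_le hA hq hev
  have hs1 := h.mul_sq_le hA hq (Real.exp_pos _).le (by positivity) hg₁
  have hs2 := h.mul_sq_le hA hq (Real.exp_pos _).le (by positivity) hg₂
  have hL0 : 0 ≤ varLen V γ η Y b ζ s := ShiftAdmissible.varLen_nonneg ζ s
  have hG0 : 0 ≤ B * ‖q‖ ^ 2 := by positivity
  have hρeq : varCost V γ η Y b B x₀ ζ s = varLen V γ η Y b ζ s + B * ‖q‖ ^ 2 := rfl
  set ρ := varCost V γ η Y b B x₀ ζ s with hρ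
  set ℓ := varLen V γ η Y b ζ s with hℓ
  set a := Real.exp (-V (z + ζ, s)) with ha
  set It := ∫ r in (0:ℝ)..1, Real.exp (varLog V (γ r) (Y r) (b r) ζ s) *
        (A (γ r + ζ * Y r, s) (0, 1) / 2) * ‖η r‖
  set I₁ := ∫ r in (0:ℝ)..1, Real.exp (varLog V (γ r) (Y r) (b r) ζ s) *
        varLogFst A 1 (γ r) (Y r) (b r) ζ s * ‖η r‖
  set I₂ := ∫ r in (0:ℝ)..1, Real.exp (varLog V (γ r) (Y r) (b r) ζ s) *
        varLogFst A Complex.I (γ r) (Y r) (b r) ζ s * ‖η r‖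
  set J₁ := ∫ r in (0:ℝ)..1, Real.exp (varLog V (γ r) (Y r) (b r) ζ s) *
        (varLogSnd H 1 (γ r) (Y r) (b r) ζ s + varLogFst A 1 (γ r) (Y r) (b r) ζ s ^ 2) * ‖η r‖
  set J₂ := ∫ r in (0:ℝ)..1, Real.exp (varLog V (γ r) (Y r) (b r) ζ s) *
        (varLogSnd H Complex.I (γ r) (Y r) (b r) ζ s +
          varLogFst A Complex.I (γ r) (Y r) (b r) ζ s ^ 2) * ‖η r‖
  have ha0 : 0 < a := Real.exp_pos _
  have hlR : 1 / R * ℓ ≤ 1 := by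
    rw [one_div, inv_mul_le_iff₀ hR]; linarith
  have hlR0 : 0 ≤ 1 / R * ℓ := by positivity
  have hlR2 : (1 / R * ℓ) ^ 2 ≤ 1 := pow_le_one₀ hlR0 hlR
  have hsum : (B * (2 * (q.re * (1 * Y 0).re + q.im * (1 * Y 0).im))) ^ 2 +
      (B * (2 * (q.re * (Complex.I * Y 0).re + q.im * (Complex.I * Y 0).im))) ^ 2 =
      4 * B ^ 2 * ‖q‖ ^ 2 * ‖Y 0‖ ^ 2 := by
    simp only [Complex.sq_norm, Complex.normSq_apply, Complex.mul_re, Complex.mul_im,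
      Complex.I_re, Complex.I_im, Complex.one_re, Complex.one_im]
    ring
  have hq2 : ‖q‖ ^ 2 ≤ r₀ ^ 2 := pow_le_pow_left₀ (norm_nonneg _) hy 2
  refine (mul_sq_le_of_conditions (τ := s - t₀) (a := a) (lapL := 1 / ‖z + ζ - p‖)
    (lapV := H (z + ζ, s) (1, 0) (1, 0) + H (z + ζ, s) (Complex.I, 0) (Complex.I, 0))
    (Vt := A (z + ζ, s) (0, 1)) (ρt := It)
    (lapR := J₁ + B * (2 * ‖1 * Y 0‖ ^ 2) + (J₂ + B * (2 * ‖Complex.I * Y 0‖ ^ 2)))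
    (S := (I₁ + B * (2 * (q.re * (1 * Y 0).re + q.im * (1 * Y 0).im))) ^ 2 +
      (I₂ + B * (2 * (q.re * (Complex.I * Y 0).re + q.im * (Complex.I * Y 0).im))) ^ 2)
    (c := c) (c' := c') (by linarith) ha0.le hR (by linarith) hρR hc hc' ?_ ?_ ?_ k1 ?_ ?_ ?_)
  · unfold maxConst; positivity
  · rw [← hA.evol _ hz, ← mul_assoc, ha, ← Real.exp_add]
    simp
  · rw [exp_logRatio ht]
    have := two_mul_exp_logBarrier_le hzp hz2
    have h3 : 0 < s - t₀ := by linarith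
    calc 2 * (s - t₀) * Real.exp (logBarrier p (z + ζ)) * a =
        (s - t₀) * (a * (2 * Real.exp (logBarrier p (z + ζ)))) := by ring
      _ ≤ _ := by gcongr
  · rw [← hl]
    refine le_trans (le_of_eq ?_) k2
    ring
  · have hb1 : a * (B * ‖Y 0‖ ^ 2) ≤ B * (2 / lam) := by
      calc a * (B * ‖Y 0‖ ^ 2) = B * (a * ‖Y 0‖ ^ 2) := by ring
        _ ≤ _ := by gcongr
    have hb2 : 0 ≤ 16 * B ^ 2 * r₀ ^ 2 / lam := by positivity
    have hb3 : 8 * B / lam = 4 * (B * (2 / lam)) := by ring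
    simp only [norm_mul, Complex.norm_I, one_mul, maxConst]
    rw [hb3]
    linarith
  · have hb1 : a * (‖q‖ ^ 2 * (B ^ 2 * ‖Y 0‖ ^ 2)) ≤ r₀ ^ 2 * (B ^ 2 * (2 / lam)) := by
      calc a * (‖q‖ ^ 2 * (B ^ 2 * ‖Y 0‖ ^ 2)) = ‖q‖ ^ 2 * (B ^ 2 * (a * ‖Y 0‖ ^ 2)) := by ring
        _ ≤ _ := by gcongr
    have hb2 : 0 ≤ 8 * B / lam := by positivity
    have hb3 : 16 * B ^ 2 * r₀ ^ 2 / lam = 8 * (r₀ ^ 2 * (B ^ 2 * (2 / lam))) := by ring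
    refine (mul_add_sq_le ha0.le hs1 hs2 hsum).trans ?_
    rw [maxConst, hb3, show a * (4 * B ^ 2 * ‖q‖ ^ 2 * ‖Y 0‖ ^ 2) =
      4 * (a * (‖q‖ ^ 2 * (B ^ 2 * ‖Y 0‖ ^ 2))) by ring]
    linarith

end

theorem exists_interior_max {E : ℂ × ℝ → ℝ} {a t₁ d c c' Eb : ℝ} (hd : 0 < d) (hc : 0 < c)
    (hc' : 0 < c') (hat : a ≤ t₁)
    (hcont : ContinuousOn E (closedBall 0 d ×ˢ Icc (max a (t₁ - d)) t₁))
    (hEb : ∀ q ∈ closedBall (0:ℂ) d ×ˢ Icc (max a (t₁ - d)) t₁, E q ≤ Eb)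
    (hE0 : ∀ ζ, E (ζ, a) = 0) (hpos : 0 < E (0, t₁)) (h1 : Eb * Real.exp (-(c * d ^ 2)) < E (0, t₁))
    (h2 : Eb * Real.exp (-(c' * d)) < E (0, t₁)) :
    ∃ ζ s, ‖ζ‖ < d ∧ max a (t₁ - d) < s ∧ s ≤ t₁ ∧ E (0, t₁) ≤ E (ζ, s) ∧
      ∀ ξ t, ‖ξ‖ ≤ d → max a (t₁ - d) ≤ t → t ≤ t₁ →
        E (ξ, t) * Real.exp (-(c * ‖ξ‖ ^ 2) - c' * (t₁ - t)) ≤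
          E (ζ, s) * Real.exp (-(c * ‖ζ‖ ^ 2) - c' * (t₁ - s)) := by
  have hle : max a (t₁ - d) ≤ t₁ := max_le hat (by linarith)
  have h0 : ((0:ℂ), t₁) ∈ closedBall (0:ℂ) d ×ˢ Icc (max a (t₁ - d)) t₁ :=
    ⟨mem_closedBall_self hd.le, hle, le_rfl⟩
  have hEb0 : 0 < Eb := hpos.trans_le (hEb _ h0)
  obtain ⟨⟨ζ, s⟩, ⟨hζ, hs⟩, hmax⟩ := ((isCompact_closedBall (0:ℂ) d).prod
    isCompact_Icc).exists_isMaxOn ⟨_, h0⟩ (hcont.mul (g := fun q : ℂ × ℝ =>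
      Real.exp (-(c * ‖q.1‖ ^ 2) - c' * (t₁ - q.2))) (by fun_prop))
  rw [isMaxOn_iff] at hmax
  have hm : ∀ ξ t, ‖ξ‖ ≤ d → max a (t₁ - d) ≤ t → t ≤ t₁ →
        E (ξ, t) * Real.exp (-(c * ‖ξ‖ ^ 2) - c' * (t₁ - t)) ≤
          E (ζ, s) * Real.exp (-(c * ‖ζ‖ ^ 2) - c' * (t₁ - s)) := fun ξ t k1 k2 k3 =>
    hmax (ξ, t) ⟨by simpa using k1, k2, k3⟩
  have hz : ‖ζ‖ ≤ d := by simpa using hζ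
  have hst : s ≤ t₁ := hs.2
  have hb : E (0, t₁) ≤ E (ζ, s) * Real.exp (-(c * ‖ζ‖ ^ 2) - c' * (t₁ - s)) := by
    simpa using hm 0 t₁ (by simpa using hd.le) hle le_rfl
  have hEs : E (ζ, s) ≤ Eb := hEb _ ⟨hζ, hs⟩
  have hEpos : 0 < E (ζ, s) := pos_of_mul_pos_left (hpos.trans_le hb) (Real.exp_pos _).le
  have q1 : 0 ≤ c * ‖ζ‖ ^ 2 := by positivity
  have q2 : 0 ≤ c' * (t₁ - s) := mul_nonneg hc'.le (by linarith)
  refine ⟨ζ, s, lt_of_le_of_ne hz fun e => ?_, lt_of_le_of_ne hs.1 fun e => ?_, hst, ?_, hm⟩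
  · refine absurd (hb.trans (mul_le_mul hEs (Real.exp_le_exp.2 ?_) (Real.exp_pos _).le hEb0.le))
      h1.not_ge
    rw [e]; linarith
  · rcases max_choice a (t₁ - d) with k | k
    · rw [← e, k, hE0] at hEpos
      exact lt_irrefl _ hEpos
    · refine absurd (hb.trans (mul_le_mul hEs (Real.exp_le_exp.2 ?_) (Real.exp_pos _).le hEb0.le))
        h2.not_ge
      rw [show t₁ - s = d by rw [← e, k]; ring]
      linarith
  · refine hb.trans (mul_le_of_le_one_right hEpos.le (Real.exp_le_one_iff.2 ?_))
    linarith

section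

variable {M : Set (ℂ × ℝ)} {V : ℂ × ℝ → ℝ} {A : ℂ × ℝ → (ℂ × ℝ →L[ℝ] ℝ)}
  {H : ℂ × ℝ → (ℂ × ℝ →L[ℝ] ℂ × ℝ →L[ℝ] ℝ)} {γ η Y b : ℝ → ℂ} {S : Set (ℂ × ℝ)}

/-- The localised quantity to which the maximum principle is applied. -/
noncomputable def locRatio (V : ℂ × ℝ → ℝ) (p : ℂ) (t₀ R : ℝ) (z : ℂ) (t ρ : ℝ) : ℝ :=
  2 * (t - t₀) * Real.exp (logBarrier p z) * Real.exp (-V (z, t)) * max 0 (1 - ρ / R) ^ 2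

theorem locRatio_eq_exp {p z : ℂ} {t₀ R t ρ : ℝ} (hR : 0 < R) (ht : t₀ < t) (hρ : ρ < R) :
    locRatio V p t₀ R z t ρ = Real.exp (logRatio V p t₀ z t) * (1 - ρ / R) ^ 2 := by
  rw [locRatio, exp_logRatio ht, max_eq_right]
  rw [sub_nonneg, div_le_one hR]; exact hρ.le

theorem locRatio_eq_exp_add {p z : ℂ} {t₀ R t ρ : ℝ} (hR : 0 < R) (ht : t₀ < t) (hρ : ρ < R) :
    locRatio V p t₀ R z t ρ =
      Real.exp (logRatio V p t₀ z t + 2 * Real.log (R - ρ)) / R ^ 2 := by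
  rw [locRatio_eq_exp hR ht hρ, Real.exp_add, show 1 - ρ / R = (R - ρ) / R by field_simp, div_pow,
    show 2 * Real.log (R - ρ) = Real.log (R - ρ) + Real.log (R - ρ) by ring, Real.exp_add,
    Real.exp_log (by linarith)]
  ring

theorem lt_of_locRatio_pos {p z : ℂ} {t₀ R t ρ : ℝ} (hR : 0 < R) (ht : t₀ ≤ t)
    (h : 0 < locRatio V p t₀ R z t ρ) : t₀ < t ∧ ρ < R := by
  constructor
  · refine lt_of_le_of_ne ht fun e => ?_
    simp [locRatio, e] at h
  · by_contra hρ
    rw [locRatio, max_eq_left] at h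
    · simp at h
    · rw [sub_nonpos, one_le_div hR]; linarith

end

theorem add_le_add_of_exp_div_mul_le {a b x y r : ℝ} (hr : 0 < r)
    (h : Real.exp a / r * Real.exp x ≤ Real.exp b / r * Real.exp y) : a + x ≤ b + y := by
  rw [div_mul_eq_mul_div, div_mul_eq_mul_div, div_le_div_iff_of_pos_right hr, ← Real.exp_add,
    ← Real.exp_add, Real.exp_le_exp] at h
  exact h

theorem exists_locRatio_le_of_near_max {T : ℝ} {M : Set (ℂ × ℝ)} {u : ℂ → ℝ → ℝ}
    (hRF : ConfRFS T M u) {p x₀ : ℂ} {ta tb R B r₀ lam am Eb : ℝ} {K : Set (ℂ × ℝ)}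
    (hp : ∀ z t, (z, t) ∈ M → t ≤ tb → z ≠ p ∧ ‖z - p‖ ≤ 2) (hK : IsCompact K) (hKM : K ⊆ M)
    (hR : 1 ≤ R) (hB : 0 ≤ B) (hr₀ : 0 < r₀) (hlam : 0 < lam)
    (hx : ∀ y ∈ closedBall x₀ r₀, ∀ t ∈ Icc ta tb, lam ≤ u y t) (ham0 : 0 < am)
    (ham : ∀ q ∈ K, Real.exp (-Real.log (u q.1 q.2)) + 1 ≤ am) (hEb0 : 0 < Eb)
    (hEb : ∀ t ∈ Icc ta tb, ∀ y ∈ closedBall x₀ r₀, ∀ z L,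
      Reach (fun z => u z t) (timeSlice M t) y z L → L + B * ‖y - x₀‖ ^ 2 < R →
      locRatio (fun q => Real.log (u q.1 q.2)) p ta R z t (L + B * ‖y - x₀‖ ^ 2) ≤ Eb) :
    ∃ κ < 1, 0 < κ ∧ ∀ t ∈ Icc ta tb, ∀ γ η : ℝ → ℂ, Continuous η →
      (∀ r, HasDerivAt γ (η r) r) → (∀ r ∈ Icc (0:ℝ) 1, (γ r, t) ∈ K) →
      ‖γ 0 - x₀‖ < 3 / 4 * r₀ → ∀ ρ,
      ρ = (∫ r in (0:ℝ)..1, Real.sqrt (u (γ r) t) * ‖η r‖) + B * ‖γ 0 - x₀‖ ^ 2 →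
      κ * Eb < locRatio (fun q => Real.log (u q.1 q.2)) p ta R (γ 1) t ρ →
      locRatio (fun q => Real.log (u q.1 q.2)) p ta R (γ 1) t ρ ≤
        1 + (tb - ta) * ((5 + 4 * maxConst B r₀ lam) / R) := by
  obtain ⟨A, H, hA⟩ := hRF.exists_logFlow
  set V : ℂ × ℝ → ℝ := fun q => Real.log (u q.1 q.2) with hV
  have hR0 : 0 < R := by linarith
  set ε := min (1 / R) (r₀ / 4) with hε
  have hε0 : 0 < ε := lt_min (by positivity) (by positivity)
  have hεR : ε ≤ 1 / R := min_le_left _ _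
  have hε2 : ε ^ 2 ≤ (1 / R) ^ 2 := pow_le_pow_left₀ hε0.le hεR 2
  obtain ⟨δ, hδ, hsh⟩ := hA.exists_uniform_shift hK hKM hε0
  set c := 1 / (R * am) with hc
  have hc0 : 0 < c := by positivity
  set c' := 1 / R with hc'
  have hc'0 : 0 < c' := by positivity
  set d := δ / 2 with hd
  have hd0 : 0 < d := by positivity
  refine ⟨max (Real.exp (-(c * d ^ 2))) (Real.exp (-(c' * d))), ?_, ?_, ?_⟩
  · refine max_lt ?_ ?_ <;> rw [Real.exp_lt_one_iff, neg_lt_zero] <;> positivity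
  · exact lt_max_of_lt_left (Real.exp_pos _)
  intro t₁ ht₁ γ η hη hγ hγK hγ0 ρ₁ hρ₁ hbig
  have hγM : ∀ r ∈ Icc (0:ℝ) 1, (γ r, t₁) ∈ M := fun r hr => hKM (hγK r hr)
  obtain ⟨Y, Y', b, hY'c, hYd, hY1, hbc, hYb, hbY, hnorm⟩ := hA.exists_transport hη hγ hγM
  have i0 : (0:ℝ) ∈ Icc (0:ℝ) 1 := left_mem_Icc.2 zero_le_one
  have i1 : (1:ℝ) ∈ Icc (0:ℝ) 1 := right_mem_Icc.2 zero_le_one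
  have hγc : Continuous γ := continuous_iff_continuousAt.2 fun r => (hγ r).continuousAt
  have hYc : Continuous Y := continuous_iff_continuousAt.2 fun r => (hYd r).continuousAt
  set S : Set (ℂ × ℝ) := ball 0 δ ×ˢ Ioo (t₁ - δ) (t₁ + δ) with hS
  have hsh' : ∀ q ∈ S, ∀ r ∈ Icc (0:ℝ) 1, _ := fun q hq r hr =>
    hsh (γ r) (γ 1) (Y r) (b r) t₁ (hγK r hr) (hγK 1 i1) (hnorm r hr) (hbY r hr) q.1 q.2
      (by simpa using hq.1) (abs_sub_lt_iff.2 ⟨by linarith [hq.2.2], by linarith [hq.2.1]⟩)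
  have hadm : ShiftAdmissible M γ η Y b S :=
    { opn := isOpen_ball.prod isOpen_Ioo
      path := hγc.continuousOn
      vel := hη.continuousOn
      shift := hYc.continuousOn
      factor := hbc
      mem := fun q hq r hr => (hsh' q hq r hr).1
      small := fun q hq r hr => (hsh' q hq r hr).2.2.1 }
  have hzM : ∀ q ∈ S, (γ 1 + q.1, q.2) ∈ M := fun q hq => (hsh' q hq 0 i0).2.1
  have hcost : ContinuousOn (fun q : ℂ × ℝ => varCost V γ η Y b B x₀ q.1 q.2) S :=
    (hadm.continuousOn_varLen hA).add (by fun_prop)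
  have hbase : ∀ q ∈ S, ‖γ 0 + q.1 * Y 0 - x₀‖ ≤ r₀ := fun q hq => by
    have h1 := (hsh' q hq 0 i0).2.2.2.1
    have h2 : ε ≤ r₀ / 4 := min_le_right _ _
    calc ‖γ 0 + q.1 * Y 0 - x₀‖ = ‖(γ 0 - x₀) + q.1 * Y 0‖ := by congr 1; ring
      _ ≤ ‖γ 0 - x₀‖ + ‖q.1 * Y 0‖ := norm_add_le _ _
      _ ≤ r₀ := by linarith
  set E : ℂ × ℝ → ℝ := fun q =>
    locRatio V p ta R (γ 1 + q.1) q.2 (varCost V γ η Y b B x₀ q.1 q.2) with hE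
  have hsub : closedBall (0:ℂ) d ×ˢ Icc (max ta (t₁ - d)) t₁ ⊆ S := by
    rintro ⟨ζ, s⟩ ⟨h1, h2, h3⟩
    have h4 : ‖ζ‖ ≤ d := by simpa using h1
    have h5 : t₁ - d ≤ s := (le_max_right _ _).trans h2
    refine ⟨by simp only [mem_ball, dist_zero_right]; linarith, ?_, ?_⟩ <;> simp only at h3 ⊢ <;>
      linarith
  have htb : ∀ {q : ℂ × ℝ}, q ∈ closedBall (0:ℂ) d ×ˢ Icc (max ta (t₁ - d)) t₁ →
      q.2 ∈ Icc ta tb := fun {q} hq => ⟨(le_max_left _ _).trans hq.2.1, hq.2.2.trans ht₁.2⟩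
  have hEcont : ContinuousOn E (closedBall (0:ℂ) d ×ˢ Icc (max ta (t₁ - d)) t₁) := by
    have k1 : ContinuousOn (fun q : ℂ × ℝ => logBarrier p (γ 1 + q.1))
        (closedBall (0:ℂ) d ×ˢ Icc (max ta (t₁ - d)) t₁) :=
      (continuousOn_logBarrier p).comp (f := fun q : ℂ × ℝ => γ 1 + q.1) (by fun_prop)
        fun q hq => (hp _ _ (hzM q (hsub hq)) (htb hq).2).1
    have k2 : ContinuousOn (fun q : ℂ × ℝ => V (γ 1 + q.1, q.2))
        (closedBall (0:ℂ) d ×ˢ Icc (max ta (t₁ - d)) t₁) :=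
      hA.continuousOn_fst.comp (f := fun q : ℂ × ℝ => (γ 1 + q.1, q.2)) (by fun_prop)
        fun q hq => hzM q (hsub hq)
    have k3 := hcost.mono hsub
    have k4 : ContinuousOn (fun q : ℂ × ℝ => 2 * (q.2 - ta))
        (closedBall (0:ℂ) d ×ˢ Icc (max ta (t₁ - d)) t₁) := by fun_prop
    exact ((k4.mul k1.rexp).mul k2.neg.rexp).mul
      ((continuousOn_const.sup (continuousOn_const.sub (k3.div_const R))).pow 2)
  have hEb' : ∀ q ∈ closedBall (0:ℂ) d ×ˢ Icc (max ta (t₁ - d)) t₁, E q ≤ Eb := by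
    intro q hq
    rcases le_or_gt (E q) 0 with h | h
    · exact h.trans hEb0.le
    · have h1 := (lt_of_locRatio_pos hR0 (htb hq).1 h).2
      have hr := reach_shift hRF.pos hη hγ hY'c hYd hYb (ζ := q.1) (s := q.2)
        (fun r hr => hadm.mem q (hsub hq) r hr) (fun r hr => hadm.small q (hsub hq) r hr)
      rw [hY1, mul_one] at hr
      exact hEb q.2 (htb hq) _ (by rw [mem_closedBall, dist_eq_norm]; exact hbase q (hsub hq)) _ _ hr h1
  have hE0 : ∀ ζ, E (ζ, ta) = 0 := fun ζ => by simp [hE, locRatio]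
  have hlen : varLen V γ η Y b 0 t₁ = ∫ r in (0:ℝ)..1, Real.sqrt (u (γ r) t₁) * ‖η r‖ := by
    refine intervalIntegral.integral_congr fun r hr => ?_
    rw [uIcc_of_le zero_le_one] at hr
    rw [exp_varLog (by simp), hV]
    simp [Real.exp_log (hRF.pos _ (hγM r hr))]
  have hE1 : E (0, t₁) = locRatio V p ta R (γ 1) t₁ ρ₁ := by
    simp [hE, varCost, hlen, hρ₁]
  have hκ : ∀ k ≤ max (Real.exp (-(c * d ^ 2))) (Real.exp (-(c' * d))), Eb * k < E (0, t₁) :=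
    fun k hk => by
      rw [hE1, mul_comm]
      exact (mul_le_mul_of_nonneg_right hk hEb0.le).trans_lt hbig
  have hpos : 0 < E (0, t₁) := by simpa using hκ 0 (le_max_of_le_left (Real.exp_pos _).le)
  obtain ⟨ζ, s, hζ, hs1, hs2, hle, hmax⟩ := exists_interior_max hd0 hc0 hc'0 ht₁.1 hEcont hEb' hE0
    hpos (hκ _ (le_max_left _ _)) (hκ _ (le_max_right _ _))
  have hqc : (ζ, s) ∈ closedBall (0:ℂ) d ×ˢ Icc (max ta (t₁ - d)) t₁ :=
    ⟨by simpa using hζ.le, hs1.le, hs2⟩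
  have hq : (ζ, s) ∈ S := hsub hqc
  obtain ⟨hts, hρR⟩ := lt_of_locRatio_pos hR0 (htb hqc).1 (hpos.trans_le hle)
  have hnear : ∀ᶠ q in nhds (ζ, s), varCost V γ η Y b B x₀ q.1 q.2 < R :=
    (hcost.continuousAt (hadm.opn.mem_nhds hq)).eventually_lt continuousAt_const hρR
  have hlog : ∀ ξ t, ‖ξ‖ ≤ d → max ta (t₁ - d) ≤ t → t ≤ t₁ → ta < t →
      varCost V γ η Y b B x₀ ξ t < R →
      logRatio V p ta (γ 1 + ξ) t + 2 * Real.log (R - varCost V γ η Y b B x₀ ξ t) +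
        (-(c * ‖ξ‖ ^ 2) - c' * (t₁ - t)) ≤
      logRatio V p ta (γ 1 + ζ) s + 2 * Real.log (R - varCost V γ η Y b B x₀ ζ s) +
        (-(c * ‖ζ‖ ^ 2) - c' * (t₁ - s)) := by
    intro ξ t k1 k2 k3 k4 k5
    have h1 := hmax ξ t k1 k2 k3
    simp only [hE] at h1
    rw [locRatio_eq_exp_add hR0 k4 k5, locRatio_eq_exp_add hR0 hts hρR] at h1
    exact add_le_add_of_exp_div_mul_le (by positivity) h1
  have hM1 := hzM _ hq
  obtain ⟨hzp, hz2⟩ := hp _ _ hM1 (htb hqc).2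
  have hres := bound_at_max hA hadm hq hM1 hzp hz2 hts hR0 hB hlam hc0.le hc'0.le (hbase _ hq)
    ?_ (fun r hr => ?_) (fun r hr => ?_) (fun r hr => ?_) hρR ?_ ?_
  · rw [← hE1]
    refine hle.trans ?_
    simp only [hE]
    rw [locRatio_eq_exp hR0 hts hρR]
    refine hres.trans ?_
    have ha : Real.exp (-V (γ 1 + ζ, s)) ≤ am :=
      ((hsh' _ hq 0 i0).2.2.2.2.2.2.2.2.le).trans (ham _ (hγK 1 i1))
    have hac : Real.exp (-V (γ 1 + ζ, s)) * c ≤ 1 / R := by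
      calc Real.exp (-V (γ 1 + ζ, s)) * c ≤ am * c := by gcongr
        _ = 1 / R := by rw [hc]; field_simp
    have hC0 : 0 ≤ maxConst B r₀ lam := by unfold maxConst; positivity
    have hR2 : 2 * maxConst B r₀ lam / R ^ 2 ≤ 2 * maxConst B r₀ lam / R := by
      gcongr
      nlinarith
    have e1 : (5 + 4 * maxConst B r₀ lam) / R = 1 / R + 4 * (1 / R) + 2 * maxConst B r₀ lam / R +
        2 * maxConst B r₀ lam / R := by ring
    rw [e1]
    have hst : s - ta ≤ tb - ta := by linarith [ht₁.2]
    have hst0 : 0 ≤ tb - ta := by linarith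
    gcongr
  · refine (hsh' _ hq 0 i0).2.2.2.2.2.2.2.1.le.trans ?_
    have h1 : lam ≤ u (γ 0) t₁ := hx _ (by
      rw [mem_closedBall, dist_eq_norm]; linarith) _ ht₁
    simp only [hV]
    rw [Real.exp_neg, Real.exp_log (by linarith), ← div_eq_mul_inv]
    gcongr
  · exact (neg_le_neg hεR).trans (hsh' _ hq r hr).2.2.2.2.1.le
  · exact (hsh' _ hq r hr).2.2.2.2.2.1.le.trans hε2
  · exact (hsh' _ hq r hr).2.2.2.2.2.2.1.le.trans hε2
  · have h1 : ∀ᶠ ξ in nhds ζ, ‖ξ‖ < d := continuous_norm.continuousAt.eventually_lt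
      continuousAt_const hζ
    have h2 : Tendsto (fun ξ : ℂ => (ξ, s)) (nhds ζ) (nhds (ζ, s)) :=
      (by fun_prop : Continuous fun ξ : ℂ => (ξ, s)).tendsto ζ
    filter_upwards [h1, h2.eventually hnear] with ξ k1 k2
    have := hlog ξ s k1.le hs1.le hs2 hts k2
    linarith
  · have h2 : Tendsto (fun t : ℝ => (ζ, t)) (nhds s) (nhds (ζ, s)) :=
      (by fun_prop : Continuous fun t : ℝ => (ζ, t)).tendsto s
    filter_upwards [(h2.mono_left nhdsWithin_le_nhds).eventually hnear, self_mem_nhdsWithin,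
      nhdsWithin_le_nhds (Ioi_mem_nhds hs1)] with t k2 k3 k4
    have k3' : t < s := k3
    have := hlog ζ t hζ.le (le_of_lt k4) (by linarith) ((le_max_left _ _).trans_lt k4) k2
    linarith

theorem add_sq_gain {Λ r₀ s : ℝ} (hΛ : 0 < Λ) (hr₀ : 0 < r₀) (hs : 3 / 4 * r₀ ≤ s) :
    Λ * s + 3 / 8 * (Λ * r₀) ≤ 2 * Λ / r₀ * s ^ 2 := by
  rw [show 2 * Λ / r₀ * s ^ 2 = 2 * Λ * s ^ 2 / r₀ by ring, le_div_iff₀ hr₀]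
  have h1 : 0 ≤ s - 3 / 4 * r₀ := by linarith
  have : 0 ≤ Λ * ((s - 3 / 4 * r₀) * (2 * s + 1 / 2 * r₀)) :=
    mul_nonneg hΛ.le (mul_nonneg h1 (by linarith))
  nlinarith

theorem one_add_mul_locRatio_le {V : ℂ × ℝ → ℝ} {p z : ℂ} {t₀ R t ρ ρ' g : ℝ} (hR : 0 < R)
    (ht : t₀ ≤ t) (hg : 0 ≤ g) (hρ0 : 0 ≤ ρ) (hρ : ρ < R) (h : ρ' + g ≤ ρ) :
    (1 + g / R) * locRatio V p t₀ R z t ρ ≤ locRatio V p t₀ R z t ρ' := by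
  have h1 : 0 ≤ 1 - ρ / R := by rw [sub_nonneg, div_le_one hR]; exact hρ.le
  have h2 : ρ' / R + g / R ≤ ρ / R := by rw [← add_div]; gcongr
  have hgR : 0 ≤ g / R := by positivity
  have hρR : 0 ≤ ρ / R := by positivity
  have h3 : 0 ≤ 1 - ρ' / R := by linarith
  unfold locRatio
  rw [max_eq_right h1, max_eq_right h3]
  have h4 : (1 + g / R) * (1 - ρ / R) ^ 2 ≤ (1 - ρ' / R) ^ 2 := by
    have h5 : (1 - ρ / R) + g / R ≤ 1 - ρ' / R := by linarith
    have h6 : ((1 - ρ / R) + g / R) ^ 2 ≤ (1 - ρ' / R) ^ 2 :=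
      pow_le_pow_left₀ (by linarith) h5 2
    nlinarith [mul_nonneg hgR h1, mul_nonneg (mul_nonneg hgR h1) hρR]
  have h7 : 0 ≤ t - t₀ := by linarith
  calc _ = 2 * (t - t₀) * Real.exp (logBarrier p z) * Real.exp (-V (z, t)) *
        ((1 + g / R) * (1 - ρ / R) ^ 2) := by ring
    _ ≤ _ := by gcongr

theorem locRatio_le {T : ℝ} {M : Set (ℂ × ℝ)} {u : ℂ → ℝ → ℝ}
    (hRF : ConfRFS T M u) (hcomp : ConfRFSComplete T M u) {p x₀ : ℂ} {ta tb R r₀ lam Λ : ℝ}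
    (hp : ∀ z t, (z, t) ∈ M → t ≤ tb → z ≠ p ∧ ‖z - p‖ ≤ 2)
    (hR : 1 ≤ R) (hr₀ : 0 < r₀) (hlam : 0 < lam) (hΛ : 0 < Λ)
    (hx : ∀ y ∈ closedBall x₀ r₀, ∀ t ∈ Icc ta tb, (y, t) ∈ M ∧ lam ≤ u y t ∧ √(u y t) ≤ Λ)
    {t : ℝ} (ht : t ∈ Icc ta tb) {y z : ℂ} (hy : y ∈ closedBall x₀ r₀) {L : ℝ}
    (hL : Reach (fun z => u z t) (timeSlice M t) y z L)
    (hLR : L + 2 * Λ / r₀ * ‖y - x₀‖ ^ 2 < R) :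
    locRatio (fun q => Real.log (u q.1 q.2)) p ta R z t (L + 2 * Λ / r₀ * ‖y - x₀‖ ^ 2) ≤
      1 + (tb - ta) * ((5 + 4 * maxConst (2 * Λ / r₀) r₀ lam) / R) := by
  set V : ℂ × ℝ → ℝ := fun q => Real.log (u q.1 q.2) with hV
  set B := 2 * Λ / r₀ with hB
  have hB0 : 0 < B := by positivity
  have hR0 : 0 < R := by linarith
  have htab : ta ≤ tb := ht.1.trans ht.2
  have hx0 : x₀ ∈ closedBall x₀ r₀ := mem_closedBall_self hr₀.le
  have hcu : ∀ t, ContinuousOn (fun z => u z t) (timeSlice M t) := fun t =>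
    continuousOn_timeSlice hRF.smooth.continuousOn t
  obtain ⟨K, hK, hKM, hball⟩ := exists_compact_reachBall_Icc hRF hcomp
    (fun t ht => (hx x₀ hx0 t ht).1) (R := Λ * r₀ + R) (by positivity)
  -- the base point can be moved to the centre of the disk
  have hpre : ∀ t ∈ Icc ta tb, ∀ y ∈ closedBall x₀ r₀, ∀ z L,
      Reach (fun z => u z t) (timeSlice M t) y z L →
      ∃ L' ≤ Λ * ‖y - x₀‖ + L, Reach (fun z => u z t) (timeSlice M t) x₀ z L' := by
    intro t ht y hy z L hL
    have hseg : segment ℝ x₀ y ⊆ closedBall x₀ r₀ := (convex_closedBall x₀ r₀).segment_subset hx0 hy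
    obtain ⟨L₀, hL₀, h0⟩ := Reach.of_segment (hcu t) (fun w hw => (hx w (hseg hw) t ht).1)
      (Λ := Λ) (fun w hw => (hx w (hseg hw) t ht).2.2)
    exact ⟨L₀ + L, by linarith, h0.trans (hcu t) hL⟩
  have hmemK : ∀ t ∈ Icc ta tb, ∀ y ∈ closedBall x₀ r₀, ∀ z L,
      Reach (fun z => u z t) (timeSlice M t) y z L → L < R → (z, t) ∈ K := by
    intro t ht y hy z L hL hLR
    obtain ⟨L', hL', h'⟩ := hpre t ht y hy z L hL
    refine hball t ht z ⟨L', ?_, h'⟩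
    have : ‖y - x₀‖ ≤ r₀ := by rwa [mem_closedBall, dist_eq_norm] at hy
    have : Λ * ‖y - x₀‖ ≤ Λ * r₀ := by gcongr
    linarith
  have hVK : ContinuousOn V K :=
    (hRF.smooth.continuousOn.mono hKM).log fun q hq => (hRF.pos q (hKM hq)).ne'
  obtain ⟨am₀, ham₀⟩ := hK.exists_bound_of_continuousOn (f := fun q => Real.exp (-V q) + 1)
    (hVK.neg.rexp.add continuousOn_const)
  have hlbK : ContinuousOn (fun q : ℂ × ℝ => logBarrier p q.1) (K ∩ {q | q.2 ≤ tb}) :=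
    (continuousOn_logBarrier p).comp continuousOn_fst fun q hq => (hp _ _ (hKM hq.1) hq.2).1
  obtain ⟨C, hC⟩ := (hK.inter_right (isClosed_le continuous_snd
    continuous_const)).exists_bound_of_continuousOn
    (f := fun q : ℂ × ℝ => 2 * (q.2 - ta) * Real.exp (logBarrier p q.1) * Real.exp (-V q))
    (((by fun_prop : Continuous fun q : ℂ × ℝ => 2 * (q.2 - ta)).continuousOn.mul hlbK.rexp).mul
      (hVK.mono inter_subset_left).neg.rexp)
  set W : Set ℝ := {w | ∃ t ∈ Icc ta tb, ∃ y ∈ closedBall x₀ r₀, ∃ z L,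
    Reach (fun z => u z t) (timeSlice M t) y z L ∧ L + B * ‖y - x₀‖ ^ 2 < R ∧
    w = locRatio V p ta R z t (L + B * ‖y - x₀‖ ^ 2)} with hW
  have hbdd : BddAbove W := by
    refine ⟨C, ?_⟩
    rintro w ⟨t, ht, y, hy, z, L, hL, hLR, rfl⟩
    have hn : 0 ≤ B * ‖y - x₀‖ ^ 2 := by positivity
    have hL0 := hL.nonneg
    have hzK := hmemK t ht y hy z L hL (by linarith)
    have h1 := (le_abs_self _).trans (hC (z, t) ⟨hzK, ht.2⟩)
    refine le_trans ?_ h1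
    have h2 : 0 ≤ t - ta := by linarith [ht.1]
    refine mul_le_of_le_one_right (by positivity) (pow_le_one₀ (le_max_left _ _) (max_le zero_le_one ?_))
    have : 0 ≤ (L + B * ‖y - x₀‖ ^ 2) / R := by positivity
    linarith
  set Q := 1 + (tb - ta) * ((5 + 4 * maxConst B r₀ lam) / R) with hQ
  have hQ0 : 0 < Q := by
    have : 0 ≤ (tb - ta) * ((5 + 4 * maxConst B r₀ lam) / R) := by
      refine mul_nonneg (by linarith) ?_
      unfold maxConst
      positivity
    linarith
  by_contra! hcon
  have hle : ∀ w ∈ W, w ≤ sSup W := fun w hw => le_csSup hbdd hw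
  have hmem : locRatio V p ta R z t (L + B * ‖y - x₀‖ ^ 2) ∈ W :=
    ⟨t, ht, y, hy, z, L, hL, hLR, rfl⟩
  have hQW : Q < sSup W := hcon.trans_le (hle _ hmem)
  have hEb0 : 0 < sSup W := hQ0.trans hQW
  obtain ⟨κ, hκ1, hκ0, hκ⟩ := exists_locRatio_le_of_near_max hRF (ta := ta) hp hK hKM hR hB0.le hr₀
    hlam (fun y hy t ht => (hx y hy t ht).2.1) (am := max am₀ 1) (by positivity)
    (fun q hq => (le_abs_self _).trans ((ham₀ q hq).trans (le_max_left _ _))) hEb0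
    (fun t ht y hy z L hL hLR => hle _ ⟨t, ht, y, hy, z, L, hL, hLR, rfl⟩)
  set g := 3 / 8 * (Λ * r₀) with hg
  have hg0 : 0 < g := by positivity
  have hgR : 0 < g / R := by positivity
  have hk2 : (1 + g / R)⁻¹ < 1 := inv_lt_one_of_one_lt₀ (by linarith)
  obtain ⟨w, ⟨t', ht', y', hy', z', L', hL', hLR', hw⟩, hlt⟩ := exists_lt_of_lt_csSup ⟨_, hmem⟩
    (max_lt hQW (max_lt (mul_lt_of_lt_one_left hEb0 hκ1) (mul_lt_of_lt_one_left hEb0 hk2)))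
  obtain ⟨hlt1, hlt2⟩ := max_lt_iff.1 hlt
  obtain ⟨hlt2, hlt3⟩ := max_lt_iff.1 hlt2
  rcases lt_or_ge ‖y' - x₀‖ (3 / 4 * r₀) with hnear | hfar
  · obtain ⟨γ, η, hη, hγ, hγM, hγ0, hγ1, hlen⟩ := hL'
    have hn : 0 ≤ B * ‖y' - x₀‖ ^ 2 := by positivity
    have hpath : ∀ r ∈ Icc (0:ℝ) 1, (γ r, t') ∈ K := fun r hr => by
      obtain ⟨L₁, L₂, h1, h2, _, h3⟩ := Reach.split (hcu t') hη hγ hγM hr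
      refine hmemK t' ht' (γ 0) (hγ0 ▸ hy') _ _ h1 ?_
      have := h2.nonneg
      linarith
    have := hκ t' ht' γ η hη hγ hpath (by rw [hγ0]; exact hnear) _ rfl
    rw [hγ0, hγ1, hlen, ← hw] at this
    exact absurd (this hlt2) hlt1.not_ge
  · obtain ⟨L'', hL'', h''⟩ := hpre t' ht' y' hy' z' L' hL'
    have hgain := add_sq_gain hΛ hr₀ hfar
    have h1 : L'' + g ≤ L' + B * ‖y' - x₀‖ ^ 2 := by linarith
    have h2 : locRatio V p ta R z' t' L'' ≤ sSup W :=
      hle _ ⟨t', ht', x₀, hx0, z', L'', h'', by simp; linarith, by simp⟩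
    have h3 := one_add_mul_locRatio_le (V := V) (p := p) (z := z') hR0 ht'.1 hg0.le
      (by have := hL'.nonneg; positivity) hLR' h1
    rw [← hw] at h3
    rw [inv_mul_lt_iff₀ (by linarith)] at hlt3
    linarith

theorem mul_exp_logBarrier_le_of_path {T : ℝ} {M : Set (ℂ × ℝ)} {u : ℂ → ℝ → ℝ}
    (hRF : ConfRFS T M u) (hcomp : ConfRFSComplete T M u) (hexp : Expanding T M) {p z : ℂ}
    {ta tb : ℝ} (htab : ta ≤ tb) (hz : (z, tb) ∈ M)
    (hp : ∀ z t, (z, t) ∈ M → t ≤ tb → z ≠ p ∧ ‖z - p‖ ≤ 2)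
    (hpath : TimePreservingFrom M ta z tb) :
    2 * (tb - ta) * Real.exp (logBarrier p z) ≤ u z tb := by
  obtain ⟨γ, hγc, hγM, hγz⟩ := hpath
  have htbT : tb < T := (hRF.sub hz).2
  have hx₀ : (γ ta, ta) ∈ M := hγM ta (left_mem_Icc.2 htab)
  set x₀ := γ ta with hx₀def
  obtain ⟨r₀, hr₀, hball⟩ := Metric.nhds_basis_closedBall.mem_iff.1
    ((isOpen_timeSlice hRF.opn ta).mem_nhds (show x₀ ∈ timeSlice M ta from hx₀))
  have hbM : ∀ y ∈ closedBall x₀ r₀, ∀ t ∈ Icc ta tb, (y, t) ∈ M := fun y hy t ht =>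
    hexp y ta t (hball hy) ht.1 (ht.2.trans_lt htbT)
  set K : Set (ℂ × ℝ) := closedBall x₀ r₀ ×ˢ Icc ta tb with hK
  have hKc : IsCompact K := (isCompact_closedBall _ _).prod isCompact_Icc
  have hKM : K ⊆ M := fun q hq => hbM q.1 hq.1 q.2 hq.2
  have hne : K.Nonempty := ⟨(x₀, ta), mem_closedBall_self hr₀.le, left_mem_Icc.2 htab⟩
  have hu := hRF.smooth.continuousOn.mono hKM
  obtain ⟨q₀, hq₀, hmin⟩ := hKc.exists_isMinOn hne hu
  obtain ⟨Λ, hΛ⟩ := hKc.exists_bound_of_continuousOn (f := fun q : ℂ × ℝ => √(u q.1 q.2)) hu.sqrt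
  rw [isMinOn_iff] at hmin
  have hx : ∀ y ∈ closedBall x₀ r₀, ∀ t ∈ Icc ta tb,
      (y, t) ∈ M ∧ u q₀.1 q₀.2 ≤ u y t ∧ √(u y t) ≤ max Λ 1 := fun y hy t ht =>
    ⟨hbM y hy t ht, hmin (y, t) ⟨hy, ht⟩,
      (le_abs_self _).trans ((hΛ (y, t) ⟨hy, ht⟩).trans (le_max_left _ _))⟩
  have hΩ := isOpen_timeSlice hRF.opn tb
  have hconn : IsPreconnected (γ '' Icc ta tb) := isPreconnected_Icc.image γ hγc
  have himg : γ '' Icc ta tb ⊆ timeSlice M tb := by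
    rintro _ ⟨r, hr, rfl⟩
    exact hexp _ r tb (hγM r hr) hr.2 htbT
  have hcc := hconn.subset_connectedComponentIn (mem_image_of_mem γ (left_mem_Icc.2 htab)) himg
  obtain ⟨L, hL⟩ := exists_reach_of_mem_connectedComponentIn hΩ
    (continuousOn_timeSlice hRF.smooth.continuousOn tb)
    (hcc (mem_image_of_mem γ (left_mem_Icc.2 htab)))
    (hcc (mem_image_of_mem γ (right_mem_Icc.2 htab)))
  rw [hγz] at hL
  set C := 5 + 4 * maxConst (2 * max Λ 1 / r₀) r₀ (u q₀.1 q₀.2)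
  have key : ∀ᶠ R : ℝ in atTop, 2 * (tb - ta) * Real.exp (logBarrier p z) *
      Real.exp (-Real.log (u z tb)) * max 0 (1 - L / R) ^ 2 ≤ 1 + (tb - ta) * (C / R) := by
    filter_upwards [eventually_ge_atTop 1, eventually_gt_atTop L] with R h1 h2
    have := locRatio_le hRF hcomp hp h1 hr₀ (hRF.pos q₀ (hKM hq₀)) (by positivity) hx
      (right_mem_Icc.2 htab) (mem_closedBall_self hr₀.le) hL (by simpa using h2)
    simpa [locRatio] using this
  have l1 : Tendsto (fun R : ℝ => 2 * (tb - ta) * Real.exp (logBarrier p z) *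
      Real.exp (-Real.log (u z tb)) * max 0 (1 - L / R) ^ 2) atTop
      (nhds (2 * (tb - ta) * Real.exp (logBarrier p z) *
        Real.exp (-Real.log (u z tb)) * max 0 (1 - 0) ^ 2)) :=
    ((tendsto_const_nhds.max (tendsto_const_nhds.sub (tendsto_const_nhds.div_atTop
      tendsto_id))).pow 2).const_mul _
  have l2 : Tendsto (fun R : ℝ => 1 + (tb - ta) * (C / R)) atTop
      (nhds (1 + (tb - ta) * 0)) :=
    ((tendsto_const_nhds.div_atTop tendsto_id).const_mul _).const_add _
  have hfin := le_of_tendsto_of_tendsto l1 l2 key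
  have hupos := hRF.pos _ hz
  rw [Real.exp_neg, Real.exp_log hupos] at hfin
  simp only [sub_zero, mul_zero, add_zero, zero_le_one, max_eq_right, one_pow, mul_one] at hfin
  rwa [← div_eq_mul_inv, div_le_one hupos] at hfin

/-- A point missing from the slice `M_t` forces the conformal factor to be large near it. -/
theorem two_mul_exp_logBarrier_le_conf {T : ℝ} {M : Set (ℂ × ℝ)} {u : ℂ → ℝ → ℝ}
    (hRF : ConfRFS T M u) (hD : M ⊆ (Metric.ball (0:ℂ) 1) ×ˢ Ioo 0 T)
    (hcomp : ConfRFSComplete T M u) (hexp : Expanding T M) (hid : InitiallyDetermined M) {p z : ℂ}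
    {t : ℝ} (hz : (z, t) ∈ M) (hp : p ∈ ball (0:ℂ) 1) (hpt : (p, t) ∉ M) :
    2 * t * Real.exp (logBarrier p z) ≤ u z t := by
  have ht := (hD hz).2
  have hp' : ∀ z s, (z, s) ∈ M → s ≤ t → z ≠ p ∧ ‖z - p‖ ≤ 2 := by
    intro w s hw hs
    refine ⟨fun e => hpt (hexp p s t (e ▸ hw) hs ht.2), ?_⟩
    have h1 : ‖w‖ < 1 := by simpa using (hD hw).1
    have h2 : ‖p‖ < 1 := by simpa using hp
    linarith [norm_sub_le w p]
  have h0 : hindsight M z t = 0 := hid _ hz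
  have hne : {s : ℝ | 0 < s ∧ s ≤ t ∧ TimePreservingFrom M s z t}.Nonempty :=
    ⟨t, ht.1, le_rfl, fun _ => z, continuousOn_const, fun r hr => by
      rw [le_antisymm hr.2 hr.1]; exact hz, rfl⟩
  refine le_of_forall_pos_lt_add fun ε hε => ?_
  set e := Real.exp (logBarrier p z)
  have he : 0 < e := Real.exp_pos _
  obtain ⟨s, ⟨hs0, hst, hs⟩, hlt⟩ := exists_lt_of_csInf_lt hne
    (show hindsight M z t < ε / (2 * e) by rw [h0]; positivity)
  have := mul_exp_logBarrier_le_of_path hRF hcomp hexp hst hz hp' hs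
  rw [lt_div_iff₀ (by positivity)] at hlt
  nlinarith

theorem div_norm_sub_le_conf {T : ℝ} {M : Set (ℂ × ℝ)} {u : ℂ → ℝ → ℝ}
    (hRF : ConfRFS T M u) (hD : M ⊆ (Metric.ball (0:ℂ) 1) ×ˢ Ioo 0 T)
    (hcomp : ConfRFSComplete T M u) (hexp : Expanding T M) (hid : InitiallyDetermined M) {p z : ℂ}
    {t : ℝ} (hz : (z, t) ∈ M) (hp : p ∈ ball (0:ℂ) 1) (hpt : (p, t) ∉ M) :
    2 * t * Real.exp (-3) / ‖z - p‖ ≤ u z t := by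
  have hne : z ≠ p := fun e => hpt (e ▸ hz)
  have hpos : 0 < ‖z - p‖ := norm_pos_iff.2 (sub_ne_zero.2 hne)
  have ht : 0 < t := (hD hz).2.1
  refine le_trans ?_ (two_mul_exp_logBarrier_le_conf hRF hD hcomp hexp hid hz hp hpt)
  rw [exp_logBarrier hne, mul_div_assoc]
  gcongr
  linarith

theorem exists_notMem_later {T : ℝ} {M : Set (ℂ × ℝ)} (hcts : ContinuousSpacetime T M) {q : ℂ}
    {t ε : ℝ} (ht : t ∈ Ioo 0 T) (hq : (q, t) ∉ M) {U : Set ℂ} (hU : IsOpen U) (hqU : q ∈ U)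
    (hε : 0 < ε) : ∃ q' ∈ ball q ε ∩ U, ∃ t' ∈ Ioo t T, (q', t') ∉ M := by
  by_contra! hc
  have : q ∈ timeSlice M t := by
    rw [hcts t ht, mem_interior]
    exact ⟨ball q ε ∩ U, fun x hx => mem_iInter₂.2 fun s hs => hc x hx s hs,
      isOpen_ball.inter hU, mem_ball_self hε, hqU⟩
  exact hq this

theorem eventually_le_log_conf {T : ℝ} {M : Set (ℂ × ℝ)} {u : ℂ → ℝ → ℝ}
    (hRF : ConfRFS T M u) (hexp : Expanding T M) (hcts : ContinuousSpacetime T M)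
    (hlow : ∀ p z t, (z, t) ∈ M → p ∈ ball (0:ℂ) 1 → (p, t) ∉ M →
      2 * t * Real.exp (-3) / ‖z - p‖ ≤ u z t)
    (a : ℝ) {q : ℂ × ℝ} (hq : q ∈ ball (0:ℂ) 1 ×ˢ Ioo 0 T) (hqM : q ∉ M) :
    ∀ᶠ x in nhds q, x ∈ M → a ≤ Real.log (u x.1 x.2) := by
  obtain ⟨q, t⟩ := q
  obtain ⟨hq1, ht⟩ := hq
  simp only at hq1 ht
  set ε : ℝ := t * Real.exp (-3) / (2 * Real.exp a) with hε
  have hε0 : 0 < ε := by have := ht.1; positivity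
  obtain ⟨q', ⟨hq'ε, hq'⟩, t', ht', hn⟩ := exists_notMem_later hcts ht hqM isOpen_ball hq1 hε0
  have hev : ball q ε ×ˢ Ioo (t / 2) t' ∈ nhds (q, t) :=
    prod_mem_nhds (ball_mem_nhds q hε0) (Ioo_mem_nhds (by linarith [ht.1]) ht'.1)
  filter_upwards [hev] with x hx hxM
  obtain ⟨z, s⟩ := x
  obtain ⟨hz, hs⟩ := hx
  simp only at hz hs ⊢
  have hn' : (q', s) ∉ M := fun h => hn (hexp q' s t' h hs.2.le ht'.2)
  have h1 := hlow q' z s hxM hq' hn'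
  have hne : z ≠ q' := fun e => hn' (e ▸ hxM)
  have hpos : 0 < ‖z - q'‖ := norm_pos_iff.2 (sub_ne_zero.2 hne)
  have hlt : ‖z - q'‖ ≤ 2 * ε := by
    rw [← dist_eq_norm]
    have := dist_triangle_right z q' q
    rw [mem_ball] at hz hq'ε
    linarith
  rw [Real.le_log_iff_exp_le (hRF.pos _ hxM)]
  refine le_trans ?_ h1
  rw [le_div_iff₀ hpos]
  calc Real.exp a * ‖z - q'‖ ≤ Real.exp a * (2 * ε) := by gcongr
    _ = 2 * (t / 2) * Real.exp (-3) := by rw [hε]; field_simp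
    _ ≤ 2 * s * Real.exp (-3) := by
      have := hs.1
      gcongr

open Classical in
/-- The extension of `V` by the constant `a` outside `M`. -/
noncomputable def extendBy (M : Set (ℂ × ℝ)) (V : ℂ × ℝ → ℝ) (a : ℝ) (q : ℂ × ℝ) : ℝ :=
  if q ∈ M then V q else a

theorem extendBy_of_mem {M : Set (ℂ × ℝ)} {V : ℂ × ℝ → ℝ} {a : ℝ} {q : ℂ × ℝ} (h : q ∈ M) :
    extendBy M V a q = V q := if_pos h

theorem extendBy_of_notMem {M : Set (ℂ × ℝ)} {V : ℂ × ℝ → ℝ} {a : ℝ} {q : ℂ × ℝ} (h : q ∉ M) :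
    extendBy M V a q = a := if_neg h

theorem eventually_le_extendBy {M : Set (ℂ × ℝ)} {V : ℂ × ℝ → ℝ} {a : ℝ} {q : ℂ × ℝ}
    (h : ∀ᶠ x in nhds q, x ∈ M → a ≤ V x) : ∀ᶠ x in nhds q, a ≤ extendBy M V a x := by
  filter_upwards [h] with x hx
  by_cases hxM : x ∈ M
  · rw [extendBy_of_mem hxM]; exact hx hxM
  · rw [extendBy_of_notMem hxM]

section

variable {M O : Set (ℂ × ℝ)} {V : ℂ × ℝ → ℝ} {A : ℂ × ℝ → (ℂ × ℝ →L[ℝ] ℝ)}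
  {H : ℂ × ℝ → (ℂ × ℝ →L[ℝ] ℂ × ℝ →L[ℝ] ℝ)} {a : ℝ} {q : ℂ × ℝ} {k k' : ℝ → ℝ}

theorem LogFlow.extendBy_eventuallyEq (h : LogFlow M V A H) (hq : q ∈ M) :
    extendBy M V a =ᶠ[nhds q] V := by
  filter_upwards [h.opn.mem_nhds hq] with x hx using extendBy_of_mem hx

theorem LogFlow.hasFDerivAt_comp_extendBy (h : LogFlow M V A H)
    (hO : ∀ q ∈ O, q ∉ M → ∀ᶠ x in nhds q, x ∈ M → a ≤ V x)
    (hk : ∀ v, HasDerivAt k (k' v) v) (hka : ∀ v, a ≤ v → k v = k a) (hk' : k' a = 0) (hq : q ∈ O) :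
    HasFDerivAt (fun q => k (extendBy M V a q)) (k' (extendBy M V a q) • A q) q := by
  by_cases hqM : q ∈ M
  · rw [extendBy_of_mem hqM]
    refine ((hk (V q)).comp_hasFDerivAt q (h.fst q hqM)).congr_of_eventuallyEq ?_
    filter_upwards [h.extendBy_eventuallyEq (a := a) hqM] with x hx
    rw [hx]; rfl
  · rw [extendBy_of_notMem hqM, hk', zero_smul]
    refine (hasFDerivAt_const (k a) q).congr_of_eventuallyEq ?_
    filter_upwards [eventually_le_extendBy (hO q hq hqM)] with x hx using hka _ hx

theorem LogFlow.hasFDerivAt_smul_extendBy (h : LogFlow M V A H)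
    (hO : ∀ q ∈ O, q ∉ M → ∀ᶠ x in nhds q, x ∈ M → a ≤ V x)
    (hk : ∀ v, HasDerivAt k (k' v) v) (hka : ∀ v, a ≤ v → k v = 0) (hk' : k' a = 0) (hq : q ∈ O) :
    HasFDerivAt (fun q => k (extendBy M V a q) • A q)
      (k (extendBy M V a q) • H q + (k' (extendBy M V a q) • A q).smulRight (A q)) q := by
  by_cases hqM : q ∈ M
  · exact (h.hasFDerivAt_comp_extendBy hO hk
      (fun v hv => (hka v hv).trans (hka a le_rfl).symm) hk' hq).smul (h.snd q hqM)
  · rw [extendBy_of_notMem hqM, hk', hka a le_rfl]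
    have : (0:ℝ) • H q + ((0:ℝ) • A q).smulRight (A q) = 0 := by ext <;> simp
    rw [this]
    refine (hasFDerivAt_const 0 q).congr_of_eventuallyEq ?_
    filter_upwards [eventually_le_extendBy (hO q hq hqM)] with x hx
    rw [hka _ hx, zero_smul]

theorem LogFlow.continuousOn_mul_extendBy (h : LogFlow M V A H)
    (hO : ∀ q ∈ O, q ∉ M → ∀ᶠ x in nhds q, x ∈ M → a ≤ V x) {B : ℂ × ℝ → ℝ}
    (hB : ContinuousOn B M) (hk : Continuous k) (hka : ∀ v, a ≤ v → k v = 0) :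
    ContinuousOn (fun q => k (extendBy M V a q) * B q) O := by
  intro q hq
  refine ContinuousAt.continuousWithinAt ?_
  by_cases hqM : q ∈ M
  · have h1 : ContinuousAt (fun q => k (V q) * B q) q :=
      (hk.continuousAt.comp (h.fst q hqM).continuousAt).mul
        (hB.continuousAt (h.opn.mem_nhds hqM))
    refine h1.congr ?_
    filter_upwards [h.extendBy_eventuallyEq (a := a) hqM] with x hx
    rw [hx]
  · refine (continuousAt_const (y := (0:ℝ))).congr ?_
    filter_upwards [eventually_le_extendBy (hO q hq hqM)] with x hx
    rw [hka _ hx, zero_mul]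

end

theorem hasDerivAt_max_zero_pow (n : ℕ) (x : ℝ) :
    HasDerivAt (fun x : ℝ => max 0 x ^ (n + 2)) ((n + 2) * max 0 x ^ (n + 1)) x := by
  rcases lt_trichotomy x 0 with hx | hx | hx
  · rw [max_eq_left hx.le]
    have : ((n:ℝ) + 2) * 0 ^ (n + 1) = 0 := by simp
    rw [this]
    refine (hasDerivAt_const x (0:ℝ)).congr_of_eventuallyEq ?_
    filter_upwards [Iio_mem_nhds hx] with y hy
    rw [max_eq_left (le_of_lt hy)]; simp
  · subst hx
    rw [hasDerivAt_iff_tendsto_slope]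
    have hc : Tendsto (fun x : ℝ => max 0 x ^ (n + 1)) (nhdsWithin 0 {0}ᶜ) (nhds 0) := by
      have : Continuous fun x : ℝ => max 0 x ^ (n + 1) := by fun_prop
      have h0 := this.tendsto 0
      simp only [max_self, ne_eq, Nat.add_eq_zero_iff, one_ne_zero, and_false, not_false_eq_true,
        zero_pow] at h0
      exact h0.mono_left nhdsWithin_le_nhds
    have e : ((n:ℝ) + 2) * max 0 0 ^ (n + 1) = 0 := by simp
    rw [e]
    refine hc.congr' ?_
    filter_upwards [self_mem_nhdsWithin] with y hy
    rw [slope_def_field]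
    rcases lt_or_gt_of_ne (hy : y ≠ 0) with h | h
    · simp [max_eq_left h.le]
    · rw [max_eq_right h.le]
      simp only [max_self, ne_eq, Nat.add_eq_zero_iff, OfNat.ofNat_ne_zero, and_false,
        not_false_eq_true, zero_pow, sub_zero]
      field_simp
      ring
  · have e : max 0 x = x := max_eq_right hx.le
    rw [e]
    refine ((hasDerivAt_pow (n + 2) x).congr_deriv (by simp)).congr_of_eventuallyEq ?_
    filter_upwards [Ioi_mem_nhds hx] with y hy
    rw [max_eq_right (le_of_lt hy)]

/-- The positive part of `1 - e ^ v / N`. -/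
noncomputable def capPart (N v : ℝ) : ℝ := max 0 (1 - Real.exp v / N)

/-- A `C²` truncation of the exponential function at height `N`. -/
noncomputable def capExp (N v : ℝ) : ℝ := N * (1 - capPart N v ^ 3)

/-- The derivative of `capLin`. -/
noncomputable def capSlope (N v : ℝ) : ℝ := 3 * capPart N v ^ 2

/-- The derivative of `capSlope`. -/
noncomputable def capSlopeDeriv (N v : ℝ) : ℝ := -(6 * capPart N v * Real.exp v / N)

/-- The concave function whose composition with the logarithm of the conformal factor has a
Laplacian dominated by the time derivative of `capExp`. -/
noncomputable def capLin (c N v : ℝ) : ℝ := ∫ x in Real.log c..v, capSlope N x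

theorem capPart_nonneg (N v : ℝ) : 0 ≤ capPart N v := le_max_left _ _

theorem capPart_le_one {N : ℝ} (hN : 0 < N) (v : ℝ) : capPart N v ≤ 1 :=
  max_le zero_le_one (by have := Real.exp_pos v; linarith [div_pos this hN])

theorem capPart_eq_zero {N v : ℝ} (hN : 0 < N) (hv : Real.log N ≤ v) : capPart N v = 0 := by
  refine max_eq_left ?_
  rw [Real.log_le_iff_le_exp hN] at hv
  rw [sub_nonpos, le_div_iff₀ hN]
  linarith

theorem continuous_capPart (N : ℝ) : Continuous (capPart N) := by
  unfold capPart; fun_prop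

theorem hasDerivAt_capPart_pow (n : ℕ) (N v : ℝ) :
    HasDerivAt (fun v => capPart N v ^ (n + 2))
      ((n + 2) * capPart N v ^ (n + 1) * -(Real.exp v / N)) v :=
  (hasDerivAt_max_zero_pow n _).comp v (((Real.hasDerivAt_exp v).div_const N).const_sub 1)

theorem hasDerivAt_capExp {N : ℝ} (hN : 0 < N) (v : ℝ) :
    HasDerivAt (capExp N) (capSlope N v * Real.exp v) v := by
  refine (((hasDerivAt_capPart_pow 1 N v).const_sub 1).const_mul N).congr_deriv ?_
  rw [capSlope]
  push_cast
  field_simp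
  norm_num
  ring

theorem hasDerivAt_capSlope (N v : ℝ) : HasDerivAt (capSlope N) (capSlopeDeriv N v) v := by
  refine ((hasDerivAt_capPart_pow 0 N v).const_mul 3).congr_deriv ?_
  rw [capSlopeDeriv]
  push_cast
  ring

theorem continuous_capSlope (N : ℝ) : Continuous (capSlope N) := by
  have := continuous_capPart N
  unfold capSlope; fun_prop

theorem continuous_capSlopeDeriv (N : ℝ) : Continuous (capSlopeDeriv N) := by
  have := continuous_capPart N
  unfold capSlopeDeriv; fun_prop

theorem capSlope_nonneg (N v : ℝ) : 0 ≤ capSlope N v := by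
  unfold capSlope; positivity

theorem capSlope_le {N : ℝ} (hN : 0 < N) (v : ℝ) : capSlope N v ≤ 3 := by
  have h := pow_le_one₀ (n := 2) (capPart_nonneg N v) (capPart_le_one hN v)
  unfold capSlope; linarith

theorem capSlopeDeriv_nonpos {N : ℝ} (hN : 0 < N) (v : ℝ) : capSlopeDeriv N v ≤ 0 := by
  have := capPart_nonneg N v
  unfold capSlopeDeriv
  rw [neg_nonpos]
  positivity

theorem capSlope_eq_zero {N v : ℝ} (hN : 0 < N) (hv : Real.log N ≤ v) : capSlope N v = 0 := by
  simp [capSlope, capPart_eq_zero hN hv]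

theorem capSlopeDeriv_eq_zero {N v : ℝ} (hN : 0 < N) (hv : Real.log N ≤ v) :
    capSlopeDeriv N v = 0 := by
  simp [capSlopeDeriv, capPart_eq_zero hN hv]

theorem capExp_eq {N v : ℝ} (hN : 0 < N) (hv : Real.log N ≤ v) : capExp N v = N := by
  simp [capExp, capPart_eq_zero hN hv]

theorem hasDerivAt_capLin (c N v : ℝ) : HasDerivAt (capLin c N) (capSlope N v) v :=
  intervalIntegral.integral_hasDerivAt_right ((continuous_capSlope N).intervalIntegrable _ _)
    ((continuous_capSlope N).stronglyMeasurableAtFilter _ _) (continuous_capSlope N).continuousAt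

theorem capLin_eq {c N v : ℝ} (hN : 0 < N) (hv : Real.log N ≤ v) :
    capLin c N v = capLin c N (Real.log N) := by
  unfold capLin
  rw [← intervalIntegral.integral_add_adjacent_intervals
    ((continuous_capSlope N).intervalIntegrable (Real.log c) (Real.log N))
    ((continuous_capSlope N).intervalIntegrable (Real.log N) v)]
  rw [add_eq_left]
  refine intervalIntegral.integral_zero_ae (Eventually.of_forall fun x hx => ?_)
  rw [uIoc_of_le hv] at hx
  exact capSlope_eq_zero hN hx.1.le

theorem capLin_nonneg {c N v : ℝ} (hv : Real.log c ≤ v) : 0 ≤ capLin c N v :=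
  intervalIntegral.integral_nonneg hv fun x _ => capSlope_nonneg N x

theorem capLin_le {c N v : ℝ} (hN : 0 < N) (hv : Real.log c ≤ v) :
    capLin c N v ≤ 3 * (v - Real.log c) := by
  have := intervalIntegral.integral_mono_on hv
    ((continuous_capSlope N).intervalIntegrable (μ := volume) _ _)
    (continuous_const.intervalIntegrable (μ := volume) _ _) fun x _ => capSlope_le hN x
  simpa [capLin, mul_comm] using this

theorem exp_le_capExp {N v : ℝ} (hN : 0 < N) (hv : v ≤ Real.log N) :
    Real.exp v ≤ capExp N v := by
  have h1 : Real.exp v ≤ N := by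
    rwa [← Real.le_log_iff_exp_le hN]
  have hx0 : 0 ≤ Real.exp v / N := by positivity
  have hx1 : Real.exp v / N ≤ 1 := by rwa [div_le_one hN]
  have hy : capPart N v = 1 - Real.exp v / N := max_eq_right (by linarith)
  have e : Real.exp v = N * (Real.exp v / N) := by field_simp
  rw [capExp, hy]
  set x := Real.exp v / N
  rw [e]
  gcongr
  nlinarith [mul_nonneg hx0 (sub_nonneg.2 hx1), mul_nonneg hx0 (mul_nonneg (sub_nonneg.2 hx1) (sub_nonneg.2 hx1))]

theorem min_le_capExp {N : ℝ} (hN : 0 < N) (v : ℝ) : min (Real.exp v) N ≤ capExp N v := by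
  rcases le_total v (Real.log N) with h | h
  · exact (min_le_left _ _).trans (exp_le_capExp hN h)
  · exact (min_le_right _ _).trans (capExp_eq hN h).ge

theorem capExp_le {N : ℝ} (hN : 0 < N) (v : ℝ) : capExp N v ≤ 3 * Real.exp v := by
  rcases le_total v (Real.log N) with h | h
  · have h1 : Real.exp v ≤ N := by rwa [← Real.le_log_iff_exp_le hN]
    have hx0 : 0 ≤ Real.exp v / N := by positivity
    have hx1 : Real.exp v / N ≤ 1 := by rwa [div_le_one hN]
    have hy : capPart N v = 1 - Real.exp v / N := max_eq_right (by linarith)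
    have e : Real.exp v = N * (Real.exp v / N) := by field_simp
    rw [capExp, hy]
    set x := Real.exp v / N
    rw [e, mul_left_comm]
    gcongr
    nlinarith [mul_nonneg hx0 hx0, mul_nonneg hx0 (mul_nonneg hx0 (sub_nonneg.2 hx1))]
  · rw [capExp_eq hN h]
    rw [Real.log_le_iff_le_exp hN] at h
    linarith

theorem capExp_nonneg {N : ℝ} (hN : 0 < N) (v : ℝ) : 0 ≤ capExp N v :=
  (le_min (Real.exp_pos v).le hN.le).trans (min_le_capExp hN v)

theorem capLin_sq_le {c N v : ℝ} (hc : 0 < c) (hcN : c ≤ N) (hv : Real.log c ≤ v) :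
    capLin c N v ^ 2 ≤ 36 * (capExp N v / c) := by
  have hN := hc.trans_le hcN
  have key : ∀ w, Real.log c ≤ w → (3 * (w - Real.log c)) ^ 2 ≤ 36 * (Real.exp w / c) := by
    intro w hw
    have e : Real.exp w / c = Real.exp ((w - Real.log c) / 2) ^ 2 := by
      rw [← Real.exp_nat_mul]
      have : (2:ℕ) * ((w - Real.log c) / 2) = w - Real.log c := by push_cast; ring
      rw [this, Real.exp_sub, Real.exp_log hc]
    rw [e]
    have := Real.add_one_le_exp ((w - Real.log c) / 2)
    have h0 : 0 ≤ w - Real.log c := by linarith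
    nlinarith
  have h0 := capLin_nonneg (N := N) hv
  rcases le_total v (Real.log N) with h | h
  · calc capLin c N v ^ 2 ≤ (3 * (v - Real.log c)) ^ 2 := by gcongr; exact capLin_le hN hv
      _ ≤ _ := key v hv
      _ ≤ _ := by gcongr; exact exp_le_capExp hN h
  · rw [capLin_eq hN h, capExp_eq hN h]
    have h1 : Real.log c ≤ Real.log N := Real.log_le_log hc hcN
    have h2 := capLin_nonneg (N := N) h1
    have h3 := key _ h1
    rw [Real.exp_log hN] at h3
    refine le_trans ?_ h3
    gcongr
    exact capLin_le hN h1

/-- The positive part of `r ^ 2 - ‖z - p‖ ^ 2`. -/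
noncomputable def bumpBase (p : ℂ) (r : ℝ) (z : ℂ) : ℝ := max 0 (r ^ 2 - ‖z - p‖ ^ 2)

/-- A `C²` bump function supported in the closed ball of centre `p` and radius `r`. -/
noncomputable def bump (p : ℂ) (r : ℝ) (z : ℂ) : ℝ := bumpBase p r z ^ 4

/-- The derivative of `bump` in the direction `e`. -/
noncomputable def bumpFst (p : ℂ) (r : ℝ) (e z : ℂ) : ℝ :=
  4 * bumpBase p r z ^ 3 * -(2 * inner ℝ (z - p) e)

/-- The second derivative of `bump` in the direction `e`. -/
noncomputable def bumpSnd (p : ℂ) (r : ℝ) (e z : ℂ) : ℝ :=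
  12 * bumpBase p r z ^ 2 * (2 * inner ℝ (z - p) e) ^ 2 - 8 * bumpBase p r z ^ 3 * ‖e‖ ^ 2

theorem bumpBase_nonneg (p : ℂ) (r : ℝ) (z : ℂ) : 0 ≤ bumpBase p r z := le_max_left _ _

theorem bump_nonneg (p : ℂ) (r : ℝ) (z : ℂ) : 0 ≤ bump p r z :=
  pow_nonneg (bumpBase_nonneg p r z) 4

theorem bumpBase_le_one {r : ℝ} (hr : 0 < r) (hr1 : r ≤ 1) (p z : ℂ) : bumpBase p r z ≤ 1 :=
  max_le zero_le_one (by nlinarith [sq_nonneg ‖z - p‖])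

theorem bumpBase_eq_zero {p : ℂ} {r : ℝ} (hr : 0 < r) {z : ℂ} (hz : z ∉ closedBall p r) :
    bumpBase p r z = 0 := by
  rw [mem_closedBall, dist_eq_norm, not_le] at hz
  refine max_eq_left ?_
  nlinarith

theorem continuous_bumpBase (p : ℂ) (r : ℝ) : Continuous (bumpBase p r) := by
  unfold bumpBase; fun_prop

theorem hasDerivAt_bumpBase_pow (n : ℕ) (p : ℂ) (r : ℝ) (z e : ℂ) :
    HasDerivAt (fun x : ℝ => bumpBase p r (z + x • e) ^ (n + 2))
      ((n + 2) * bumpBase p r z ^ (n + 1) * -(2 * inner ℝ (z - p) e)) 0 := by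
  have h0 : HasDerivAt (fun x : ℝ => z + x • e - p) e 0 := by
    simpa using (((hasDerivAt_id (0:ℝ)).smul_const e).const_add z).sub_const p
  have h1 := (h0.norm_sq.const_sub (r ^ 2))
  have h2 := (hasDerivAt_max_zero_pow n (r ^ 2 - ‖z + (0:ℝ) • e - p‖ ^ 2)).comp (0:ℝ) h1
  simpa [bumpBase, Function.comp_def] using h2

theorem hasLineDerivAt_bump (p : ℂ) (r : ℝ) (z e : ℂ) :
    HasLineDerivAt ℝ (bump p r) (bumpFst p r e z) z e := by
  refine (hasDerivAt_bumpBase_pow 2 p r z e).congr_deriv ?_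
  rw [bumpFst]
  norm_num

theorem hasLineDerivAt_bumpFst (p : ℂ) (r : ℝ) (z e : ℂ) :
    HasLineDerivAt ℝ (bumpFst p r e) (bumpSnd p r e z) z e := by
  have h0 : HasDerivAt (fun x : ℝ => z + x • e - p) e 0 := by
    simpa using (((hasDerivAt_id (0:ℝ)).smul_const e).const_add z).sub_const p
  have h1 := ((h0.inner ℝ (hasDerivAt_const (0:ℝ) e)).const_mul 2).neg
  have h2 := ((hasDerivAt_bumpBase_pow 1 p r z e).const_mul 4).mul h1
  refine h2.congr_deriv ?_
  simp only [Pi.neg_apply, zero_smul, add_zero, inner_zero_right, real_inner_self_eq_norm_sq, bumpSnd]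
  push_cast
  ring

theorem continuous_bump (p : ℂ) (r : ℝ) : Continuous (bump p r) :=
  (continuous_bumpBase p r).pow 4

theorem continuous_bumpFst (p : ℂ) (r : ℝ) (e : ℂ) : Continuous (bumpFst p r e) := by
  have := continuous_bumpBase p r
  unfold bumpFst; fun_prop

theorem continuous_bumpSnd (p : ℂ) (r : ℝ) (e : ℂ) : Continuous (bumpSnd p r e) := by
  have := continuous_bumpBase p r
  unfold bumpSnd; fun_prop

theorem abs_bumpSnd_add_le {r : ℝ} (hr : 0 < r) (hr1 : r ≤ 1) (p z : ℂ) :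
    |bumpSnd p r 1 z + bumpSnd p r Complex.I z| ≤ 112 * bumpBase p r z ^ 2 := by
  by_cases hz : z ∈ closedBall p r
  · have h0 := bumpBase_nonneg p r z
    have h1 := bumpBase_le_one hr hr1 p z
    have h2 : ‖z - p‖ ^ 2 ≤ 1 := by
      rw [mem_closedBall, dist_eq_norm] at hz
      exact pow_le_one₀ (norm_nonneg _) (hz.trans hr1)
    have e1 : inner ℝ (z - p) (1:ℂ) = (z - p).re := by simp [Complex.inner]
    have e2 : inner ℝ (z - p) Complex.I = (z - p).im := by
      simp [Complex.inner]
      ring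
    have e3 : ‖z - p‖ ^ 2 = (z - p).re ^ 2 + (z - p).im ^ 2 := by
      rw [Complex.sq_norm, Complex.normSq_apply]; ring
    have e : bumpSnd p r 1 z + bumpSnd p r Complex.I z =
        bumpBase p r z ^ 2 * (48 * ‖z - p‖ ^ 2 - 16 * bumpBase p r z) := by
      rw [bumpSnd, bumpSnd, e1, e2, e3, norm_one, Complex.norm_I]
      ring
    rw [e, abs_mul, abs_of_nonneg (by positivity : 0 ≤ bumpBase p r z ^ 2), mul_comm]
    gcongr
    rw [abs_le]
    constructor <;> nlinarith [sq_nonneg ‖z - p‖]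
  · simp [bumpSnd, bumpBase_eq_zero hr hz]

theorem integrable_of_continuousOn_of_eq_zero {g : ℂ → ℝ} {K : Set ℂ} (hK : IsCompact K)
    (hg : ContinuousOn g K) (h0 : ∀ z ∉ K, g z = 0) : Integrable g := by
  rw [← integrableOn_iff_integrable_of_support_subset (s := K)]
  · exact hg.integrableOn_compact hK
  · intro z hz
    by_contra h
    exact hz (h0 z h)

theorem integral_lineDeriv_eq_zero {g g' : ℂ → ℝ} {e : ℂ} (hg : Integrable g) (hg' : Integrable g')
    (h : ∀ z, HasLineDerivAt ℝ g (g' z) z e) : ∫ z, g' z = 0 := by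
  have := integral_bilinear_hasLineDerivAt_right_eq_neg_left_of_integrable (μ := volume)
    (f := fun _ : ℂ => (1:ℝ)) (f' := fun _ => 0) (g := g) (g' := g') (v := e)
    (B := ContinuousLinearMap.mul ℝ ℝ) (by simp) (by simpa using hg') (by simpa using hg)
    (fun x _ => by simpa [HasLineDerivAt] using hasDerivAt_const (0:ℝ) (1:ℝ)) (fun x _ => h x)
  simpa using this

section

variable {M O : Set (ℂ × ℝ)} {V : ℂ × ℝ → ℝ} {A : ℂ × ℝ → (ℂ × ℝ →L[ℝ] ℝ)}
  {H : ℂ × ℝ → (ℂ × ℝ →L[ℝ] ℂ × ℝ →L[ℝ] ℝ)} {a : ℝ} {q : ℂ × ℝ} {k k₁ k₂ : ℝ → ℝ}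

/-- The second derivative in the direction `e` of the composition of a function with derivatives
`k₁` and `k₂` with the extension of `V`. -/
noncomputable def extendBySnd (M : Set (ℂ × ℝ)) (V : ℂ × ℝ → ℝ) (A : ℂ × ℝ → (ℂ × ℝ →L[ℝ] ℝ))
    (H : ℂ × ℝ → (ℂ × ℝ →L[ℝ] ℂ × ℝ →L[ℝ] ℝ)) (a : ℝ) (k₁ k₂ : ℝ → ℝ) (e : ℂ) (q : ℂ × ℝ) : ℝ :=
  k₁ (extendBy M V a q) * H q (e, 0) (e, 0) + k₂ (extendBy M V a q) * A q (e, 0) ^ 2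

theorem LogFlow.continuousOn_extendBySnd (h : LogFlow M V A H)
    (hO : ∀ q ∈ O, q ∉ M → ∀ᶠ x in nhds q, x ∈ M → a ≤ V x) (hk₁ : Continuous k₁)
    (hk₂ : Continuous k₂) (hk₁a : ∀ v, a ≤ v → k₁ v = 0) (hk₂a : ∀ v, a ≤ v → k₂ v = 0) (e : ℂ) :
    ContinuousOn (extendBySnd M V A H a k₁ k₂ e) O := by
  refine (h.continuousOn_mul_extendBy hO (B := fun q => H q (e, 0) (e, 0)) ?_ hk₁ hk₁a).add
    (h.continuousOn_mul_extendBy hO (B := fun q => A q (e, 0) ^ 2) ?_ hk₂ hk₂a)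
  · exact (h.cont.clm_apply continuousOn_const).clm_apply continuousOn_const
  · exact (h.continuousOn_snd.clm_apply continuousOn_const).pow 2

theorem HasFDerivAt.hasLineDerivAt_slice {g : ℂ × ℝ → ℝ} {g' : ℂ × ℝ →L[ℝ] ℝ} {z : ℂ} {t : ℝ}
    (hg : HasFDerivAt g g' (z, t)) (e : ℂ) :
    HasLineDerivAt ℝ (fun z => g (z, t)) (g' (e, 0)) z e := by
  have hc : HasDerivAt (fun x : ℝ => (z + x • e, t)) (e, (0:ℝ)) 0 := by
    refine HasDerivAt.prodMk ?_ (hasDerivAt_const _ t)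
    simpa using ((hasDerivAt_id (0:ℝ)).smul_const e).const_add z
  have hg' : HasFDerivAt g g' (z + (0:ℝ) • e, t) := by simpa using hg
  exact hg'.comp_hasDerivAt (0:ℝ) hc

theorem LogFlow.integral_extendBySnd_mul_bump (h : LogFlow M V A H)
    (hO : ∀ q ∈ O, q ∉ M → ∀ᶠ x in nhds q, x ∈ M → a ≤ V x)
    (hk : ∀ v, HasDerivAt k (k₁ v) v) (hk₁ : ∀ v, HasDerivAt k₁ (k₂ v) v) (hk₂ : Continuous k₂)
    (hka : ∀ v, a ≤ v → k v = k a) (hk₁a : ∀ v, a ≤ v → k₁ v = 0)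
    (hk₂a : ∀ v, a ≤ v → k₂ v = 0) {p : ℂ} {r t : ℝ} (hr : 0 < r)
    (hK : closedBall p r ×ˢ {t} ⊆ O) (e : ℂ) :
    Integrable (fun z => k (extendBy M V a (z, t)) * bumpSnd p r e z) ∧
    Integrable (fun z => extendBySnd M V A H a k₁ k₂ e (z, t) * bump p r z) ∧
    ∫ z, extendBySnd M V A H a k₁ k₂ e (z, t) * bump p r z =
      ∫ z, k (extendBy M V a (z, t)) * bumpSnd p r e z := by
  have hk₁c : Continuous k₁ := continuous_iff_continuousAt.2 fun v => (hk₁ v).continuousAt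
  have hmaps : MapsTo (fun z : ℂ => (z, t)) (closedBall p r) O := fun z hz => hK ⟨hz, rfl⟩
  have hin : ContinuousOn (fun z : ℂ => (z, t)) (closedBall p r) := by fun_prop
  have c0 : ContinuousOn (fun z => k (extendBy M V a (z, t))) (closedBall p r) :=
    ContinuousOn.comp (t := O) (g := fun q => k (extendBy M V a q)) (fun q hq =>
      (h.hasFDerivAt_comp_extendBy hO hk hka (hk₁a a le_rfl) hq).continuousAt.continuousWithinAt)
      hin hmaps
  have c1 : ContinuousOn (fun z => k₁ (extendBy M V a (z, t)) * A (z, t) (e, 0)) (closedBall p r) :=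
    ContinuousOn.comp (t := O) (g := fun q => k₁ (extendBy M V a q) * A q (e, 0))
      (h.continuousOn_mul_extendBy hO (h.continuousOn_snd.clm_apply continuousOn_const) hk₁c hk₁a)
      hin hmaps
  have c2 : ContinuousOn (fun z => extendBySnd M V A H a k₁ k₂ e (z, t)) (closedBall p r) :=
    (h.continuousOn_extendBySnd hO hk₁c hk₂ hk₁a hk₂a e).comp hin hmaps
  have b0 : ∀ z ∉ closedBall p r, bump p r z = 0 := fun z hz => by
    simp [bump, bumpBase_eq_zero hr hz]
  have b1 : ∀ z ∉ closedBall p r, bumpFst p r e z = 0 := fun z hz => by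
    simp [bumpFst, bumpBase_eq_zero hr hz]
  have b2 : ∀ z ∉ closedBall p r, bumpSnd p r e z = 0 := fun z hz => by
    simp [bumpSnd, bumpBase_eq_zero hr hz]
  have i1 : Integrable (fun z => k (extendBy M V a (z, t)) * bumpSnd p r e z) :=
    integrable_of_continuousOn_of_eq_zero (isCompact_closedBall p r)
      (c0.mul (continuous_bumpSnd p r e).continuousOn) fun z hz => by rw [b2 z hz, mul_zero]
  have i2 : Integrable (fun z => extendBySnd M V A H a k₁ k₂ e (z, t) * bump p r z) :=
    integrable_of_continuousOn_of_eq_zero (isCompact_closedBall p r)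
      (c2.mul (continuous_bump p r).continuousOn) fun z hz => by rw [b0 z hz, mul_zero]
  have i3 : Integrable (fun z => k (extendBy M V a (z, t)) * bumpFst p r e z -
      k₁ (extendBy M V a (z, t)) * A (z, t) (e, 0) * bump p r z) :=
    integrable_of_continuousOn_of_eq_zero (isCompact_closedBall p r)
      ((c0.mul (continuous_bumpFst p r e).continuousOn).sub
        (c1.mul (continuous_bump p r).continuousOn)) fun z hz => by
        rw [b0 z hz, b1 z hz, mul_zero, mul_zero, sub_zero]
  refine ⟨i1, i2, ?_⟩
  have key : ∫ z, (k (extendBy M V a (z, t)) * bumpSnd p r e z -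
      extendBySnd M V A H a k₁ k₂ e (z, t) * bump p r z) = 0 := by
    refine integral_lineDeriv_eq_zero (e := e) i3 (i1.sub i2) fun z => ?_
    by_cases hz : z ∈ closedBall p r
    · have hq : (z, t) ∈ O := hmaps hz
      have d0 := (h.hasFDerivAt_comp_extendBy hO hk hka (hk₁a a le_rfl) hq).hasLineDerivAt_slice e
      have d1 := ((ContinuousLinearMap.apply ℝ ℝ ((e, 0) : ℂ × ℝ)).hasFDerivAt.comp (z, t)
        (h.hasFDerivAt_smul_extendBy hO hk₁ hk₁a (hk₂a a le_rfl) hq)).hasLineDerivAt_slice e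
      have d2 := HasDerivAt.sub (HasDerivAt.mul d0 (hasLineDerivAt_bumpFst p r z e))
        (HasDerivAt.mul d1 (hasLineDerivAt_bump p r z e))
      refine HasDerivAt.congr_deriv d2 ?_
      simp [extendBySnd]
      ring
    · rw [b0 z hz, b2 z hz, mul_zero, mul_zero, sub_zero]
      have : ∀ᶠ x : ℝ in nhds 0, z + x • e ∉ closedBall p r := by
        have hc : ContinuousAt (fun x : ℝ => z + x • e) 0 := by fun_prop
        exact hc.eventually (isClosed_closedBall.isOpen_compl.mem_nhds (by simpa using hz))
      refine HasDerivAt.congr_of_eventuallyEq (hasDerivAt_const (0:ℝ) (0:ℝ)) ?_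
      filter_upwards [this] with x hx
      rw [b0 _ hx, b1 _ hx, mul_zero, mul_zero, sub_zero]
  rw [integral_sub i1 i2] at key
  linarith

end

theorem hasDerivAt_integral_of_isCompact {S : Set ℝ} (hS : IsOpen S) {K : Set ℂ} (hK : IsCompact K)
    {f f' : ℝ → ℂ → ℝ} (hd : ∀ x ∈ S, ∀ z ∈ K, HasDerivAt (fun x => f x z) (f' x z) x)
    (hf : ∀ x ∈ S, ContinuousOn (f x) K)
    (hf' : ContinuousOn (fun p : ℝ × ℂ => f' p.1 p.2) (S ×ˢ K)) {x : ℝ} (hx : x ∈ S) :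
    HasDerivAt (fun x => ∫ z in K, f x z) (∫ z in K, f' x z) x := by
  obtain ⟨δ, hδ, hball⟩ := Metric.nhds_basis_closedBall.mem_iff.1 (hS.mem_nhds hx)
  obtain ⟨C, hC⟩ := ((isCompact_closedBall x δ).prod hK).exists_bound_of_continuousOn
    (hf'.mono (prod_mono hball Subset.rfl))
  have hslice : ContinuousOn (f' x) K :=
    hf'.comp (f := fun z => (x, z)) (by fun_prop) fun z hz => ⟨hx, hz⟩
  have hae : ∀ {P : ℂ → Prop}, (∀ z ∈ K, P z) → ∀ᵐ z ∂(volume.restrict K), P z := fun h =>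
    (ae_restrict_iff' hK.measurableSet).2 (Eventually.of_forall h)
  have hfin : IsFiniteMeasure (volume.restrict K) := ⟨by simpa using hK.measure_lt_top⟩
  refine (hasDerivAt_integral_of_dominated_loc_of_deriv_le
    (F := f) (F' := f') (bound := fun _ => C) (s := closedBall x δ) (closedBall_mem_nhds x hδ)
    ?_ ?_ ?_ ?_ ?_ ?_).2
  · filter_upwards [hS.mem_nhds hx] with y hy
    exact (hf y hy).aestronglyMeasurable hK.measurableSet
  · exact (hf x hx).integrableOn_compact hK
  · exact hslice.aestronglyMeasurable hK.measurableSet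
  · exact hae fun z hz y hy => hC (y, z) ⟨hy, hz⟩
  · exact integrable_const C
  · exact hae fun z hz y hy => hd y (hball hy) z hz

/-- The integral of the truncated conformal factor against the bump function. -/
noncomputable def capIntegral (M : Set (ℂ × ℝ)) (V : ℂ × ℝ → ℝ) (N : ℝ) (p : ℂ) (r t : ℝ) : ℝ :=
  ∫ z in closedBall p r, capExp N (extendBy M V (Real.log N) (z, t)) * bump p r z

section

variable {M : Set (ℂ × ℝ)} {V : ℂ × ℝ → ℝ} {A : ℂ × ℝ → (ℂ × ℝ →L[ℝ] ℝ)}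
  {H : ℂ × ℝ → (ℂ × ℝ →L[ℝ] ℂ × ℝ →L[ℝ] ℝ)} {c N r : ℝ} {p : ℂ} {S : Set ℝ}

theorem LogFlow.continuousOn_capExp (h : LogFlow M V A H) (hN : 0 < N) {O : Set (ℂ × ℝ)}
    (hO : ∀ q ∈ O, q ∉ M → ∀ᶠ x in nhds q, x ∈ M → Real.log N ≤ V x) :
    ContinuousOn (fun q => capExp N (extendBy M V (Real.log N) q)) O := fun q hq =>
  (h.hasFDerivAt_comp_extendBy hO (hasDerivAt_capExp hN)
    (fun v hv => (capExp_eq hN hv).trans (capExp_eq hN le_rfl).symm)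
    (by rw [capSlope_eq_zero hN le_rfl, zero_mul]) hq).continuousAt.continuousWithinAt

theorem LogFlow.hasDerivAt_capIntegral (h : LogFlow M V A H) (hN : 0 < N) (hS : IsOpen S)
    (hO : ∀ q ∈ closedBall p r ×ˢ S, q ∉ M → ∀ᶠ x in nhds q, x ∈ M → Real.log N ≤ V x)
    {t : ℝ} (ht : t ∈ S) :
    ContinuousOn (fun z => capSlope N (extendBy M V (Real.log N) (z, t)) *
        Real.exp (extendBy M V (Real.log N) (z, t)) * A (z, t) (0, 1) * bump p r z)
        (closedBall p r) ∧
    HasDerivAt (capIntegral M V N p r)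
      (∫ z in closedBall p r, capSlope N (extendBy M V (Real.log N) (z, t)) *
        Real.exp (extendBy M V (Real.log N) (z, t)) * A (z, t) (0, 1) * bump p r z) t := by
  have hc : ContinuousOn (fun q : ℂ × ℝ => capSlope N (extendBy M V (Real.log N) q) *
        Real.exp (extendBy M V (Real.log N) q) * A q (0, 1)) (closedBall p r ×ˢ S) :=
    h.continuousOn_mul_extendBy (k := fun v => capSlope N v * Real.exp v) hO
      (h.continuousOn_snd.clm_apply continuousOn_const)
      ((continuous_capSlope N).mul Real.continuous_exp)
      fun v hv => by rw [capSlope_eq_zero hN hv, zero_mul]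
  refine ⟨?_, hasDerivAt_integral_of_isCompact hS (isCompact_closedBall p r)
    (f := fun t z => capExp N (extendBy M V (Real.log N) (z, t)) * bump p r z)
    (f' := fun t z => capSlope N (extendBy M V (Real.log N) (z, t)) *
        Real.exp (extendBy M V (Real.log N) (z, t)) * A (z, t) (0, 1) * bump p r z)
    ?_ ?_ ?_ ht⟩
  · exact (hc.comp (f := fun z => (z, t)) (by fun_prop) fun z hz => ⟨hz, ht⟩).mul
      (continuous_bump p r).continuousOn
  · intro s hs z hz
    have h1 := h.hasFDerivAt_comp_extendBy hO (hasDerivAt_capExp hN)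
      (fun v hv => (capExp_eq hN hv).trans (capExp_eq hN le_rfl).symm)
      (by rw [capSlope_eq_zero hN le_rfl, zero_mul]) (q := (z, s)) ⟨hz, hs⟩
    have h2 := h1.comp_hasDerivAt s ((hasDerivAt_const s z).prodMk (hasDerivAt_id s))
    exact h2.mul_const (bump p r z)
  · intro s hs
    exact ((h.continuousOn_capExp hN hO).comp (f := fun z => (z, s)) (by fun_prop)
      fun z hz => ⟨hz, hs⟩).mul (continuous_bump p r).continuousOn
  · exact (hc.comp (f := fun x : ℝ × ℂ => (x.2, x.1)) (by fun_prop)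
      fun x hx => ⟨hx.2, hx.1⟩).mul ((continuous_bump p r).comp continuous_snd).continuousOn

theorem LogFlow.extendBySnd_add_le (h : LogFlow M V A H) (hN : 0 < N) (q : ℂ × ℝ) :
    extendBySnd M V A H (Real.log N) (capSlope N) (capSlopeDeriv N) 1 q +
      extendBySnd M V A H (Real.log N) (capSlope N) (capSlopeDeriv N) Complex.I q ≤
    capSlope N (extendBy M V (Real.log N) q) * Real.exp (extendBy M V (Real.log N) q) *
      A q (0, 1) := by
  unfold extendBySnd
  by_cases hq : q ∈ M
  · rw [extendBy_of_mem hq, mul_assoc, h.evol q hq]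
    have h1 := capSlopeDeriv_nonpos hN (V q)
    nlinarith [mul_nonneg (neg_nonneg.2 h1) (sq_nonneg (A q (1, 0))),
      mul_nonneg (neg_nonneg.2 h1) (sq_nonneg (A q (Complex.I, 0)))]
  · rw [extendBy_of_notMem hq, capSlope_eq_zero hN le_rfl, capSlopeDeriv_eq_zero hN le_rfl]
    simp

theorem neg_le_capLin_mul {v y b : ℝ} (hc : 0 < c) (hcN : c ≤ N) (hv : Real.log c ≤ v)
    (hb : |b| ≤ 112 * y ^ 2) :
    -(336 * (1 + 1 / c) * (1 + capExp N v * y ^ 4)) ≤ capLin c N v * b := by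
  have h0 := capLin_nonneg (N := N) hv
  have h1 := capLin_sq_le hc hcN hv
  have hf := capExp_nonneg (hc.trans_le hcN) v
  set f := capExp N v
  set l := capLin c N v
  have h2 : |l * b| ≤ 112 * (l * y ^ 2) := by
    rw [abs_mul, abs_of_nonneg h0]
    nlinarith
  have h3 : l * y ^ 2 ≤ 3 * (1 + f / c * y ^ 4) := by
    have hfc : 0 ≤ f / c := by positivity
    have : (l * y ^ 2) ^ 2 ≤ 36 * (f / c) * y ^ 4 := by
      calc (l * y ^ 2) ^ 2 = l ^ 2 * y ^ 4 := by ring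
        _ ≤ 36 * (f / c) * y ^ 4 := by gcongr
    have hX : 0 ≤ f / c * y ^ 4 := by positivity
    refine abs_le_of_sq_le_sq' (?_ : _ ≤ _) (by positivity) |>.2
    nlinarith [sq_nonneg (1 - f / c * y ^ 4)]
  have h4 : f / c * y ^ 4 ≤ 1 / c + (1 + 1 / c) * (f * y ^ 4) := by
    have : 0 ≤ f * y ^ 4 := by positivity
    have e : f / c * y ^ 4 = 1 / c * (f * y ^ 4) := by ring
    have : 0 ≤ 1 / c := by positivity
    rw [e]
    nlinarith
  have := neg_abs_le (l * b)
  nlinarith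

theorem LogFlow.neg_le_deriv_capIntegral (h : LogFlow M V A H) (hc : 0 < c) (hcN : c ≤ N)
    (hO : ∀ q ∈ closedBall p r ×ˢ S, q ∉ M → ∀ᶠ x in nhds q, x ∈ M → Real.log N ≤ V x)
    (hS : IsOpen S) (hr : 0 < r) (hr1 : r ≤ 1) {t : ℝ} (ht : t ∈ S)
    (hV : ∀ z ∈ closedBall p r, (z, t) ∈ M → Real.log c ≤ V (z, t)) :
    -(336 * (1 + 1 / c) * (volume.real (closedBall p r) + capIntegral M V N p r t)) ≤
      ∫ z in closedBall p r, capSlope N (extendBy M V (Real.log N) (z, t)) *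
        Real.exp (extendBy M V (Real.log N) (z, t)) * A (z, t) (0, 1) * bump p r z := by
  have hN := hc.trans_le hcN
  have hsub : closedBall p r ×ˢ {t} ⊆ closedBall p r ×ˢ S :=
    prod_mono Subset.rfl (singleton_subset_iff.2 ht)
  have hKm : MeasurableSet (closedBall p r) := measurableSet_closedBall
  have green := fun e => h.integral_extendBySnd_mul_bump hO (hasDerivAt_capLin c N)
    (hasDerivAt_capSlope N) (continuous_capSlopeDeriv N) (fun v hv => capLin_eq hN hv)
    (fun v hv => capSlope_eq_zero hN hv) (fun v hv => capSlopeDeriv_eq_zero hN hv) hr hsub e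
  obtain ⟨i1, j1, e1⟩ := green 1
  obtain ⟨i2, j2, e2⟩ := green Complex.I
  have hW : ∀ z ∈ closedBall p r, Real.log c ≤ extendBy M V (Real.log N) (z, t) := by
    intro z hz
    by_cases hzM : (z, t) ∈ M
    · rw [extendBy_of_mem hzM]; exact hV z hz hzM
    · rw [extendBy_of_notMem hzM]; exact Real.log_le_log hc hcN
  have hfi : IntegrableOn (fun z => capExp N (extendBy M V (Real.log N) (z, t)) * bump p r z)
      (closedBall p r) :=
    (((h.continuousOn_capExp hN hO).comp (f := fun z => (z, t)) (by fun_prop)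
      fun z hz => ⟨hz, ht⟩).mul (continuous_bump p r).continuousOn).integrableOn_compact
      (isCompact_closedBall p r)
  have h1i : IntegrableOn (fun _ => (1:ℝ)) (closedBall p r) :=
    continuousOn_const.integrableOn_compact (isCompact_closedBall p r)
  have hb : ∀ z ∉ closedBall p r, bumpBase p r z = 0 := fun z hz => bumpBase_eq_zero hr hz
  calc -(336 * (1 + 1 / c) * (volume.real (closedBall p r) + capIntegral M V N p r t))
      = ∫ z in closedBall p r, -(336 * (1 + 1 / c) *
          (1 + capExp N (extendBy M V (Real.log N) (z, t)) * bump p r z)) := by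
        rw [integral_neg, integral_const_mul, integral_add h1i hfi]
        simp [capIntegral]
    _ ≤ ∫ z in closedBall p r, capLin c N (extendBy M V (Real.log N) (z, t)) *
          (bumpSnd p r 1 z + bumpSnd p r Complex.I z) := by
        refine setIntegral_mono_on ?_ ?_ hKm fun z hz => ?_
        · exact Integrable.neg (Integrable.const_mul (Integrable.add h1i hfi) _)
        · simp only [mul_add]
          exact (i1.add i2).integrableOn
        · exact neg_le_capLin_mul hc hcN (hW z hz) (abs_bumpSnd_add_le hr hr1 p z)
    _ = ∫ z, capLin c N (extendBy M V (Real.log N) (z, t)) *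
          (bumpSnd p r 1 z + bumpSnd p r Complex.I z) :=
        setIntegral_eq_integral_of_forall_compl_eq_zero fun z hz => by
          simp [bumpSnd, hb z hz]
    _ = ∫ z, (extendBySnd M V A H (Real.log N) (capSlope N) (capSlopeDeriv N) 1 (z, t) +
          extendBySnd M V A H (Real.log N) (capSlope N) (capSlopeDeriv N) Complex.I (z, t)) *
          bump p r z := by
        simp only [mul_add, add_mul]
        rw [integral_add i1 i2, integral_add j1 j2, e1, e2]
    _ = ∫ z in closedBall p r,
          (extendBySnd M V A H (Real.log N) (capSlope N) (capSlopeDeriv N) 1 (z, t) +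
          extendBySnd M V A H (Real.log N) (capSlope N) (capSlopeDeriv N) Complex.I (z, t)) *
          bump p r z :=
        (setIntegral_eq_integral_of_forall_compl_eq_zero fun z hz => by
          simp [bump, hb z hz]).symm
    _ ≤ _ := by
        refine setIntegral_mono_on ?_ ?_ hKm fun z hz => ?_
        · simp only [add_mul]
          exact (j1.add j2).integrableOn
        · exact (h.hasDerivAt_capIntegral hN hS hO ht).1.integrableOn_compact
            (isCompact_closedBall p r)
        · exact mul_le_mul_of_nonneg_right (h.extendBySnd_add_le hN (z, t)) (bump_nonneg p r z)

theorem LogFlow.capIntegral_le (h : LogFlow M V A H) (hc : 0 < c) (hcN : c ≤ N)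
    (hO : ∀ q ∈ closedBall p r ×ˢ S, q ∉ M → ∀ᶠ x in nhds q, x ∈ M → Real.log N ≤ V x)
    (hS : IsOpen S) (hr : 0 < r) (hr1 : r ≤ 1) {t₀ t₁ : ℝ} (h01 : t₀ ≤ t₁) (ht : Icc t₀ t₁ ⊆ S)
    (hV : ∀ t ∈ Icc t₀ t₁, ∀ z ∈ closedBall p r, (z, t) ∈ M → Real.log c ≤ V (z, t))
    (hM : ∀ z ∈ closedBall p r, (z, t₁) ∈ M) :
    capIntegral M V N p r t₀ ≤ Real.exp (336 * (1 + 1 / c) * (t₁ - t₀)) *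
      (volume.real (closedBall p r) +
        ∫ z in closedBall p r, 3 * Real.exp (V (z, t₁)) * bump p r z) := by
  have hN := hc.trans_le hcN
  set C := 336 * (1 + 1 / c) with hC
  set vol := volume.real (closedBall p r)
  have hd : ∀ t ∈ Icc t₀ t₁, HasDerivAt
      (fun t => Real.exp (C * t) * (vol + capIntegral M V N p r t)) _ t := fun t hts =>
    ((((hasDerivAt_id t).const_mul C).exp).mul
      ((h.hasDerivAt_capIntegral hN hS hO (ht hts)).2.const_add vol))
  have hmono : MonotoneOn (fun t => Real.exp (C * t) * (vol + capIntegral M V N p r t))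
      (Icc t₀ t₁) := by
    refine monotoneOn_of_deriv_nonneg (convex_Icc _ _)
      (fun t hts => (hd t hts).continuousAt.continuousWithinAt) ?_ ?_
    · intro t hts
      rw [interior_Icc] at hts
      exact (hd t (Ioo_subset_Icc_self hts)).differentiableAt.differentiableWithinAt
    · intro t hts
      rw [interior_Icc] at hts
      have hts' := Ioo_subset_Icc_self hts
      rw [(hd t hts').deriv]
      have h1 := h.neg_le_deriv_capIntegral hc hcN hO hS hr hr1 (ht hts') (hV t hts')
      have h2 := Real.exp_pos (C * t)
      rw [← hC] at h1
      simp only [id_eq, mul_one]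
      nlinarith
  have h1 := hmono (left_mem_Icc.2 h01) (right_mem_Icc.2 h01) h01
  simp only at h1
  have hK := isCompact_closedBall p r
  have hVc : ContinuousOn (fun z => V (z, t₁)) (closedBall p r) :=
    h.continuousOn_fst.comp (by fun_prop) hM
  have h2 : capIntegral M V N p r t₁ ≤
      ∫ z in closedBall p r, 3 * Real.exp (V (z, t₁)) * bump p r z := by
    refine setIntegral_mono_on ?_ ?_ measurableSet_closedBall fun z hz => ?_
    · exact (((h.continuousOn_capExp hN hO).comp (f := fun z => (z, t₁)) (by fun_prop)
        fun z hz => ⟨hz, ht (right_mem_Icc.2 h01)⟩).mul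
        (continuous_bump p r).continuousOn).integrableOn_compact hK
    · exact ((continuousOn_const.mul hVc.rexp).mul
        (continuous_bump p r).continuousOn).integrableOn_compact hK
    · rw [extendBy_of_mem (hM z hz)]
      exact mul_le_mul_of_nonneg_right (capExp_le hN _) (bump_nonneg p r z)
  have h3 : 0 ≤ vol := measureReal_nonneg
  have e1 : Real.exp (C * (t₁ - t₀)) = Real.exp (C * t₁) / Real.exp (C * t₀) := by
    rw [← Real.exp_sub]; ring_nf
  rw [e1, div_mul_eq_mul_div, le_div_iff₀ (Real.exp_pos _)]
  have h4 := Real.exp_pos (C * t₀)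
  have h5 := Real.exp_pos (C * t₁)
  nlinarith

end

theorem setLIntegral_le_setLIntegral_abs_sub {a θ₀ δ : ℝ} (hθ : θ₀ ∈ Ioc (-a) a) (hδ : 0 < δ)
    (f : ℝ → ENNReal) :
    ∫⁻ s in Ioo δ a, f s ≤ ∫⁻ θ in Ioo (-a) a, f |θ - θ₀| := by
  rw [← lintegral_indicator measurableSet_Ioo, ← lintegral_indicator measurableSet_Ioo]
  obtain ⟨h1, h2⟩ := hθ
  rcases le_or_gt θ₀ 0 with h | h
  · rw [← lintegral_sub_right_eq_self _ θ₀]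
    refine lintegral_mono fun θ => ?_
    by_cases hm : θ - θ₀ ∈ Ioo δ a
    · rw [indicator_of_mem hm, indicator_of_mem (show θ ∈ Ioo (-a) a from ⟨by linarith [hm.1], by linarith [hm.2]⟩),
        abs_of_pos (hδ.trans hm.1)]
    · rw [indicator_of_notMem hm]
      exact zero_le
  · rw [← lintegral_sub_left_eq_self _ θ₀]
    refine lintegral_mono fun θ => ?_
    by_cases hm : θ₀ - θ ∈ Ioo δ a
    · rw [indicator_of_mem hm, indicator_of_mem (show θ ∈ Ioo (-a) a from ⟨by linarith [hm.2], by linarith [hm.1]⟩),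
        abs_sub_comm, abs_of_pos (hδ.trans hm.1)]
    · rw [indicator_of_notMem hm]
      exact zero_le

theorem setLIntegral_div_id {δ a c : ℝ} (hδ : 0 < δ) (ha : δ < a) (hc : 0 ≤ c) :
    ∫⁻ s in Ioo δ a, ENNReal.ofReal (c / s) = ENNReal.ofReal (c * Real.log (a / δ)) := by
  have hci : ContinuousOn (fun s : ℝ => c / s) (uIcc δ a) := by
    rw [uIcc_of_le ha.le]
    exact continuousOn_const.div continuousOn_id fun s hs => (hδ.trans_le hs.1).ne'
  have hi : IntegrableOn (fun s : ℝ => c / s) (Ioo δ a) :=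
    (hci.intervalIntegrable.1).mono_set Ioo_subset_Ioc_self
  rw [← ofReal_integral_eq_lintegral_ofReal hi, ← integral_Ioc_eq_integral_Ioo,
    ← intervalIntegral.integral_of_le ha.le]
  · simp_rw [div_eq_mul_inv c]
    rw [intervalIntegral.integral_const_mul, integral_inv_of_pos hδ (hδ.trans ha)]
  · refine (ae_restrict_iff' measurableSet_Ioo).2 (Eventually.of_forall fun s hs => ?_)
    exact div_nonneg hc (hδ.trans hs.1).le

theorem norm_polar_sub_le {ρ : ℝ} (hρ : 0 ≤ ρ) (hρ1 : ρ ≤ 1) (k : ℂ) (hk : ‖k‖ = ρ) (θ : ℝ) :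
    ‖Complex.polarCoord.symm (ρ, θ) - k‖ ≤ |θ - Complex.arg k| := by
  have e : Complex.polarCoord.symm (ρ, θ) - k
      = ρ * Complex.exp (Complex.arg k * Complex.I)
        * (Complex.exp (Complex.I * ((θ - Complex.arg k : ℝ) : ℂ)) - 1) := by
    have h1 : Complex.polarCoord.symm (ρ, θ) = ρ * Complex.exp (θ * Complex.I) := by
      rw [Complex.polarCoord_symm_apply, Complex.exp_mul_I]
      push_cast
      rfl
    have h2 : k = ρ * Complex.exp (Complex.arg k * Complex.I) := by
      rw [← hk, Complex.norm_mul_exp_arg_mul_I]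
    generalize Complex.arg k = α at h2 ⊢
    rw [h1, h2, mul_sub, mul_one, mul_assoc, ← Complex.exp_add]
    congr 3
    push_cast
    ring
  rw [e, norm_mul, norm_mul, Complex.norm_exp_ofReal_mul_I, mul_one, Complex.norm_real,
    Real.norm_of_nonneg hρ]
  have := Real.norm_exp_I_mul_ofReal_sub_one_le (x := θ - Complex.arg k)
  rw [Real.norm_eq_abs] at this
  calc ρ * _ ≤ 1 * |θ - Complex.arg k| := by gcongr
    _ = _ := one_mul _

theorem norm_polarCoord_symm {ρ : ℝ} (hρ : 0 ≤ ρ) (θ : ℝ) :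
    ‖Complex.polarCoord.symm (ρ, θ)‖ = ρ := by
  rw [Complex.norm_polarCoord_symm, abs_of_nonneg hρ]

/-- Integrating in polar coordinates, a function with a singularity `c / s` on every circle
of an annulus has integral at least a multiple of a logarithm. -/
theorem ofReal_log_le_lintegral {G : ℂ → ENNReal} (hG : Measurable G) {a b c δ : ℝ} (ha : 0 < a)
    (hb : b ≤ 1) (hc : 0 ≤ c) (hδ : 0 < δ) (hδπ : δ < Real.pi)
    (h : ∀ ρ ∈ Ioo a b, ∃ k : ℂ, ‖k‖ = ρ ∧
      ∀ z : ℂ, ‖z‖ = ρ → ∀ s > δ, ‖z - k‖ ≤ s → ENNReal.ofReal (c / s) ≤ G z) :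
    ENNReal.ofReal (a * (b - a) * (c * Real.log (Real.pi / δ))) ≤ ∫⁻ z, G z := by
  have hsymm : Measurable (fun x : ℝ × ℝ => Complex.polarCoord.symm x) := by
    simp_rw [Complex.polarCoord_symm_apply]
    fun_prop
  have hlog : 0 ≤ c * Real.log (Real.pi / δ) :=
    mul_nonneg hc (Real.log_nonneg ((one_le_div hδ).2 hδπ.le))
  rw [← Complex.lintegral_comp_polarCoord_symm]
  have hsub : Ioo a b ×ˢ Ioo (-Real.pi) Real.pi ⊆ Complex.polarCoord.target := by
    rintro ⟨x, y⟩ ⟨hx, hy⟩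
    exact ⟨ha.trans hx.1, hy⟩
  refine le_trans ?_ (lintegral_mono_set hsub)
  rw [Measure.volume_eq_prod, setLIntegral_prod]
  swap
  · exact ((ENNReal.measurable_ofReal.comp measurable_fst).smul (hG.comp hsymm)).aemeasurable
  have key : ∀ ρ ∈ Ioo a b, ENNReal.ofReal (a * (c * Real.log (Real.pi / δ))) ≤
      ∫⁻ θ in Ioo (-Real.pi) Real.pi, ENNReal.ofReal ρ • G (Complex.polarCoord.symm (ρ, θ)) := by
    intro ρ hρ
    have hρ0 : 0 ≤ ρ := (ha.trans hρ.1).le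
    obtain ⟨k, hk, hkG⟩ := h ρ hρ
    simp_rw [smul_eq_mul]
    have hm : Measurable fun θ : ℝ => G (Complex.polarCoord.symm (ρ, θ)) :=
      hG.comp (hsymm.comp measurable_prodMk_left)
    rw [lintegral_const_mul _ hm,
      ENNReal.ofReal_mul ha.le]
    refine mul_le_mul' (ENNReal.ofReal_le_ofReal hρ.1.le) ?_
    rw [← setLIntegral_div_id hδ hδπ hc, ← lintegral_indicator measurableSet_Ioo]
    have h1 := setLIntegral_le_setLIntegral_abs_sub (Complex.arg_mem_Ioc k) hδ
      ((Ioo δ Real.pi).indicator fun s => ENNReal.ofReal (c / s))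
    rw [setLIntegral_indicator measurableSet_Ioo, inter_self] at h1
    rw [lintegral_indicator measurableSet_Ioo]
    refine h1.trans (lintegral_mono fun θ => ?_)
    by_cases hm : |θ - Complex.arg k| ∈ Ioo δ Real.pi
    · rw [indicator_of_mem hm]
      exact hkG _ (norm_polarCoord_symm hρ0 θ) _ hm.1
        (norm_polar_sub_le hρ0 (hρ.2.le.trans hb) k hk θ)
    · rw [indicator_of_notMem hm]
      exact zero_le
  refine le_trans ?_ (setLIntegral_mono' measurableSet_Ioo key)
  rw [setLIntegral_const, Real.volume_Ioo,
    ← ENNReal.ofReal_mul (mul_nonneg ha.le hlog)]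
  exact ENNReal.ofReal_le_ofReal (le_of_eq (by ring))

theorem exists_circle {K : Set ℂ} {p : ℂ} {r c C N₀ : ℝ} {F : ℝ → ℂ → ℝ} (hr : 0 < r) (hr1 : r ≤ 1)
    (hc : 0 < c) (hF : ∀ N ≥ N₀, ContinuousOn (F N) (closedBall p r))
    (hF0 : ∀ N ≥ N₀, ∀ z, 0 ≤ F N z)
    (hC : ∀ N ≥ N₀, ∫ z in closedBall p r, F N z * bump p r z ≤ C)
    (hK : ∀ N ≥ N₀, ∀ z ∈ closedBall p r, ∀ k ∈ K, ∀ s > 0, ‖z - k‖ ≤ s → min (c / s) N ≤ F N z) :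
    ∃ ϱ ∈ Ioo 0 r, ∀ z, ‖z - p‖ = ϱ → z ∉ K := by
  by_contra! hcon
  set β : ℝ := (r ^ 2 - (r / 2) ^ 2) ^ 4 with hβ
  have hβ0 : 0 < β := by
    have : 0 < r ^ 2 - (r / 2) ^ 2 := by nlinarith
    positivity
  have main : ∀ N ≥ N₀, 0 < N → c / N < Real.pi →
      r / 4 * (r / 2 - r / 4) * (β * c * Real.log (Real.pi / (c / N))) ≤ C := by
    intro N hN hN0 hNπ
    set g : ℂ → ℝ := (closedBall p r).indicator fun z => F N z * bump p r z with hg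
    have hg0 : ∀ z, 0 ≤ g z := fun z =>
      indicator_nonneg (fun z _ => mul_nonneg (hF0 N hN z) (bump_nonneg p r z)) z
    have hcont : ContinuousOn (fun z => F N z * bump p r z) (closedBall p r) :=
      (hF N hN).mul (continuous_bump p r).continuousOn
    have hgm : Measurable g := by
      classical
      rw [hg, ← piecewise_eq_indicator]
      exact hcont.measurable_piecewise continuousOn_const measurableSet_closedBall
    have hgi : Integrable g :=
      (hcont.integrableOn_compact (isCompact_closedBall p r)).integrable_indicator
        measurableSet_closedBall
    have hgC : ∫ z, g z ≤ C := by
      rw [hg, integral_indicator measurableSet_closedBall]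
      exact hC N hN
    have h1 := ofReal_log_le_lintegral (G := fun z => ENNReal.ofReal (g (z + p)))
      (a := r / 4) (b := r / 2) (c := β * c) (δ := c / N)
      (ENNReal.measurable_ofReal.comp (hgm.comp (measurable_id.add_const p)))
      (by linarith) (by linarith) (by positivity) (by positivity) hNπ ?_
    · rw [lintegral_add_right_eq_self (fun z => ENNReal.ofReal (g z)) p,
        ← ofReal_integral_eq_lintegral_ofReal hgi (Eventually.of_forall hg0)] at h1
      exact ((ENNReal.ofReal_le_ofReal_iff (integral_nonneg hg0)).1 h1).trans hgC
    · intro ρ hρ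
      obtain ⟨k, hk, hkK⟩ := hcon ρ ⟨by linarith [hρ.1], by linarith [hρ.2]⟩
      refine ⟨k - p, hk, fun z hz s hs hzs => ENNReal.ofReal_le_ofReal ?_⟩
      have hs0 : 0 < s := lt_trans (by positivity) hs
      have hmem : z + p ∈ closedBall p r := by
        rw [mem_closedBall, dist_eq_norm, add_sub_cancel_right, hz]
        linarith [hρ.2]
      have h2 := hK N hN _ hmem k hkK s hs0 (by convert hzs using 2; ring)
      rw [min_eq_left ((div_le_comm₀ hs0 hN0).2 hs.le)] at h2
      have h3 : β ≤ bump p r (z + p) := by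
        have : r ^ 2 - (r / 2) ^ 2 ≤ bumpBase p r (z + p) := by
          refine le_max_of_le_right ?_
          rw [add_sub_cancel_right, hz]
          nlinarith [hρ.1, hρ.2]
        exact pow_le_pow_left₀ (by nlinarith) this 4
      rw [hg, indicator_of_mem hmem, mul_div_assoc, mul_comm]
      exact mul_le_mul h2 h3 hβ0.le (hF0 N hN _)
  have hlim : Tendsto (fun N : ℝ => r / 4 * (r / 2 - r / 4) *
      (β * c * Real.log (Real.pi / (c / N)))) atTop atTop := by
    refine Tendsto.const_mul_atTop (by nlinarith) (Tendsto.const_mul_atTop (by positivity) ?_)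
    refine Real.tendsto_log_atTop.comp ?_
    have : (fun N : ℝ => Real.pi / (c / N)) = fun N => Real.pi / c * N := by
      funext N
      rw [div_div_eq_mul_div, div_mul_eq_mul_div]
    rw [this]
    exact tendsto_id.const_mul_atTop (by positivity)
  obtain ⟨N, h1, h2, h3, h4⟩ := ((hlim.eventually_gt_atTop C).and ((eventually_ge_atTop N₀).and
    ((eventually_gt_atTop 0).and (eventually_gt_atTop (c / Real.pi))))).exists
  exact absurd (main N h2 h3 ((div_lt_comm₀ h3 Real.pi_pos).2 h4)) (not_le.2 h1)

/-- A closed disk whose boundary circle has entered the spacetime is filled from then on. -/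
theorem ConfRFS.closedBall_subset_timeSlice {T : ℝ} {M : Set (ℂ × ℝ)} {u : ℂ → ℝ → ℝ}
    (hRF : ConfRFS T M u) (hexp : Expanding T M) (hcts : ContinuousSpacetime T M)
    {p : ℂ} {ϱ t₀ t₁ : ℝ} (h0 : 0 < t₀) (h01 : t₀ ≤ t₁) (h1T : t₁ < T)
    (hcirc : ∀ z, ‖z - p‖ = ϱ → (z, t₀) ∈ M) (h1 : ∀ z ∈ closedBall p ϱ, (z, t₁) ∈ M) :
    ∀ z ∈ closedBall p ϱ, (z, t₀) ∈ M := by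
  by_contra! hcon
  set Z : Set ℝ := {t | t ∈ Icc t₀ t₁ ∧ ∃ q ∈ closedBall p ϱ, (q, t) ∉ M} with hZ
  have hZne : Z.Nonempty := ⟨t₀, ⟨le_rfl, h01⟩, hcon⟩
  have hZb : BddAbove Z := ⟨t₁, fun t ht => ht.1.2⟩
  set m := sSup Z with hm
  have hm0 : t₀ ≤ m := le_csSup hZb ⟨⟨le_rfl, h01⟩, hcon⟩
  have hm1 : m ≤ t₁ := csSup_le hZne fun t ht => ht.1.2
  have hmZ : ∃ q ∈ closedBall p ϱ, (q, m) ∉ M := by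
    by_contra! hall
    obtain ⟨U, W, hU, hW, hKU, hmW, hUW⟩ := generalized_tube_lemma (isCompact_closedBall p ϱ)
      (isCompact_singleton (x := m)) hRF.opn (by rintro ⟨z, t⟩ ⟨hz, rfl⟩; exact hall z hz)
    obtain ⟨ε, hε, hball⟩ := Metric.isOpen_iff.1 hW m (hmW rfl)
    obtain ⟨t, ⟨ht, q, hq, hqM⟩, hlt⟩ := exists_lt_of_lt_csSup hZne (sub_lt_self m hε)
    refine hqM (hUW ⟨hKU hq, hball ?_⟩)
    have : t ≤ m := le_csSup hZb ⟨ht, q, hq, hqM⟩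
    rw [mem_ball, Real.dist_eq, abs_lt]
    constructor <;> linarith
  obtain ⟨q, hq, hqM⟩ := hmZ
  have hmlt : m < t₁ := lt_of_le_of_ne hm1 fun h => hqM (h ▸ h1 q hq)
  have hqb : q ∈ ball p ϱ := by
    rw [mem_closedBall, dist_eq_norm] at hq
    rw [mem_ball, dist_eq_norm]
    exact lt_of_le_of_ne hq fun h => hqM (hexp q t₀ m (hcirc q h) hm0 (by linarith))
  obtain ⟨q', hq', t', ht', hqM'⟩ := exists_notMem_later hcts ⟨by linarith, by linarith⟩ hqM
    isOpen_ball hqb one_pos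
  have hmem : min t' t₁ ∈ Z := by
    refine ⟨⟨le_min (by linarith [ht'.1]) h01, min_le_right _ _⟩, q', ball_subset_closedBall hq'.2,
      fun h => hqM' (hexp q' _ t' h (min_le_left _ _) ht'.2)⟩
  exact absurd (le_csSup hZb hmem) (not_le.2 <| lt_min ht'.1 hmlt)

/-- Rigidity of spacetimes in the disk: a complete, expanding, continuous and
initially determined conformal Ricci flow spacetime in `D × (0,T)` whose slices exhaust the
unit disk is the whole cylinder `D × (0,T)`. -/
theorem rigidity_in_disk
    (T : ℝ) (hT : 0 < T) (M : Set (ℂ × ℝ)) (u : ℂ → ℝ → ℝ)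
    (hRF : ConfRFS T M u)
    (hD : M ⊆ (Metric.ball (0:ℂ) 1) ×ˢ Ioo 0 T)
    (hcomp : ConfRFSComplete T M u)
    (hexp : Expanding T M) (hcts : ContinuousSpacetime T M)
    (hid : InitiallyDetermined M)
    (hexh : (⋃ t ∈ Ioo (0:ℝ) T, timeSlice M t) = Metric.ball (0:ℂ) 1) :
    M = (Metric.ball (0:ℂ) 1) ×ˢ Ioo 0 T := by
  refine hD.antisymm ?_
  by_contra hnot
  obtain ⟨⟨p, s⟩, ⟨hp, hs⟩, hps⟩ := not_subset.1 hnot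
  have hexi : ∃ b ∈ Ioo 0 T, (p, b) ∈ M := by
    have hp' : p ∈ ⋃ t ∈ Ioo (0:ℝ) T, timeSlice M t := hexh ▸ hp
    simpa [timeSlice] using hp'
  obtain ⟨b, hb, hpb⟩ := hexi
  set Y : Set ℝ := {t | t ∈ Ioo 0 T ∧ (p, t) ∉ M} with hY
  have hYb : ∀ t ∈ Y, t < b := fun t ht => not_le.1 fun h => ht.2 (hexp p b t hpb h ht.1.2)
  have hYne : Y.Nonempty := ⟨s, hs, hps⟩
  have hYbdd : BddAbove Y := ⟨b, fun t ht => (hYb t ht).le⟩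
  set t₀ := sSup Y with ht₀
  have h0 : 0 < t₀ := hs.1.trans_le (le_csSup hYbdd ⟨hs, hps⟩)
  have h0T : t₀ < T := (csSup_le hYne fun t ht => (hYb t ht).le).trans_lt hb.2
  have hpt₀ : (p, t₀) ∉ M := by
    intro h
    obtain ⟨ε, hε, hball⟩ := Metric.isOpen_iff.1 hRF.opn _ h
    obtain ⟨t, ht, hlt⟩ := exists_lt_of_lt_csSup hYne (sub_lt_self t₀ hε)
    have htt : t ≤ t₀ := le_csSup hYbdd ht
    refine ht.2 (hball ?_)
    rw [mem_ball, Prod.dist_eq, dist_self, Real.dist_eq]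
    refine max_lt hε ?_
    rw [abs_lt]
    constructor <;> linarith
  have hlow : ∀ k z t, (z, t) ∈ M → k ∈ ball (0:ℂ) 1 → (k, t) ∉ M →
      2 * t * Real.exp (-3) / ‖z - k‖ ≤ u z t := fun k z t hz hk hkt =>
    div_norm_sub_le_conf hRF hD hcomp hexp hid hz hk hkt
  obtain ⟨q, hq, t₁, ht₁, hqt₁⟩ := exists_notMem_later hcts ⟨h0, h0T⟩ hpt₀ isOpen_ball hp one_pos
  replace hq := hq.2
  have hpt₁ : (p, t₁) ∈ M := by
    by_contra h
    exact absurd (le_csSup hYbdd ⟨⟨h0.trans ht₁.1, ht₁.2⟩, h⟩) (not_le.2 ht₁.1)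
  obtain ⟨r₀, hr₀, hball⟩ := Metric.nhds_basis_closedBall.mem_iff.1
    ((isOpen_timeSlice hRF.opn t₁).mem_nhds hpt₁)
  set r := min r₀ 1
  have hr : 0 < r := lt_min hr₀ one_pos
  have hr1 : r ≤ 1 := min_le_right _ _
  have hB₁ : ∀ z ∈ closedBall p r, (z, t₁) ∈ M := fun z hz =>
    hball (closedBall_subset_closedBall (min_le_left _ _) hz)
  have hBD : ∀ z ∈ closedBall p r, z ∈ ball (0:ℂ) 1 := fun z hz => (hD (hB₁ z hz)).1
  set c := t₀ * Real.exp (-3) with hc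
  have hc0 : 0 < c := by positivity
  obtain ⟨A, H, hlog⟩ := hRF.exists_logFlow
  set V : ℂ × ℝ → ℝ := fun x => Real.log (u x.1 x.2) with hV
  have hVlow : ∀ t ∈ Icc t₀ t₁, ∀ z ∈ closedBall p r, (z, t) ∈ M → Real.log c ≤ V (z, t) := by
    intro t ht z hz hzM
    refine Real.log_le_log hc0 (le_trans ?_ (hlow q z t hzM hq fun h =>
      hqt₁ (hexp q t t₁ h ht.2 ht₁.2)))
    have hzq : 0 < ‖z - q‖ := by
      rw [norm_pos_iff, sub_ne_zero]
      rintro rfl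
      exact hqt₁ (hexp z t t₁ hzM ht.2 ht₁.2)
    have h2 : ‖z - q‖ ≤ 2 := by
      have h3 := hBD z hz
      rw [mem_ball_zero_iff] at h3 hq
      linarith [norm_sub_le z q]
    rw [le_div_iff₀ hzq, hc]
    have h4 : t₀ * Real.exp (-3) ≤ t * Real.exp (-3) := by gcongr; exact ht.1
    nlinarith
  have hO : ∀ N : ℝ, ∀ x ∈ closedBall p r ×ˢ Ioo 0 T, x ∉ M →
      ∀ᶠ y in nhds x, y ∈ M → Real.log N ≤ V y := fun N x hx hxM =>
    eventually_le_log_conf hRF hexp hcts hlow _ ⟨hBD _ hx.1, hx.2⟩ hxM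
  obtain ⟨ϱ, hϱ, hcirc⟩ := exists_circle (p := p) (r := r) (c := 2 * c) (N₀ := c)
    (K := {k | k ∈ ball (0:ℂ) 1 ∧ (k, t₀) ∉ M})
    (F := fun N z => capExp N (extendBy M V (Real.log N) (z, t₀))) hr hr1 (by positivity)
    (fun N hN => (hlog.continuousOn_capExp (hc0.trans_le hN) (hO N)).comp (f := fun z => (z, t₀))
      (by fun_prop) fun z hz => ⟨hz, h0, h0T⟩)
    (fun N hN z => capExp_nonneg (hc0.trans_le hN) _)
    (fun N hN => hlog.capIntegral_le hc0 hN (hO N) isOpen_Ioo hr hr1 ht₁.1.le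
      (fun t ht => ⟨h0.trans_le ht.1, ht.2.trans_lt ht₁.2⟩) hVlow hB₁)
    (by
      intro N hN z hz k hk s hs hzs
      have hN0 := hc0.trans_le hN
      by_cases hzM : (z, t₀) ∈ M
      · rw [extendBy_of_mem hzM]
        refine le_trans (min_le_min_right _ ?_) (min_le_capExp hN0 _)
        rw [hV, Real.exp_log (hRF.pos _ hzM)]
        refine le_trans ?_ (hlow k z t₀ hzM hk.1 hk.2)
        have hzk : 0 < ‖z - k‖ := by
          rw [norm_pos_iff, sub_ne_zero]
          rintro rfl
          exact hk.2 hzM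
        rw [mul_assoc]
        gcongr
      · rw [extendBy_of_notMem hzM, capExp_eq hN0 le_rfl]
        exact min_le_right _ _)
  have hsub : closedBall p ϱ ⊆ closedBall p r := closedBall_subset_closedBall hϱ.2.le
  refine hpt₀ (hRF.closedBall_subset_timeSlice hexp hcts h0 ht₁.1.le ht₁.2 (fun z hz => ?_)
    (fun z hz => hB₁ z (hsub hz)) p (mem_closedBall_self hϱ.1.le))
  by_contra h
  refine hcirc z hz ⟨hBD z (hsub ?_), h⟩
  rw [mem_closedBall, dist_eq_norm, hz]
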